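/- arXiv:2602.23631 — 4 statements merged into one kernel-verified Lean document; each statement's English description precedes it below -/
import Mathlib

section
/- Theorem (W-symmetric polygons; Theorem 6.1). Assume n = 2 and let K ⊆ {1, 2}; the full-dimensional W-symmetric polygon P = conv(⋃_{w ∈ W} w(Λ)) is allowed to be degenerate. Then: (i) every s ∈ W_K maps facets (edges) of P to facets of P with s(ℓ_F) = ℓ_{s(F)}, and the automorphism of ℝ[X_F : F ∈ 𝔉(P)] determined by X_F ↦ X_{s(F)} maps the ideal I_P + J_P onto itself, so that W_K acts on 𝒜(P) by ℝ-algebra automorphisms; (ii) P ∩ C_K is a full-dimensional polygon, and there exists an ℝ-algebra isomorphism between 𝒜(P ∩ C_K) and the invariant subalgebra 𝒜(P)^{W_K} of elements of 𝒜(P) fixed by every element of W_K. -/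
open scoped RealInnerProductSpace

noncomputable section

variable {V : Type*} [NormedAddCommGroup V] [InnerProductSpace ℝ V]

/-- The reflection `r_α` across the hyperplane orthogonal to `α`:
`r_α(x) = x − (2⟪x,α⟫/⟪α,α⟫) α`. -/
def reflMap (α : V) : V → V := fun x => x - (2 * ⟪x, α⟫ / ⟪α, α⟫) • α

/-- The hyperplane `H_α = {x | ⟪x, α⟫ = 0}` fixed by `reflMap α`. -/
def hplane (α : V) : Set V := {x : V | ⟪x, α⟫ = 0}

/-- `F` is a facet of the full-dimensional polytope `Q`: an exposed face whose affine
span has dimension `n − 1` (where `n = dim V`). -/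
def IsFacet (Q F : Set V) : Prop :=
  IsExposed ℝ Q F ∧ Module.finrank ℝ (affineSpan ℝ F).direction + 1 = Module.finrank ℝ V

open Classical in
/-- The barycenter of a nonempty face: the centroid of its finitely many extreme points. -/
def barycenter (F : Set V) : V :=
  if h : (Set.extremePoints ℝ F).Finite then h.toFinset.centroid ℝ id else 0

/-- A full-dimensional polytope is simple if every extreme point lies in exactly `n` facets. -/
def IsSimple (Q : Set V) : Prop :=
  ∀ v ∈ Set.extremePoints ℝ Q, {F : Set V | IsFacet Q F ∧ v ∈ F}.ncard = Module.finrank ℝ V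

/-- The cone `C_K = {x | ⟪x, α_k⟫ ≥ 0 for all k ∈ K}`. -/
def cham {n : ℕ} (α : Fin n → V) (K : Set (Fin n)) : Set V :=
  {x : V | ∀ k ∈ K, 0 ≤ ⟪x, α k⟫}

/-- The parabolic subgroup `W_K`, realized as the submonoid of `Function.End V`
generated by the simple reflections `r_{α_k}`, `k ∈ K` (since each generator is an
involution, this submonoid coincides with the generated group). -/
def WK {n : ℕ} (α : Fin n → V) (K : Set (Fin n)) : Submonoid (Function.End V) :=
  Submonoid.closure {g : Function.End V | ∃ k ∈ K, g = reflMap (α k)}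

/-- A reduced root system of full rank `n` in `V` with a fixed simple system `α`. -/
structure RootSystemData (V : Type*) [NormedAddCommGroup V] [InnerProductSpace ℝ V]
    (n : ℕ) : Type _ where
  α : Fin n → V
  R : Set V
  hn : 1 ≤ n
  hdim : Module.finrank ℝ V = n
  hR_fin : R.Finite
  hR_ne0 : ∀ β ∈ R, β ≠ 0
  hR_refl : ∀ β ∈ R, reflMap β '' R = R
  hR_red : ∀ β ∈ R, R ∩ {x : V | ∃ c : ℝ, x = c • β} = {β, -β}
  hα_mem : ∀ i, α i ∈ R
  hα_indep : LinearIndependent ℝ α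
  hα_span : Submodule.span ℝ (Set.range α) = ⊤
  hα_sign : ∀ β ∈ R, ∃ c : Fin n → ℝ, β = ∑ i, c i • α i ∧
    ((∀ i, 0 ≤ c i) ∨ (∀ i, c i ≤ 0))

/-- A `W`-symmetric polytope datum: a root system together with a finite nonempty
set `Λ` contained in the fundamental chamber `C_S`. -/
structure PermSetup (V : Type*) [NormedAddCommGroup V] [InnerProductSpace ℝ V]
    (n : ℕ) extends RootSystemData V n where
  Λ : Set V
  hΛ_fin : Λ.Finite
  hΛ_ne : Λ.Nonempty
  hΛ_cham : Λ ⊆ cham α Set.univ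

/-- The `W`-symmetric polytope `P = conv(⋃_{w ∈ W} w(Λ))`. -/
def PermSetup.P {n : ℕ} (S : PermSetup V n) : Set V :=
  convexHull ℝ (⋃ w ∈ WK S.α Set.univ, Set.image w S.Λ)

/-- `P` is nondegenerate: `⟪λ, α_i⟫ > 0` for every `λ ∈ Λ` and every `i`. -/
def PermSetup.Nondegenerate {n : ℕ} (S : PermSetup V n) : Prop :=
  ∀ l ∈ S.Λ, ∀ i, 0 < ⟪l, S.α i⟫

/-- The type of facets of `Q`. -/
abbrev Facets (Q : Set V) := {F : Set V // IsFacet Q F}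

/-- `u` is the unit outward normal of the facet `F` of `Q`. -/
def IsOutwardNormal (Q F : Set V) (u : V) : Prop :=
  ‖u‖ = 1 ∧ F = {x ∈ Q | ∀ y ∈ Q, ⟪u, y⟫ ≤ ⟪u, x⟫}

open Classical in
/-- The unit outward normal `ℓ_F` of a facet `F` of `Q`. -/
def normalVec (Q F : Set V) : V :=
  if h : ∃ u : V, IsOutwardNormal Q F u then h.choose else 0

/-- The Stanley–Reisner ideal `I_Q`, generated by the square-free monomials
`X_{F_1} ⋯ X_{F_p}` with `F_1 ∩ ⋯ ∩ F_p = ∅`. -/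
def srIdeal (Q : Set V) : Ideal (MvPolynomial (Facets Q) ℝ) :=
  Ideal.span {p | ∃ t : Finset (Facets Q), (⋂ F ∈ t, (F.1 : Set V)) = ∅ ∧
    p = ∏ F ∈ t, MvPolynomial.X F}

/-- The ideal `J_Q` generated by the linear forms `∑_F ⟪u, ℓ_F⟫ X_F` for `u ∈ V`. -/
def linIdeal (Q : Set V) : Ideal (MvPolynomial (Facets Q) ℝ) :=
  Ideal.span {p | ∃ u : V,
    p = ∑ᶠ F : Facets Q, MvPolynomial.C ⟪u, normalVec Q F.1⟫ * MvPolynomial.X F}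

/-- The ideal `I_Q + J_Q`. -/
def polyIdeal (Q : Set V) : Ideal (MvPolynomial (Facets Q) ℝ) := srIdeal Q + linIdeal Q

/-- The polytopal algebra `𝒜(Q) = ℝ[X_F : F ∈ 𝔉(Q)]/(I_Q + J_Q)`. -/
abbrev PolyAlg (Q : Set V) := MvPolynomial (Facets Q) ℝ ⧸ polyIdeal Q

/-- The quotient map onto the polytopal algebra. -/
def polyMk (Q : Set V) : MvPolynomial (Facets Q) ℝ →ₐ[ℝ] PolyAlg Q :=
  Ideal.Quotient.mkₐ ℝ (polyIdeal Q)

/-- The invariant subalgebra of an action `ρ` of a monoid `G` by `ℝ`-algebra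
automorphisms: the elements fixed by every `ρ g`. -/
def invariants {A : Type*} [CommRing A] [Algebra ℝ A] {G : Type*} [Monoid G]
    (ρ : G →* (A ≃ₐ[ℝ] A)) : Subalgebra ℝ A where
  carrier := {a : A | ∀ g : G, ρ g a = a}
  mul_mem' := fun {a b} ha hb g => by
    simp only [Set.mem_setOf_eq] at ha hb ⊢
    rw [map_mul, ha g, hb g]
  one_mem' := fun g => map_one (ρ g)
  add_mem' := fun {a b} ha hb g => by
    simp only [Set.mem_setOf_eq] at ha hb ⊢
    rw [map_add, ha g, hb g]
  zero_mem' := fun g => map_zero (ρ g)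
  algebraMap_mem' := fun r g => (ρ g).commutes r

/-- The graded algebra `ℝ ⊕ L ⊕ ℝ` in which two elements `x, y` of `L` multiply to
`b x y + b y x` in the last summand. -/
@[ext] structure QuadAlg {L : Type*} [AddCommGroup L] [Module ℝ L]
    (b : LinearMap.BilinForm ℝ L) where
  low : ℝ
  mid : L
  top : ℝ

namespace QuadAlg

variable {L : Type*} [AddCommGroup L] [Module ℝ L] {b : LinearMap.BilinForm ℝ L}

instance : Zero (QuadAlg b) := ⟨⟨0, 0, 0⟩⟩
instance : One (QuadAlg b) := ⟨⟨1, 0, 0⟩⟩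
instance : Add (QuadAlg b) := ⟨fun x y => ⟨x.low + y.low, x.mid + y.mid, x.top + y.top⟩⟩
instance : Neg (QuadAlg b) := ⟨fun x => ⟨-x.low, -x.mid, -x.top⟩⟩
instance : Mul (QuadAlg b) := ⟨fun x y => ⟨x.low * y.low, x.low • y.mid + y.low • x.mid,
  x.low * y.top + y.low * x.top + (b x.mid y.mid + b y.mid x.mid)⟩⟩

@[simp] lemma low_zero : (0 : QuadAlg b).low = 0 := rfl
@[simp] lemma mid_zero : (0 : QuadAlg b).mid = 0 := rfl
@[simp] lemma top_zero : (0 : QuadAlg b).top = 0 := rfl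
@[simp] lemma low_one : (1 : QuadAlg b).low = 1 := rfl
@[simp] lemma mid_one : (1 : QuadAlg b).mid = 0 := rfl
@[simp] lemma top_one : (1 : QuadAlg b).top = 0 := rfl
@[simp] lemma low_add (x y : QuadAlg b) : (x + y).low = x.low + y.low := rfl
@[simp] lemma mid_add (x y : QuadAlg b) : (x + y).mid = x.mid + y.mid := rfl
@[simp] lemma top_add (x y : QuadAlg b) : (x + y).top = x.top + y.top := rfl
@[simp] lemma low_neg (x : QuadAlg b) : (-x).low = -x.low := rfl
@[simp] lemma mid_neg (x : QuadAlg b) : (-x).mid = -x.mid := rfl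
@[simp] lemma top_neg (x : QuadAlg b) : (-x).top = -x.top := rfl
@[simp] lemma low_mul (x y : QuadAlg b) : (x * y).low = x.low * y.low := rfl
@[simp] lemma mid_mul (x y : QuadAlg b) :
    (x * y).mid = x.low • y.mid + y.low • x.mid := rfl
@[simp] lemma top_mul (x y : QuadAlg b) : (x * y).top =
    x.low * y.top + y.low * x.top + (b x.mid y.mid + b y.mid x.mid) := rfl

instance : CommRing (QuadAlg b) where
  add_assoc x y z := by ext <;> simp [add_assoc]
  zero_add x := by ext <;> simp
  add_zero x := by ext <;> simp
  add_comm x y := by ext <;> simp [add_comm]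
  nsmul := nsmulRec
  zsmul := zsmulRec
  neg_add_cancel x := by ext <;> simp
  mul_assoc x y z := by
    ext
    · simp [mul_assoc]
    · simp only [mid_mul, low_mul]; module
    · simp only [mid_mul, low_mul, top_mul, map_add, map_smul, LinearMap.add_apply,
        LinearMap.smul_apply, smul_eq_mul]; ring
  one_mul x := by ext <;> simp
  mul_one x := by ext <;> simp
  mul_comm x y := by
    ext
    · simp [mul_comm]
    · simp only [mid_mul]; module
    · simp only [top_mul]; ring
  left_distrib x y z := by
    ext
    · simp [mul_add]
    · simp only [mid_mul, mid_add, low_add]; module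
    · simp only [low_add, mid_add, top_mul, top_add, map_add, LinearMap.add_apply]; ring
  right_distrib x y z := by
    ext
    · simp [add_mul]
    · simp only [mid_mul, mid_add, low_add]; module
    · simp only [low_add, mid_add, top_mul, top_add, map_add, LinearMap.add_apply]; ring
  zero_mul x := by ext <;> simp
  mul_zero x := by ext <;> simp

instance : Algebra ℝ (QuadAlg b) :=
  RingHom.toAlgebra
    { toFun := fun r => ⟨r, 0, 0⟩
      map_one' := rfl
      map_mul' := fun x y => by ext <;> simp
      map_zero' := rfl
      map_add' := fun x y => by ext <;> simp }

@[simp] lemma low_algebraMap (r : ℝ) : (algebraMap ℝ (QuadAlg b) r).low = r := rfl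
@[simp] lemma mid_algebraMap (r : ℝ) : (algebraMap ℝ (QuadAlg b) r).mid = 0 := rfl
@[simp] lemma top_algebraMap (r : ℝ) : (algebraMap ℝ (QuadAlg b) r).top = 0 := rfl
@[simp] lemma low_smul (r : ℝ) (x : QuadAlg b) : (r • x).low = r * x.low := by
  simp [Algebra.smul_def]
@[simp] lemma mid_smul (r : ℝ) (x : QuadAlg b) : (r • x).mid = r • x.mid := by
  simp [Algebra.smul_def]
@[simp] lemma top_smul (r : ℝ) (x : QuadAlg b) : (r • x).top = r * x.top := by
  simp [Algebra.smul_def]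

/-- The inclusion of the middle summand. -/
def inMid (b : LinearMap.BilinForm ℝ L) : L →ₗ[ℝ] QuadAlg b where
  toFun x := ⟨0, x, 0⟩
  map_add' x y := by ext <;> simp
  map_smul' r x := by ext <;> simp

@[simp] lemma low_inMid (x : L) : (inMid b x).low = 0 := rfl
@[simp] lemma mid_inMid (x : L) : (inMid b x).mid = x := rfl
@[simp] lemma top_inMid (x : L) : (inMid b x).top = 0 := rfl

/-- An isometry of `L` induces an algebra endomorphism. -/
def mapMid (f : L →ₗ[ℝ] L) (hf : ∀ x y, b (f x) (f y) = b x y) :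
    QuadAlg b →ₐ[ℝ] QuadAlg b where
  toFun x := ⟨x.low, f x.mid, x.top⟩
  map_one' := by ext <;> simp
  map_mul' x y := by ext <;> simp [hf]
  map_zero' := by ext <;> simp
  map_add' x y := by ext <;> simp
  commutes' r := by ext <;> simp

@[simp] lemma mapMid_apply (f : L →ₗ[ℝ] L) (hf : ∀ x y, b (f x) (f y) = b x y)
    (x : QuadAlg b) : mapMid f hf x = ⟨x.low, f x.mid, x.top⟩ := rfl

end QuadAlg

section Circuit

variable {E A : Type*} [Fintype E] [CommRing A] [Algebra ℝ A]

/-- The combinatorial features of the edges of a polygon: unit normals `l` indexed by `E`,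
and the relation `adj` of sharing a vertex. -/
structure IsCircuit (l : E → V) (adj : E → E → Prop) : Prop where
  norm_eq_one : ∀ F, ‖l F‖ = 1
  symm : ∀ F G, adj F G → adj G F
  irrefl : ∀ F, ¬ adj F F
  exists_dual : ∀ F G, adj F G → ∃ u : V, ⟪u, l F⟫ = 1 ∧ ⟪u, l G⟫ = 0
  exists_dir : ∀ F, ∃ d : V, ⟪d, l F⟫ = 0 ∧ (∀ G, adj F G → ⟪d, l G⟫ ≠ 0) ∧
    ∀ G H, adj F G → adj F H → 0 < ⟪d, l G⟫ * ⟪d, l H⟫ → G = H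
  connected : ∀ F G, Relation.ReflTransGen adj F G

/-- Elements `x F` of an algebra satisfying the relations of the polytopal algebra. -/
structure IsCircuitRel (l : E → V) (adj : E → E → Prop) (x : E → A) : Prop where
  linear : ∀ u : V, ∑ F, ⟪u, l F⟫ • x F = 0
  two : ∀ F G, F ≠ G → ¬ adj F G → x F * x G = 0
  three : ∀ F G H, F ≠ G → F ≠ H → G ≠ H → x F * x G * x H = 0

namespace IsCircuitRel

variable {l : E → V} {adj : E → E → Prop} {x : E → A}

lemma mul_mem_of_adj (hc : IsCircuit l adj) (hx : IsCircuitRel l adj x) {F : E}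
    {M : Submodule ℝ A} (h : ∀ G, adj F G → x F * x G ∈ M) (G : E) : x F * x G ∈ M := by
  classical
  have key : ∀ G, G ≠ F → x F * x G ∈ M := fun G hG => by
    by_cases ha : adj F G
    · exact h G ha
    · rw [hx.two F G hG.symm ha]; exact M.zero_mem
  by_cases hG : G = F
  · subst hG
    have h0 := congrArg (x G * ·) (hx.linear (l G))
    simp only [mul_zero, Finset.mul_sum, mul_smul_comm] at h0
    rw [← Finset.add_sum_erase _ _ (Finset.mem_univ G), real_inner_self_eq_norm_sq,
      hc.norm_eq_one, one_pow, one_smul] at h0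
    rw [eq_neg_of_add_eq_zero_left h0]
    exact M.neg_mem (M.sum_mem fun H hH => M.smul_mem _ (key H (Finset.ne_of_mem_erase hH)))
  · exact key G hG

lemma mul_mem_span (hc : IsCircuit l adj) (hx : IsCircuitRel l adj x) {F G : E}
    (hG : adj F G) (H : E) : x F * x H ∈ Submodule.span ℝ {x F * x G} := by
  classical
  refine mul_mem_of_adj hc hx (fun H hH => ?_) H
  by_cases hGH : H = G
  · subst hGH; exact Submodule.mem_span_singleton_self _
  obtain ⟨d, hdF, hd0, hd⟩ := hc.exists_dir F
  have h0 := congrArg (x F * ·) (hx.linear d)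
  simp only [mul_zero, Finset.mul_sum, mul_smul_comm] at h0
  rw [← Finset.add_sum_erase _ _ (Finset.mem_univ G),
    ← Finset.add_sum_erase _ _ (Finset.mem_erase.2 ⟨hGH, Finset.mem_univ H⟩),
    Finset.sum_eq_zero, add_zero] at h0
  · have h1 : x F * x H = (-(⟪d, l G⟫ / ⟪d, l H⟫)) • (x F * x G) := by
      have h2 := congrArg ((⟪d, l H⟫)⁻¹ • ·) (eq_neg_of_add_eq_zero_right h0)
      simp only [smul_smul, inv_mul_cancel₀ (hd0 H hH), one_smul, smul_neg] at h2
      rw [h2, neg_smul, div_eq_inv_mul]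
    rw [h1]
    exact Submodule.smul_mem _ _ (Submodule.mem_span_singleton_self _)
  · intro I hI
    simp only [Finset.mem_erase, Finset.mem_univ, and_true] at hI
    by_cases hIF : I = F
    · rw [hIF, hdF, zero_smul]
    by_cases ha : adj F I
    · exfalso
      have a1 := fun h => hI.2 (hd I G ha hG h)
      have a2 := fun h => hI.1 (hd I H ha hH h)
      have a3 := fun h => hGH (hd H G hH hG h)
      have b1 := lt_of_le_of_ne (not_lt.1 a1) (mul_ne_zero (hd0 I ha) (hd0 G hG))
      have b2 := lt_of_le_of_ne (not_lt.1 a2) (mul_ne_zero (hd0 I ha) (hd0 H hH))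
      have b3 := lt_of_le_of_ne (not_lt.1 a3) (mul_ne_zero (hd0 H hH) (hd0 G hG))
      have := mul_pos_of_neg_of_neg b1 b2
      nlinarith [sq_nonneg (⟪d, l I⟫)]
    · rw [hx.two F I (Ne.symm hIF) ha, smul_zero]

lemma sq_mul_eq_zero (hc : IsCircuit l adj) (hx : IsCircuitRel l adj x) {F G : E}
    (hFG : F ≠ G) : x F * x F * x G = 0 := by
  classical
  by_cases ha : adj F G
  · obtain ⟨u, hF, hG⟩ := hc.exists_dual F G ha
    have h0 := congrArg (x F * x G * ·) (hx.linear u)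
    simp only [mul_zero, Finset.mul_sum, mul_smul_comm] at h0
    rw [← Finset.add_sum_erase _ _ (Finset.mem_univ F), Finset.sum_eq_zero, add_zero, hF,
      one_smul] at h0
    · rw [← h0]; ring
    · intro H hH
      have hHF := Finset.ne_of_mem_erase hH
      by_cases hHG : H = G
      · rw [hHG, hG, zero_smul]
      · rw [hx.three F G H hFG hHF.symm (Ne.symm hHG), smul_zero]
  · rw [mul_assoc, hx.two F G hFG ha, mul_zero]

lemma mul_mul_eq_zero (hc : IsCircuit l adj) (hx : IsCircuitRel l adj x) (F G H : E) :
    x F * x G * x H = 0 := by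
  classical
  have cube : ∀ F, x F * x F * x F = 0 := fun F => by
    have h0 := congrArg (x F * x F * ·) (hx.linear (l F))
    simp only [mul_zero, Finset.mul_sum, mul_smul_comm] at h0
    rw [← Finset.add_sum_erase _ _ (Finset.mem_univ F), real_inner_self_eq_norm_sq,
      hc.norm_eq_one, one_pow, one_smul, Finset.sum_eq_zero, add_zero] at h0
    · exact h0
    · intro G hG
      rw [sq_mul_eq_zero hc hx (Finset.ne_of_mem_erase hG).symm, smul_zero]
  by_cases h1 : F = G
  · subst h1
    by_cases h2 : F = H
    · subst h2; exact cube F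
    · exact sq_mul_eq_zero hc hx h2
  by_cases h2 : F = H
  · subst h2; rw [← sq_mul_eq_zero hc hx h1]; ring
  by_cases h3 : G = H
  · subst h3; rw [← sq_mul_eq_zero hc hx (Ne.symm h1)]; ring
  exact hx.three F G H h1 h2 h3

/-- The products of two of the generators span at most a line, killed by the generators. -/
lemma exists_top (hc : IsCircuit l adj) (hx : IsCircuitRel l adj x) :
    ∃ w : A, (∀ F G, ∃ c : ℝ, x F * x G = c • w) ∧ ∀ F, w * x F = 0 := by
  classical
  rcases isEmpty_or_nonempty E with hE | ⟨⟨F₀⟩⟩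
  · exact ⟨0, fun F => hE.elim F, fun F => hE.elim F⟩
  obtain ⟨w, hw, hw0⟩ : ∃ w : A, (∀ G, x F₀ * x G ∈ Submodule.span ℝ {w}) ∧
      ∀ F, w * x F = 0 := by
    by_cases h : ∃ G₀, adj F₀ G₀
    · obtain ⟨G₀, h⟩ := h
      exact ⟨x F₀ * x G₀, mul_mem_span hc hx h, mul_mul_eq_zero hc hx F₀ G₀⟩
    · push Not at h
      exact ⟨0, mul_mem_of_adj hc hx fun G hG => (h G hG).elim, fun F => zero_mul _⟩
  refine ⟨w, fun F G => ?_, hw0⟩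
  have : ∀ G, x F * x G ∈ Submodule.span ℝ {w} := by
    induction hc.connected F₀ F with
    | refl => exact hw
    | @tail F F' _ hFF' ih =>
      intro G
      refine Submodule.span_le.2 ?_ (mul_mem_span hc hx (hc.symm _ _ hFF') G)
      rw [Set.singleton_subset_iff, mul_comm]
      exact ih F'
  obtain ⟨c, hcw⟩ := Submodule.mem_span_singleton.1 (this G)
  exact ⟨c, hcw.symm⟩

end IsCircuitRel

end Circuit

section Polygon

lemma inner_lt_of_mem_interior {Q : Set V} {p u : V} {c : ℝ} (hp : p ∈ interior Q) (hu : u ≠ 0)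
    (h : ∀ x ∈ Q, ⟪u, x⟫ ≤ c) : ⟪u, p⟫ < c := by
  have hcont : Filter.Tendsto (fun t : ℝ => p + t • u) (nhdsWithin 0 (Set.Ioi 0)) (nhds p) := by
    have : Continuous fun t : ℝ => p + t • u := by fun_prop
    simpa using (this.tendsto 0).mono_left nhdsWithin_le_nhds
  obtain ⟨t, ht, ht0⟩ := ((hcont.eventually (mem_interior_iff_mem_nhds.1 hp)).and
    self_mem_nhdsWithin).exists
  have h1 := h _ ht
  rw [inner_add_right, inner_smul_right] at h1
  have : 0 < t * ⟪u, u⟫ := mul_pos ht0 (real_inner_self_pos.2 hu)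
  linarith

/-- `F` is an edge of `Q`, lying on the supporting line `⟪u, x⟫ = c` with unit normal `u`. -/
structure IsEdge (Q F : Set V) (u : V) (c : ℝ) : Prop where
  norm_eq : ‖u‖ = 1
  le : ∀ x ∈ Q, ⟪u, x⟫ ≤ c
  eq : F = {x ∈ Q | ⟪u, x⟫ = c}
  nontrivial : F.Nontrivial

lemma IsEdge.ne_zero {Q F : Set V} {u : V} {c : ℝ} (h : IsEdge Q F u c) : u ≠ 0 := by
  intro h0; have := h.norm_eq; simp [h0] at this

variable [FiniteDimensional ℝ V]

lemma exists_frame (h2 : Module.finrank ℝ V = 2) {u : V} (hu : ‖u‖ = 1) :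
    ∃ d : V, ‖d‖ = 1 ∧ ⟪d, u⟫ = 0 ∧
      (∀ x y : V, ⟪x, y⟫ = ⟪u, x⟫ * ⟪u, y⟫ + ⟪d, x⟫ * ⟪d, y⟫) ∧
      ∀ x : V, x = ⟪u, x⟫ • u + ⟪d, x⟫ • d := by
  obtain ⟨b, hb⟩ := Orthonormal.exists_orthonormalBasis_extension_of_card_eq (ι := Fin 2)
    (by simpa using h2) (v := fun _ => u) (s := {0})
    ⟨fun _ => hu, fun i j hij => (hij (Subsingleton.elim _ _)).elim⟩
  have h0 : b 0 = u := hb 0 rfl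
  refine ⟨b 1, b.orthonormal.1 1, ?_, fun x y => ?_, fun x => ?_⟩
  · rw [← h0]; exact b.orthonormal.2 (by decide)
  · rw [← b.sum_inner_mul_inner x y, Fin.sum_univ_two, h0, real_inner_comm x u,
      real_inner_comm x (b 1)]
  · rw [← h0]
    conv_lhs => rw [← b.sum_repr' x, Fin.sum_univ_two]

lemma support_line_unique (h2 : Module.finrank ℝ V = 2) {Q : Set V}
    (hQ : (interior Q).Nonempty) {u u' x y : V} {c c' : ℝ} (hu : ‖u‖ = 1) (hu' : ‖u'‖ = 1)
    (h : ∀ x ∈ Q, ⟪u, x⟫ ≤ c) (h' : ∀ x ∈ Q, ⟪u', x⟫ ≤ c') (hxy : x ≠ y)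
    (hx : ⟪u, x⟫ = c) (hy : ⟪u, y⟫ = c) (hx' : ⟪u', x⟫ = c') (hy' : ⟪u', y⟫ = c') :
    u = u' ∧ c = c' := by
  obtain ⟨d, -, hdu, hfr, hex⟩ := exists_frame h2 hu
  have he : ⟪u, x - y⟫ = 0 := by rw [inner_sub_right, hx, hy, sub_self]
  have he' : ⟪u', x - y⟫ = 0 := by rw [inner_sub_right, hx', hy', sub_self]
  have hd : ⟪d, x - y⟫ ≠ 0 := by
    intro h0
    apply hxy
    rw [← sub_eq_zero, hex (x - y), he, h0]; simp
  rw [hfr, he, mul_zero, zero_add] at he'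
  have hdu' : ⟪d, u'⟫ = 0 := (mul_eq_zero.1 he').resolve_right hd
  have hu'u : u' = ⟪u, u'⟫ • u := by
    have := hex u'
    rwa [hdu', zero_smul, add_zero] at this
  obtain ⟨p, hp⟩ := hQ
  have hne : ∀ v : V, ‖v‖ = 1 → v ≠ 0 := fun v hv h0 => by simp [h0] at hv
  have hp1 := inner_lt_of_mem_interior hp (hne u hu) h
  have hp2 := inner_lt_of_mem_interior hp (hne u' hu') h'
  have hn := hu'
  rw [hu'u, norm_smul, hu, mul_one, Real.norm_eq_abs] at hn
  rcases abs_eq (zero_le_one' ℝ) |>.1 hn with h1 | h1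
  · rw [h1, one_smul] at hu'u
    exact ⟨hu'u.symm, by rw [← hx, ← hx', hu'u]⟩
  · exfalso
    rw [h1, neg_one_smul] at hu'u
    rw [hu'u, inner_neg_left] at hp2 hx'
    linarith

lemma isFacet_iff (h2 : Module.finrank ℝ V = 2) {Q : Set V} (hQ : (interior Q).Nonempty)
    {F : Set V} : IsFacet Q F ↔ ∃ u c, IsEdge Q F u c := by
  constructor
  · rintro ⟨hexp, hdim⟩
    rw [h2, direction_affineSpan] at hdim
    have hnt : F.Nontrivial := by
      by_contra h
      rw [Set.not_nontrivial_iff] at h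
      rw [vectorSpan_of_subsingleton ℝ h, finrank_bot] at hdim
      omega
    obtain ⟨l, hl⟩ := hexp hnt.nonempty
    obtain ⟨v, rfl⟩ := (InnerProductSpace.toDual ℝ V).surjective l
    simp only [InnerProductSpace.toDual_apply_apply] at hl
    have hv : v ≠ 0 := by
      rintro rfl
      have hFQ : F = Q := by rw [hl]; ext x; simp
      rw [hFQ, ← direction_affineSpan] at hdim
      have : affineSpan ℝ Q = ⊤ := by
        refine top_unique ?_
        rw [← isOpen_interior.affineSpan_eq_top hQ]
        exact affineSpan_mono ℝ interior_subset
      rw [this, AffineSubspace.direction_top, finrank_top, h2] at hdim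
      omega
    have hvn : 0 < ‖v‖ := norm_pos_iff.2 hv
    obtain ⟨x₀, hx₀⟩ := hnt.nonempty
    have hx₀' := hx₀
    rw [hl] at hx₀'
    refine ⟨‖v‖⁻¹ • v, ⟪‖v‖⁻¹ • v, x₀⟫, by rw [norm_smul, norm_inv, norm_norm,
      inv_mul_cancel₀ hvn.ne'], fun x hx => ?_, ?_, hnt⟩
    · simp only [real_inner_smul_left]
      exact mul_le_mul_of_nonneg_left (hx₀'.2 x hx) (by positivity)
    · rw [hl]; ext x
      simp only [real_inner_smul_left, mul_right_inj' (inv_pos.2 hvn).ne', Set.mem_ofPred_eq]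
      refine and_congr_right fun hx => ⟨fun h => le_antisymm (hx₀'.2 x hx) (h x₀ hx₀'.1),
        fun h y hy => h ▸ hx₀'.2 y hy⟩
  · rintro ⟨u, c, h⟩
    obtain ⟨x, hx, y, hy, hxy⟩ := h.nontrivial
    have hx' := hx
    have hy' := hy
    rw [h.eq] at hx' hy'
    refine ⟨fun _ => ⟨InnerProductSpace.toDual ℝ V u, ?_⟩, ?_⟩
    · simp only [InnerProductSpace.toDual_apply_apply]
      rw [h.eq]; ext z
      exact and_congr_right fun hz => ⟨fun e y hy => e ▸ h.le y hy,
        fun e => le_antisymm (h.le z hz) (hx'.2 ▸ e x hx'.1)⟩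
    · rw [h2, direction_affineSpan]
      have hle : vectorSpan ℝ F ≤ (Submodule.span ℝ {u})ᗮ := by
        rw [vectorSpan_def, Submodule.span_le]
        rintro _ ⟨a, ha, b, hb, rfl⟩
        rw [h.eq] at ha hb
        rw [SetLike.mem_coe, Submodule.mem_orthogonal_singleton_iff_inner_right]
        change ⟪u, a - b⟫ = 0
        rw [inner_sub_right, ha.2, hb.2, sub_self]
      have h1 : Module.finrank ℝ (Submodule.span ℝ {u})ᗮ = 1 := by
        have : Fact (Module.finrank ℝ V = 1 + 1) := ⟨h2⟩
        exact Submodule.finrank_orthogonal_span_singleton h.ne_zero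
      have hle' := Submodule.finrank_mono hle
      have hpos : 0 < Module.finrank ℝ (vectorSpan ℝ F) := by
        rw [Module.finrank_pos_iff, Submodule.nontrivial_iff_ne_bot]
        intro hb
        have := vsub_mem_vectorSpan ℝ hx hy
        rw [hb, Submodule.mem_bot, vsub_eq_sub, sub_eq_zero] at this
        exact hxy this
      omega

lemma IsEdge.unique (h2 : Module.finrank ℝ V = 2) {Q : Set V} (hQ : (interior Q).Nonempty)
    {F : Set V} {u u' : V} {c c' : ℝ} (h : IsEdge Q F u c) (hu' : ‖u'‖ = 1)
    (hle : ∀ x ∈ Q, ⟪u', x⟫ ≤ c') (hF : ∀ x ∈ F, ⟪u', x⟫ = c') : u = u' ∧ c = c' := by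
  obtain ⟨x, hx, y, hy, hxy⟩ := h.nontrivial
  have hx' := hF x hx
  have hy' := hF y hy
  rw [h.eq] at hx hy
  exact support_line_unique h2 hQ h.norm_eq hu' h.le hle hxy hx.2 hy.2 hx' hy'

lemma IsEdge.normalVec_eq (h2 : Module.finrank ℝ V = 2) {Q : Set V}
    (hQ : (interior Q).Nonempty) {F : Set V} {u : V} {c : ℝ} (h : IsEdge Q F u c) :
    normalVec Q F = u := by
  have key : ∃ u : V, IsOutwardNormal Q F u := by
    obtain ⟨x, hx⟩ := h.nontrivial.nonempty
    rw [h.eq] at hx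
    refine ⟨u, h.norm_eq, ?_⟩
    rw [h.eq]; ext z
    exact and_congr_right fun hz => ⟨fun e y hy => e ▸ h.le y hy,
      fun e => le_antisymm (h.le z hz) (hx.2 ▸ e x hx.1)⟩
  rw [normalVec, dif_pos key]
  have hs := key.choose_spec
  obtain ⟨x, hx⟩ := h.nontrivial.nonempty
  have hx' := hx
  rw [hs.2] at hx'
  refine (h.unique h2 hQ hs.1 (c' := ⟪key.choose, x⟫) hx'.2 fun y hy => ?_).1.symm
  rw [hs.2] at hy
  exact le_antisymm (hx'.2 y hy.1) (hy.2 x hx'.1)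

end Polygon

section Polygon

/-- A convex polygon, presented by finitely many linear inequalities. -/
structure IsPolygon (Q : Set V) : Prop where
  finrank_eq : Module.finrank ℝ V = 2
  bounded : Bornology.IsBounded Q
  interior_nonempty : (interior Q).Nonempty
  exists_halfspaces : ∃ I : Finset (V × ℝ), (∀ i ∈ I, i.1 ≠ 0) ∧
    Q = {x | ∀ i ∈ I, ⟪i.1, x⟫ ≤ i.2}

lemma exists_pos_small_perturbation {I : Finset (V × ℝ)} {z d : V}
    (h : ∀ i ∈ I, ⟪i.1, z⟫ < i.2 ∨ (⟪i.1, z⟫ ≤ i.2 ∧ ⟪i.1, d⟫ ≤ 0)) :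
    ∃ t : ℝ, 0 < t ∧ ∀ i ∈ I, ⟪i.1, z + t • d⟫ ≤ i.2 := by
  have : ∀ᶠ t : ℝ in nhdsWithin 0 (Set.Ioi 0), ∀ i ∈ I, ⟪i.1, z + t • d⟫ ≤ i.2 := by
    rw [Filter.eventually_all_finset]
    intro i hi
    rcases h i hi with h | h
    · have hc : Continuous fun t : ℝ => ⟪i.1, z + t • d⟫ := by fun_prop
      have := (hc.tendsto 0).mono_left (nhdsWithin_le_nhds (s := Set.Ioi 0))
      simp only [zero_smul, add_zero] at this
      exact (this.eventually (gt_mem_nhds h)).mono fun _ => le_of_lt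
    · filter_upwards [self_mem_nhdsWithin] with t ht
      rw [inner_add_right, inner_smul_right]
      have := mul_nonpos_of_nonneg_of_nonpos (le_of_lt ht) h.2
      linarith [h.1]
  obtain ⟨t, ht, ht0⟩ := (this.and self_mem_nhdsWithin).exists
  exact ⟨t, ht0, ht⟩

variable [FiniteDimensional ℝ V] {Q : Set V}

lemma exists_edge_of_halfspaces (h2 : Module.finrank ℝ V = 2) (hQ : (interior Q).Nonempty)
    {I : Finset (V × ℝ)} (hI : ∀ i ∈ I, i.1 ≠ 0) (hQI : Q = {x | ∀ i ∈ I, ⟪i.1, x⟫ ≤ i.2})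
    {x : V} (hx : x ∉ Q) : ∃ F u c, IsEdge Q F u c ∧ c < ⟪u, x⟫ := by
  classical
  obtain ⟨J, hJI, hJ⟩ := exists_minimal_le_of_wellFoundedLT
    (fun J : Finset (V × ℝ) => Q = {x | ∀ i ∈ J, ⟪i.1, x⟫ ≤ i.2}) I hQI
  have hQJ := hJ.prop
  have hx' : ∃ i ∈ J, i.2 < ⟪i.1, x⟫ := by
    rw [hQJ] at hx
    simpa using hx
  obtain ⟨i, hi, hix⟩ := hx'
  obtain ⟨y, hy, hyi⟩ : ∃ y, (∀ j ∈ J.erase i, ⟪j.1, y⟫ ≤ j.2) ∧ i.2 < ⟪i.1, y⟫ := by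
    by_contra! hcon
    have hle : J ≤ J.erase i := hJ.2 (by
      rw [hQJ]; ext y
      refine ⟨fun h j hj => h j (Finset.mem_of_mem_erase hj), fun h j hj => ?_⟩
      by_cases hji : j = i
      · rw [hji]; exact hcon y h
      · exact h j (Finset.mem_erase.2 ⟨hji, hj⟩)) (Finset.erase_subset i J)
    exact (Finset.mem_erase.1 (hle hi)).1 rfl
  obtain ⟨p, hp⟩ := hQ
  have hpJ : ∀ j ∈ J, ⟪j.1, p⟫ < j.2 := fun j hj =>
    inner_lt_of_mem_interior hp (hI j (hJI hj)) fun x hx => by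
      rw [hQJ] at hx; exact hx j hj
  have hpi := hpJ i hi
  set s : ℝ := (i.2 - ⟪i.1, p⟫) / (⟪i.1, y⟫ - ⟪i.1, p⟫) with hs
  have hden : 0 < ⟪i.1, y⟫ - ⟪i.1, p⟫ := by linarith
  have hs0 : 0 < s := div_pos (by linarith) hden
  have hs1 : s < 1 := (div_lt_one hden).2 (by linarith)
  have hsi : s * (⟪i.1, y⟫ - ⟪i.1, p⟫) = i.2 - ⟪i.1, p⟫ := div_mul_cancel₀ _ hden.ne'
  have hz : ∀ v : V, ⟪v, p + s • (y - p)⟫ = ⟪v, p⟫ + s * (⟪v, y⟫ - ⟪v, p⟫) := fun v => by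
    rw [inner_add_right, inner_smul_right, inner_sub_right]
  have hzi : ⟪i.1, p + s • (y - p)⟫ = i.2 := by rw [hz, hsi]; ring
  have hzJ : ∀ j ∈ J, j ≠ i → ⟪j.1, p + s • (y - p)⟫ < j.2 := fun j hj hji => by
    rw [hz]
    have h1 := hpJ j hj
    have h2 := hy j (Finset.mem_erase.2 ⟨hji, hj⟩)
    nlinarith
  set z := p + s • (y - p)
  have hi0 : 0 < ‖i.1‖ := norm_pos_iff.2 (hI i (hJI hi))
  have hun : ‖‖i.1‖⁻¹ • i.1‖ = 1 := by
    rw [norm_smul, norm_inv, norm_norm, inv_mul_cancel₀ hi0.ne']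
  obtain ⟨d, hd, hdi, -⟩ := exists_frame h2 hun
  rw [inner_smul_right, mul_eq_zero, or_iff_right (inv_pos.2 hi0).ne', real_inner_comm] at hdi
  obtain ⟨t, ht, htJ⟩ := exists_pos_small_perturbation (I := J) (z := z) (d := d)
    fun j hj => by
      by_cases hji : j = i
      · rw [hji]; exact Or.inr ⟨hzi.le, hdi.le⟩
      · exact Or.inl (hzJ j hj hji)
  have hzQ : z ∈ Q := by
    rw [hQJ]; intro j hj
    by_cases hji : j = i
    · rw [hji]; exact hzi.le
    · exact (hzJ j hj hji).le
  have htQ : z + t • d ∈ Q := by rw [hQJ]; exact htJ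
  refine ⟨_, ‖i.1‖⁻¹ • i.1, ‖i.1‖⁻¹ * i.2, ⟨hun, fun x hx => ?_, rfl, z, ⟨hzQ, ?_⟩,
    z + t • d, ⟨htQ, ?_⟩, ?_⟩, ?_⟩
  · rw [real_inner_smul_left]
    rw [hQJ] at hx
    exact mul_le_mul_of_nonneg_left (hx i hi) (by positivity)
  · rw [real_inner_smul_left, hzi]
  · rw [real_inner_smul_left, inner_add_right, hzi, inner_smul_right, hdi, mul_zero, add_zero]
  · intro h
    rw [left_eq_add, smul_eq_zero] at h
    rcases h with h | h
    · exact ht.ne' h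
    · simp [h] at hd
  · rw [real_inner_smul_left]
    exact mul_lt_mul_of_pos_left hix (by positivity)

lemma IsEdge.exists_halfspace (h2 : Module.finrank ℝ V = 2) (hQ : (interior Q).Nonempty)
    {I : Finset (V × ℝ)} (hI : ∀ i ∈ I, i.1 ≠ 0) (hQI : Q = {x | ∀ i ∈ I, ⟪i.1, x⟫ ≤ i.2})
    {F : Set V} {u : V} {c : ℝ} (h : IsEdge Q F u c) :
    ∃ i ∈ I, u = ‖i.1‖⁻¹ • i.1 ∧ c = ‖i.1‖⁻¹ * i.2 := by
  obtain ⟨x, hx, y, hy, hxy⟩ := h.nontrivial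
  rw [h.eq] at hx hy
  have hxI := hx.1
  have hyI := hy.1
  rw [hQI] at hxI hyI
  have hm : ∀ v : V, ⟪v, (2⁻¹ : ℝ) • (x + y)⟫ = 2⁻¹ * (⟪v, x⟫ + ⟪v, y⟫) := fun v => by
    rw [inner_smul_right, inner_add_right]
  have hact : ∃ i ∈ I, i.2 ≤ ⟪i.1, (2⁻¹ : ℝ) • (x + y)⟫ := by
    by_contra! hcon
    obtain ⟨t, ht, htI⟩ := exists_pos_small_perturbation (I := I) (z := (2⁻¹ : ℝ) • (x + y))
      (d := u) fun i hi => Or.inl (hcon i hi)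
    have := h.le ((2⁻¹ : ℝ) • (x + y) + t • u) (by rw [hQI]; exact htI)
    rw [inner_add_right, hm, hx.2, hy.2, inner_smul_right, real_inner_self_eq_norm_sq,
      h.norm_eq] at this
    linarith
  obtain ⟨i, hi, hmi⟩ := hact
  rw [hm] at hmi
  have hxi := hxI i hi
  have hyi := hyI i hi
  have hi0 : 0 < ‖i.1‖ := norm_pos_iff.2 (hI i hi)
  refine ⟨i, hi, support_line_unique h2 hQ h.norm_eq ?_ h.le ?_ hxy hx.2 hy.2 ?_ ?_⟩
  · rw [norm_smul, norm_inv, norm_norm, inv_mul_cancel₀ hi0.ne']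
  · intro z hz
    rw [hQI] at hz
    rw [real_inner_smul_left]
    exact mul_le_mul_of_nonneg_left (hz i hi) (by positivity)
  · rw [real_inner_smul_left]; congr 1; linarith
  · rw [real_inner_smul_left]; congr 1; linarith

/-- The value of the unit normal of an edge `F` of `Q` on `F`. -/
def edgeHeight (Q F : Set V) : ℝ := sSup ((fun x => ⟪normalVec Q F, x⟫) '' Q)

namespace IsPolygon

lemma isEdge (hQ : IsPolygon Q) (F : Facets Q) :
    IsEdge Q F.1 (normalVec Q F.1) (edgeHeight Q F.1) := by
  obtain ⟨u, c, h⟩ := (isFacet_iff hQ.finrank_eq hQ.interior_nonempty).1 F.2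
  rw [edgeHeight, h.normalVec_eq hQ.finrank_eq hQ.interior_nonempty]
  convert h
  obtain ⟨x, hx⟩ := h.nontrivial.nonempty
  rw [h.eq] at hx
  refine IsGreatest.csSup_eq ⟨⟨x, hx⟩, ?_⟩
  rintro _ ⟨y, hy, rfl⟩
  exact h.le y hy

lemma facet_ext (hQ : IsPolygon Q) {F G : Facets Q}
    (h : normalVec Q F.1 = normalVec Q G.1) : F = G := by
  apply Subtype.ext
  rw [(hQ.isEdge F).eq, (hQ.isEdge G).eq, edgeHeight, edgeHeight, h]

lemma exists_edge_of_notMem (hQ : IsPolygon Q) {x : V} (hx : x ∉ Q) :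
    ∃ F : Facets Q, edgeHeight Q F.1 < ⟪normalVec Q F.1, x⟫ := by
  obtain ⟨I, hI, hQI⟩ := hQ.exists_halfspaces
  obtain ⟨F, u, c, h, hx⟩ :=
    exists_edge_of_halfspaces hQ.finrank_eq hQ.interior_nonempty hI hQI hx
  have hF : IsFacet Q F := (isFacet_iff hQ.finrank_eq hQ.interior_nonempty).2 ⟨u, c, h⟩
  have hu := h.normalVec_eq hQ.finrank_eq hQ.interior_nonempty
  have h' := hQ.isEdge ⟨F, hF⟩
  obtain ⟨y, hy⟩ := h.nontrivial.nonempty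
  have h1 := hy
  have h2 : y ∈ (⟨F, hF⟩ : Facets Q).1 := hy
  rw [h.eq] at h1
  rw [h'.eq] at h2
  refine ⟨⟨F, hF⟩, ?_⟩
  rw [← h2.2, hu, h1.2]
  exact hx

lemma mem_iff (hQ : IsPolygon Q) {x : V} :
    x ∈ Q ↔ ∀ F : Facets Q, ⟪normalVec Q F.1, x⟫ ≤ edgeHeight Q F.1 := by
  refine ⟨fun hx F => (hQ.isEdge F).le x hx, fun h => ?_⟩
  by_contra hx
  obtain ⟨F, hF⟩ := hQ.exists_edge_of_notMem hx
  exact (h F).not_gt hF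

lemma finite_facets (hQ : IsPolygon Q) : Finite (Facets Q) := by
  obtain ⟨I, hI, hQI⟩ := hQ.exists_halfspaces
  choose i hi hiu hic using fun F : Facets Q =>
    (hQ.isEdge F).exists_halfspace hQ.finrank_eq hQ.interior_nonempty hI hQI
  refine Finite.of_injective (fun F => (⟨i F, hi F⟩ : I)) fun F G hFG => ?_
  rw [Subtype.mk.injEq] at hFG
  exact hQ.facet_ext (by rw [hiu, hiu, hFG])

omit [FiniteDimensional ℝ V] in
lemma isClosed (hQ : IsPolygon Q) : IsClosed Q := by
  obtain ⟨I, -, hQI⟩ := hQ.exists_halfspaces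
  rw [hQI]
  simp only [Set.ofPred_forall]
  exact isClosed_iInter fun i => isClosed_iInter fun _ =>
    isClosed_le (by fun_prop) continuous_const

lemma isCompact (hQ : IsPolygon Q) : IsCompact Q :=
  Metric.isCompact_of_isClosed_isBounded hQ.isClosed hQ.bounded

omit [FiniteDimensional ℝ V] in
lemma convex (hQ : IsPolygon Q) : Convex ℝ Q := by
  obtain ⟨I, -, hQI⟩ := hQ.exists_halfspaces
  rw [hQI]
  simp only [Set.ofPred_forall]
  exact convex_iInter fun i => convex_iInter fun _ =>
    convex_halfSpace_le ⟨fun x y => inner_add_right _ x y, fun c x => inner_smul_right _ x c⟩ _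

lemma isCompact_facet (hQ : IsPolygon Q) (F : Facets Q) : IsCompact F.1 := by
  rw [(hQ.isEdge F).eq]
  exact hQ.isCompact.inter_right (isClosed_eq (by fun_prop) continuous_const)

end IsPolygon

end Polygon

section Polygon

/-- Distinct facets sharing a point. -/
def FacetAdj (Q : Set V) (F G : Facets Q) : Prop := F ≠ G ∧ (F.1 ∩ G.1).Nonempty

namespace IsPolygon

variable [FiniteDimensional ℝ V] {Q : Set V}

lemma norm_normalVec (hQ : IsPolygon Q) (F : Facets Q) : ‖normalVec Q F.1‖ = 1 :=
  (hQ.isEdge F).norm_eq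

lemma mem_facet_iff (hQ : IsPolygon Q) {F : Facets Q} {x : V} :
    x ∈ F.1 ↔ x ∈ Q ∧ ⟪normalVec Q F.1, x⟫ = edgeHeight Q F.1 := by
  conv_lhs => rw [(hQ.isEdge F).eq]
  rfl

lemma inner_le (hQ : IsPolygon Q) (F : Facets Q) {x : V} (hx : x ∈ Q) :
    ⟪normalVec Q F.1, x⟫ ≤ edgeHeight Q F.1 := (hQ.isEdge F).le x hx

lemma inner_sub_neg (hQ : IsPolygon Q) {F G : Facets Q} (hFG : F ≠ G) {x z : V}
    (hzF : z ∈ F.1) (hzG : z ∈ G.1) (hx : x ∈ F.1) (hxz : x ≠ z) :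
    ⟪normalVec Q G.1, x - z⟫ < 0 := by
  rw [hQ.mem_facet_iff] at hzF hzG hx
  rw [inner_sub_right, hzG.2, sub_neg]
  refine lt_of_le_of_ne (hQ.inner_le G hx.1) fun h => hFG (hQ.facet_ext ?_)
  exact (support_line_unique hQ.finrank_eq hQ.interior_nonempty (hQ.norm_normalVec F)
    (hQ.norm_normalVec G) (fun x => hQ.inner_le F) (fun x => hQ.inner_le G) hxz hx.2 hzF.2 h
    hzG.2).1

lemma exists_ne_mem (hQ : IsPolygon Q) (F : Facets Q) (z : V) : ∃ x ∈ F.1, x ≠ z :=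
  (hQ.isEdge F).nontrivial.exists_ne z

lemma inter_inter_eq_empty (hQ : IsPolygon Q) {F G H : Facets Q} (hFG : F ≠ G) (hFH : F ≠ H)
    (hGH : G ≠ H) {z : V} (hzF : z ∈ F.1) (hzG : z ∈ G.1) (hzH : z ∈ H.1) : False := by
  obtain ⟨d, -, hdu, hfr, hex⟩ := exists_frame hQ.finrank_eq (hQ.norm_normalVec F)
  obtain ⟨x, hx, hxz⟩ := hQ.exists_ne_mem F z
  obtain ⟨y, hy, hyz⟩ := hQ.exists_ne_mem G z
  obtain ⟨w, hw, hwz⟩ := hQ.exists_ne_mem H z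
  have hFx : ⟪normalVec Q F.1, x - z⟫ = 0 := by
    rw [inner_sub_right, (hQ.mem_facet_iff.1 hx).2, (hQ.mem_facet_iff.1 hzF).2, sub_self]
  have hGy : ⟪normalVec Q G.1, y - z⟫ = 0 := by
    rw [inner_sub_right, (hQ.mem_facet_iff.1 hy).2, (hQ.mem_facet_iff.1 hzG).2, sub_self]
  have hHw : ⟪normalVec Q H.1, w - z⟫ = 0 := by
    rw [inner_sub_right, (hQ.mem_facet_iff.1 hw).2, (hQ.mem_facet_iff.1 hzH).2, sub_self]
  have h1 := hQ.inner_sub_neg hFG hzF hzG hx hxz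
  have h2 := hQ.inner_sub_neg hFH hzF hzH hx hxz
  have h3 := hQ.inner_sub_neg hFG.symm hzG hzF hy hyz
  have h4 := hQ.inner_sub_neg hGH hzG hzH hy hyz
  have h5 := hQ.inner_sub_neg hFH.symm hzH hzF hw hwz
  have h6 := hQ.inner_sub_neg hGH.symm hzH hzG hw hwz
  have e1 := hfr (normalVec Q G.1) (x - z)
  have e2 := hfr (normalVec Q H.1) (x - z)
  have e3 := hfr (normalVec Q G.1) (y - z)
  have e4 := hfr (normalVec Q H.1) (y - z)
  have e5 := hfr (normalVec Q G.1) (w - z)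
  have e6 := hfr (normalVec Q H.1) (w - z)
  rw [hFx, mul_zero, zero_add] at e1 e2
  rw [hGy] at e3
  rw [hHw] at e6
  set u := normalVec Q F.1
  set g := normalVec Q G.1
  set h := normalVec Q H.1
  generalize ⟪u, g⟫ = g0 at *
  generalize ⟪d, g⟫ = g1 at *
  generalize ⟪u, h⟫ = h0 at *
  generalize ⟪d, h⟫ = h1' at *
  generalize ⟪u, y - z⟫ = y0 at *
  generalize ⟪d, y - z⟫ = y1 at *
  generalize ⟪u, w - z⟫ = w0 at *
  generalize ⟪d, w - z⟫ = w1 at *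
  have hp : 0 < g1 * h1' := by
    have : 0 < ⟪g, x - z⟫ * ⟪h, x - z⟫ := mul_pos_of_neg_of_neg h1 h2
    rw [e1, e2] at this
    have h7 : 0 < (g1 * h1') * ⟪d, x - z⟫ ^ 2 := by linarith
    exact pos_of_mul_pos_left h7 (sq_nonneg _)
  have k1 : (g1 * h0 - h1' * g0) * y0 = g1 * ⟪h, y - z⟫ := by
    rw [e4]; linear_combination h1' * e3
  have k2 : (h1' * g0 - g1 * h0) * w0 = h1' * ⟪g, w - z⟫ := by
    rw [e5]; linear_combination g1 * e6
  rcases pos_and_pos_or_neg_and_neg_of_mul_pos hp with ⟨hg, hh⟩ | ⟨hg, hh⟩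
  · have := mul_neg_of_pos_of_neg hg h4
    have := mul_neg_of_pos_of_neg hh h6
    nlinarith
  · have := mul_pos_of_neg_of_neg hg h4
    have := mul_pos_of_neg_of_neg hh h6
    nlinarith

/-- Two facets adjacent to `F` on the same side of `F` coincide. -/
lemma adj_unique (hQ : IsPolygon Q) {F G H : Facets Q} {d : V} (hd : ⟪normalVec Q F.1, d⟫ = 0)
    (hG : FacetAdj Q F G) (hH : FacetAdj Q F H) (hdG : 0 < ⟪normalVec Q G.1, d⟫)
    (hdH : 0 < ⟪normalVec Q H.1, d⟫) : G = H := by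
  obtain ⟨hFG, z, hzF, hzG⟩ := hG
  obtain ⟨hFH, w, hwF, hwH⟩ := hH
  have hd0 : d ≠ 0 := by rintro rfl; simp at hdG
  by_cases hzw : z = w
  · subst hzw
    by_contra hGH
    exact hQ.inter_inter_eq_empty hFG hFH hGH hzF hzG hwH
  exfalso
  have h1 := hQ.inner_sub_neg hFG hzF hzG hwF (Ne.symm hzw)
  have h2 := hQ.inner_sub_neg hFH hwF hwH hzF hzw
  obtain ⟨e, -, heu, hfr, hex⟩ := exists_frame hQ.finrank_eq (hQ.norm_normalVec F)
  have h0 : ⟪normalVec Q F.1, w - z⟫ = 0 := by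
    rw [inner_sub_right, (hQ.mem_facet_iff.1 hwF).2, (hQ.mem_facet_iff.1 hzF).2, sub_self]
  have h0' : ⟪normalVec Q F.1, z - w⟫ = 0 := by
    rw [inner_sub_right, (hQ.mem_facet_iff.1 hwF).2, (hQ.mem_facet_iff.1 hzF).2, sub_self]
  rw [hfr, h0, mul_zero, zero_add] at h1
  rw [hfr, h0', mul_zero, zero_add, ← neg_sub w z, inner_neg_right] at h2
  rw [hfr, hd, mul_zero, zero_add] at hdG hdH
  have k1 := mul_neg_of_pos_of_neg hdG h1
  have k2 := mul_neg_of_pos_of_neg hdH h2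
  have a1 : 0 < ⟪e, normalVec Q G.1⟫ ^ 2 := by
    rw [sq_pos_iff]; rintro h; simp [h] at hdG
  have a2 : 0 < ⟪e, normalVec Q H.1⟫ ^ 2 := by
    rw [sq_pos_iff]; rintro h; simp [h] at hdH
  have b1 : ⟪e, normalVec Q G.1⟫ ^ 2 * (⟪e, d⟫ * ⟪e, w - z⟫) < 0 := by linarith
  have b2 : 0 < ⟪e, normalVec Q H.1⟫ ^ 2 * (⟪e, d⟫ * ⟪e, w - z⟫) := by linarith
  have c1 := neg_of_mul_neg_right b1 a1.le
  have c2 := pos_of_mul_pos_right b2 a2.le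
  linarith

/-- Each facet has an adjacent facet on each of its two sides. -/
lemma exists_adj (hQ : IsPolygon Q) (F : Facets Q) {d : V} (hd : ⟪normalVec Q F.1, d⟫ = 0)
    (hd0 : d ≠ 0) : ∃ G : Facets Q, FacetAdj Q F G ∧ 0 < ⟪normalVec Q G.1, d⟫ := by
  obtain ⟨z, hz, hmax⟩ := (hQ.isCompact_facet F).exists_isMaxOn (hQ.isEdge F).nontrivial.nonempty
    (f := fun x => ⟪d, x⟫) (by fun_prop)
  by_contra! hcon
  have := hQ.finite_facets
  cases nonempty_fintype (Facets Q)
  classical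
  have hzQ := (hQ.mem_facet_iff.1 hz)
  obtain ⟨t, ht, htI⟩ := exists_pos_small_perturbation (z := z) (d := d)
    (I := Finset.univ.image fun G : Facets Q => (normalVec Q G.1, edgeHeight Q G.1))
    fun i hi => by
      obtain ⟨G, -, rfl⟩ := Finset.mem_image.1 hi
      rcases (hQ.inner_le G hzQ.1).lt_or_eq with h | h
      · exact Or.inl h
      · refine Or.inr ⟨h.le, ?_⟩
        by_cases hGF : F = G
        · rw [← hGF]; exact hd.le
        · exact hcon G ⟨hGF, z, hz, hQ.mem_facet_iff.2 ⟨hzQ.1, h⟩⟩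
  have hQ' : z + t • d ∈ Q := hQ.mem_iff.2 fun G =>
    htI (normalVec Q G.1, edgeHeight Q G.1) (Finset.mem_image_of_mem _ (Finset.mem_univ G))
  have hF : z + t • d ∈ F.1 := hQ.mem_facet_iff.2 ⟨hQ', by
    rw [inner_add_right, inner_smul_right, hd, mul_zero, add_zero, hzQ.2]⟩
  have := hmax hF
  simp only [Set.mem_ofPred_eq, inner_add_right, inner_smul_right] at this
  have := mul_pos ht (real_inner_self_pos.2 hd0)
  linarith

lemma adj_inner_ne_zero (hQ : IsPolygon Q) {F G : Facets Q} (hG : FacetAdj Q F G) {d : V}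
    (hd : ⟪normalVec Q F.1, d⟫ = 0) (hd0 : d ≠ 0) : ⟪normalVec Q G.1, d⟫ ≠ 0 := by
  obtain ⟨hFG, z, hzF, hzG⟩ := hG
  obtain ⟨x, hx, hxz⟩ := hQ.exists_ne_mem F z
  have h1 := hQ.inner_sub_neg hFG hzF hzG hx hxz
  have h0 : ⟪normalVec Q F.1, x - z⟫ = 0 := by
    rw [inner_sub_right, (hQ.mem_facet_iff.1 hx).2, (hQ.mem_facet_iff.1 hzF).2, sub_self]
  obtain ⟨e, -, heu, hfr, hex⟩ := exists_frame hQ.finrank_eq (hQ.norm_normalVec F)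
  rw [hfr, h0, mul_zero, zero_add] at h1
  rw [hfr, hd, mul_zero, zero_add]
  refine mul_ne_zero (fun h => by simp [h] at h1) fun h => hd0 ?_
  rw [hex d, hd, h]; simp

omit [FiniteDimensional ℝ V] in
lemma adj_symm {F G : Facets Q} (h : FacetAdj Q F G) : FacetAdj Q G F :=
  ⟨h.1.symm, Set.inter_comm F.1 G.1 ▸ h.2⟩

lemma reflTransGen_adj (hQ : IsPolygon Q) (G₀ F : Facets Q) :
    Relation.ReflTransGen (FacetAdj Q) G₀ F := by
  have := hQ.finite_facets
  choose v hv hmax using fun G : Facets Q => (hQ.isCompact_facet G).exists_isMaxOn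
    (hQ.isEdge G).nontrivial.nonempty (f := fun x => ⟪normalVec Q F.1, x⟫) (by fun_prop)
  obtain ⟨G, hG, hGmax⟩ := Set.exists_max_image {G | Relation.ReflTransGen (FacetAdj Q) G₀ G}
    (fun G => ⟪normalVec Q F.1, v G⟫) (Set.toFinite _) ⟨G₀, .refl⟩
  by_cases hFG : F = G
  · rw [hFG]; exact hG
  obtain ⟨d, hd1, hdG, hdF⟩ : ∃ d : V, d ≠ 0 ∧ ⟪normalVec Q G.1, d⟫ = 0 ∧
      0 ≤ ⟪normalVec Q F.1, d⟫ := by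
    obtain ⟨d, hd, hdu, -⟩ := exists_frame hQ.finrank_eq (hQ.norm_normalVec G)
    have hd0 : d ≠ 0 := by rintro rfl; simp at hd
    rw [real_inner_comm] at hdu
    rcases le_total 0 ⟪normalVec Q F.1, d⟫ with h | h
    · exact ⟨d, hd0, hdu, h⟩
    · exact ⟨-d, neg_ne_zero.2 hd0, by rw [inner_neg_right, hdu, neg_zero], by
        rw [inner_neg_right]; linarith⟩
  obtain ⟨H, hGH, hdH⟩ := hQ.exists_adj G hdG hd1
  obtain ⟨hne, z, hzG, hzH⟩ := hGH
  have hH : Relation.ReflTransGen (FacetAdj Q) G₀ H := hG.tail ⟨hne, z, hzG, hzH⟩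
  -- `z` maximizes the linear form on `G` and on `H`
  have hzG' := hQ.mem_facet_iff.1 hzG
  have hzH' := hQ.mem_facet_iff.1 hzH
  obtain ⟨e, he, heG, hfr, hex⟩ := exists_frame hQ.finrank_eq (hQ.norm_normalVec G)
  have hde : d = ⟪e, d⟫ • e := by
    conv_lhs => rw [hex d, hdG, zero_smul, zero_add]
  have hzmaxG : ∀ x ∈ G.1, ⟪normalVec Q F.1, x⟫ ≤ ⟪normalVec Q F.1, z⟫ := fun x hx => by
    by_cases hxz : x = z
    · rw [hxz]
    have h0 : ⟪normalVec Q G.1, x - z⟫ = 0 := by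
      rw [inner_sub_right, (hQ.mem_facet_iff.1 hx).2, hzG'.2, sub_self]
    have h1 := hQ.inner_sub_neg hne hzG hzH hx hxz
    have h2 := hdH
    have h3 := hdF
    rw [hfr, h0, mul_zero, zero_add] at h1
    rw [hfr, hdG, mul_zero, zero_add] at h2 h3
    rw [← sub_nonpos, ← inner_sub_right, hfr, h0, mul_zero, zero_add]
    by_contra! hcon
    have h4 := mul_pos h2 hcon
    have h5 := mul_nonneg h3 (neg_nonneg.2 h1.le)
    have h6 : 0 < (⟪e, normalVec Q F.1⟫ * ⟪e, d⟫) * (⟪e, normalVec Q H.1⟫ * ⟪e, x - z⟫) := by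
      linarith
    linarith
  have hzmaxH : ∀ x ∈ H.1, ⟪normalVec Q F.1, x⟫ ≤ ⟪normalVec Q F.1, z⟫ := fun x hx =>
    ((hmax H hx).trans (hGmax H hH)).trans (hzmaxG _ (hv G))
  obtain ⟨y, hy, hyz⟩ := hQ.exists_ne_mem H z
  have hGy := hQ.inner_sub_neg hne.symm hzH hzG hy hyz
  have hHy : ⟪normalVec Q H.1, y - z⟫ = 0 := by
    rw [inner_sub_right, (hQ.mem_facet_iff.1 hy).2, hzH'.2, sub_self]
  have hFy : ⟪normalVec Q F.1, y - z⟫ ≤ 0 := by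
    rw [inner_sub_right]; linarith [hzmaxH y hy]
  set b : ℝ := ⟪normalVec Q F.1, d⟫ / ⟪normalVec Q H.1, d⟫ with hb
  have hb0 : 0 ≤ b := div_nonneg hdF hdH.le
  have hbd : b * ⟪normalVec Q H.1, d⟫ = ⟪normalVec Q F.1, d⟫ := div_mul_cancel₀ _ hdH.ne'
  set a : ℝ := ⟪normalVec Q G.1, normalVec Q F.1⟫ - b * ⟪normalVec Q G.1, normalVec Q H.1⟫
  have hcomb : ∀ x, ⟪normalVec Q F.1, x⟫ =
      a * ⟪normalVec Q G.1, x⟫ + b * ⟪normalVec Q H.1, x⟫ := fun x => by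
    have h1 : b * ⟪e, normalVec Q H.1⟫ = ⟪e, normalVec Q F.1⟫ := by
      have hed : ⟪e, d⟫ ≠ 0 := fun h => hd1 (by rw [hde, h, zero_smul])
      rw [hfr _ d, hfr (normalVec Q F.1) d, hdG] at hbd
      simp only [mul_zero, zero_add] at hbd
      exact mul_right_cancel₀ hed (by linarith)
    rw [hfr (normalVec Q F.1), hfr (normalVec Q H.1), ← h1]
    ring
  have ha0 : 0 ≤ a := by
    rw [hcomb, hHy, mul_zero, add_zero] at hFy
    by_contra! hcon
    have := mul_pos_of_neg_of_neg hcon hGy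
    linarith
  obtain ⟨x, hx, -⟩ := hQ.exists_ne_mem F 0
  have hx' := hQ.mem_facet_iff.1 hx
  have hzF : z ∈ F.1 := by
    refine hQ.mem_facet_iff.2 ⟨hzG'.1, le_antisymm (hQ.inner_le F hzG'.1) ?_⟩
    rw [← hx'.2, hcomb x, hcomb z, hzG'.2, hzH'.2]
    have := mul_le_mul_of_nonneg_left (hQ.inner_le G hx'.1) ha0
    have := mul_le_mul_of_nonneg_left (hQ.inner_le H hx'.1) hb0
    linarith
  exact hG.tail ⟨Ne.symm hFG, z, hzG, hzF⟩

lemma isCircuit (hQ : IsPolygon Q) :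
    IsCircuit (fun F : Facets Q => normalVec Q F.1) (FacetAdj Q) where
  norm_eq_one := hQ.norm_normalVec
  symm _ _ := adj_symm
  irrefl _ h := h.1 rfl
  exists_dual F G h := by
    obtain ⟨hFG, z, hzF, hzG⟩ := h
    obtain ⟨x, hx, hxz⟩ := hQ.exists_ne_mem G z
    have h1 := hQ.inner_sub_neg hFG.symm hzG hzF hx hxz
    refine ⟨⟪normalVec Q F.1, x - z⟫⁻¹ • (x - z), ?_, ?_⟩
    · rw [real_inner_smul_left, real_inner_comm (normalVec Q F.1), inv_mul_cancel₀ h1.ne]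
    · rw [real_inner_smul_left, real_inner_comm (normalVec Q G.1) (x - z),
        inner_sub_right (normalVec Q G.1), (hQ.mem_facet_iff.1 hx).2,
        (hQ.mem_facet_iff.1 hzG).2, sub_self, mul_zero]
  exists_dir F := by
    obtain ⟨d, hd, hdu, -⟩ := exists_frame hQ.finrank_eq (hQ.norm_normalVec F)
    have hd0 : d ≠ 0 := by rintro rfl; simp at hd
    have hdu' : ⟪normalVec Q F.1, d⟫ = 0 := by rw [real_inner_comm]; exact hdu
    refine ⟨d, hdu, fun G hG => ?_, fun G H hG hH hGH => ?_⟩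
    · rw [real_inner_comm]; exact hQ.adj_inner_ne_zero hG hdu' hd0
    · rw [real_inner_comm _ d, real_inner_comm _ d] at hGH
      rcases pos_and_pos_or_neg_and_neg_of_mul_pos hGH with ⟨h1, h2⟩ | ⟨h1, h2⟩
      · exact hQ.adj_unique hdu' hG hH h1 h2
      · exact hQ.adj_unique (d := -d) (by rw [inner_neg_right, hdu', neg_zero]) hG hH
          (by rw [inner_neg_right]; linarith) (by rw [inner_neg_right]; linarith)
  connected := hQ.reflTransGen_adj

end IsPolygon

end Polygon

section PolyAlg

variable {Q : Set V}

/-- The class in the polytopal algebra of the variable attached to `F`. -/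
def polyVar (Q : Set V) (F : Facets Q) : PolyAlg Q := polyMk Q (MvPolynomial.X F)

lemma polyMk_eq_zero {p : MvPolynomial (Facets Q) ℝ} (hp : p ∈ polyIdeal Q) :
    polyMk Q p = 0 := Ideal.Quotient.eq_zero_iff_mem.2 hp

lemma prod_polyVar_eq_zero (t : Finset (Facets Q)) (h : (⋂ F ∈ t, (F.1 : Set V)) = ∅) :
    ∏ F ∈ t, polyVar Q F = 0 := by
  have := polyMk_eq_zero (Ideal.mem_sup_left (Ideal.subset_span ⟨t, h, rfl⟩) :
    ∏ F ∈ t, MvPolynomial.X F ∈ polyIdeal Q)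
  rwa [map_prod] at this

lemma sum_smul_polyVar_eq_zero [Fintype (Facets Q)] (u : V) :
    ∑ F, ⟪u, normalVec Q F.1⟫ • polyVar Q F = 0 := by
  have := polyMk_eq_zero (Ideal.mem_sup_right (Ideal.subset_span ⟨u, rfl⟩) :
    ∑ᶠ F : Facets Q, MvPolynomial.C ⟪u, normalVec Q F.1⟫ * MvPolynomial.X F ∈ polyIdeal Q)
  rw [finsum_eq_sum_of_fintype, map_sum] at this
  simpa only [← MvPolynomial.smul_eq_C_mul, map_smul, polyVar] using this

lemma PolyAlg.algHom_ext {B : Type*} [CommRing B] [Algebra ℝ B] {f g : PolyAlg Q →ₐ[ℝ] B}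
    (h : ∀ F, f (polyVar Q F) = g (polyVar Q F)) : f = g :=
  Ideal.Quotient.algHom_ext _ (MvPolynomial.algHom_ext h)

namespace QuadAlg

variable {L : Type*} [AddCommGroup L] [Module ℝ L] {b : LinearMap.BilinForm ℝ L}

lemma inMid_mul_inMid_mul_inMid (x y z : L) : inMid b x * inMid b y * inMid b z = 0 := by
  ext <;> simp

lemma inMid_mul_inMid_eq_zero {x y : L} (h : b x y + b y x = 0) :
    inMid b x * inMid b y = 0 := by
  ext <;> simp [h]

end QuadAlg

namespace IsPolygon

variable [FiniteDimensional ℝ V]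

lemma isCircuitRel [Fintype (Facets Q)] (hQ : IsPolygon Q) :
    IsCircuitRel (fun F : Facets Q => normalVec Q F.1) (FacetAdj Q) (polyVar Q) := by
  classical
  refine ⟨sum_smul_polyVar_eq_zero, fun F G hFG h => ?_, fun F G H hFG hFH hGH => ?_⟩
  · have := prod_polyVar_eq_zero ({F, G} : Finset (Facets Q)) (by
      by_contra hne
      obtain ⟨z, hz⟩ := Set.nonempty_iff_ne_empty.2 hne
      simp only [Finset.mem_insert, Finset.mem_singleton, Set.mem_iInter] at hz
      exact h ⟨hFG, z, hz F (Or.inl rfl), hz G (Or.inr rfl)⟩)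
    rwa [Finset.prod_pair hFG] at this
  · have := prod_polyVar_eq_zero ({F, G, H} : Finset (Facets Q)) (by
      by_contra hne
      obtain ⟨z, hz⟩ := Set.nonempty_iff_ne_empty.2 hne
      simp only [Finset.mem_insert, Finset.mem_singleton, Set.mem_iInter] at hz
      exact hQ.inter_inter_eq_empty hFG hFH hGH (hz F (Or.inl rfl)) (hz G (Or.inr (Or.inl rfl)))
        (hz H (Or.inr (Or.inr rfl))))
    rwa [Finset.prod_insert (by simp [hFG, hFH]), Finset.prod_pair hGH, ← mul_assoc] at this

variable [Fintype (Facets Q)] [DecidableEq (Facets Q)]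
  {L : Type*} [AddCommGroup L] [Module ℝ L] {b : LinearMap.BilinForm ℝ L}
  {φ : (Facets Q → ℝ) →ₗ[ℝ] L}

/-- The algebra of a polygon maps to the graded algebra defined by a bilinear form compatible
with its incidences. -/
lemma exists_algHom_quadAlg (hQ : IsPolygon Q)
    (hφ : ∀ u : V, φ (fun F => ⟪u, normalVec Q F.1⟫) = 0)
    (hb : ∀ F G : Facets Q, F ≠ G → F.1 ∩ G.1 = ∅ →
      b (φ (Pi.single F 1)) (φ (Pi.single G 1)) + b (φ (Pi.single G 1)) (φ (Pi.single F 1)) = 0) :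
    ∃ Θ : PolyAlg Q →ₐ[ℝ] QuadAlg b, ∀ F, Θ (polyVar Q F) = QuadAlg.inMid b (φ (Pi.single F 1)) := by
  let Φ : MvPolynomial (Facets Q) ℝ →ₐ[ℝ] QuadAlg b :=
    MvPolynomial.aeval fun F => QuadAlg.inMid b (φ (Pi.single F 1))
  have hΦ : ∀ F, Φ (MvPolynomial.X F) = QuadAlg.inMid b (φ (Pi.single F 1)) :=
    fun F => MvPolynomial.aeval_X _ F
  have hker : polyIdeal Q ≤ RingHom.ker Φ := by
    refine sup_le (Ideal.span_le.2 ?_) (Ideal.span_le.2 ?_)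
    · rintro _ ⟨t, ht, rfl⟩
      rw [SetLike.mem_coe, RingHom.mem_ker, map_prod]
      simp only [hΦ]
      rcases lt_or_ge 2 t.card with hc | hc
      · obtain ⟨F, hF, G, hG, H, hH, hFG, hFH, hGH⟩ := Finset.two_lt_card.1 hc
        rw [← Finset.mul_prod_erase t _ hF, ← Finset.mul_prod_erase _ _
          (Finset.mem_erase.2 ⟨hFG.symm, hG⟩), ← Finset.mul_prod_erase _ _
          (Finset.mem_erase.2 ⟨hGH.symm, Finset.mem_erase.2 ⟨hFH.symm, hH⟩⟩),
          ← mul_assoc, ← mul_assoc, QuadAlg.inMid_mul_inMid_mul_inMid, zero_mul]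
      · interval_cases hcard : t.card
        · rw [Finset.card_eq_zero] at hcard
          subst hcard
          simp at ht
        · obtain ⟨F, rfl⟩ := Finset.card_eq_one.1 hcard
          obtain ⟨x, hx, -⟩ := hQ.exists_ne_mem F 0
          simp only [Finset.mem_singleton, Set.iInter_iInter_eq_left] at ht
          rw [ht] at hx
          exact hx.elim
        · obtain ⟨F, G, hFG, rfl⟩ := Finset.card_eq_two.1 hcard
          rw [Finset.prod_pair hFG]
          refine QuadAlg.inMid_mul_inMid_eq_zero (hb F G hFG ?_)
          rw [← ht]
          ext z; simp
    · rintro _ ⟨u, rfl⟩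
      rw [SetLike.mem_coe, RingHom.mem_ker, finsum_eq_sum_of_fintype, map_sum]
      simp only [← MvPolynomial.smul_eq_C_mul, map_smul, hΦ]
      simp only [← map_smul, ← map_sum]
      have : ∑ F : Facets Q, ⟪u, normalVec Q F.1⟫ • (Pi.single F 1 : Facets Q → ℝ) =
          fun F => ⟪u, normalVec Q F.1⟫ := by
        ext G; simp [Finset.sum_apply, Pi.single_apply]
      rw [this, hφ, map_zero]
  exact ⟨Ideal.Quotient.liftₐ (polyIdeal Q) Φ fun a ha => hker ha, fun F => hΦ F⟩

lemma exists_eq_add (hQ : IsPolygon Q) :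
    ∃ w : PolyAlg Q, (∀ F G, ∃ c : ℝ, polyVar Q F * polyVar Q G = c • w) ∧
      ∀ z : PolyAlg Q, ∃ (a : ℝ) (h : Facets Q → ℝ) (t : ℝ),
        z = algebraMap ℝ _ a + ∑ F, h F • polyVar Q F + t • w := by
  obtain ⟨w, hw, hw0⟩ := hQ.isCircuitRel.exists_top hQ.isCircuit
  refine ⟨w, hw, fun z => ?_⟩
  obtain ⟨p, rfl⟩ := Ideal.Quotient.mkₐ_surjective ℝ (polyIdeal Q) z
  induction p using MvPolynomial.induction_on with
  | C a => exact ⟨a, 0, 0, by simp⟩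
  | add p q hp hq =>
    obtain ⟨a, h, t, hp⟩ := hp
    obtain ⟨a', h', t', hq⟩ := hq
    refine ⟨a + a', h + h', t + t', ?_⟩
    rw [map_add, hp, hq]
    simp only [map_add, Pi.add_apply, add_smul, Finset.sum_add_distrib]
    abel
  | mul_X p F hp =>
    obtain ⟨a, h, t, hp⟩ := hp
    choose c hc using fun G => hw G F
    refine ⟨0, Pi.single F a, ∑ G, h G * c G, ?_⟩
    rw [map_mul, hp]
    change _ * polyVar Q F = _
    rw [add_mul, add_mul, smul_mul_assoc, hw0, Finset.sum_mul, ← Algebra.smul_def]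
    simp only [smul_mul_assoc, hc, smul_smul, ← Finset.sum_smul]
    simp [Pi.single_apply, ite_smul]

theorem exists_embedding (hQ : IsPolygon Q)
    (hφ : ∀ h, φ h = 0 ↔ ∃ u : V, h = fun F => ⟪u, normalVec Q F.1⟫)
    (hb : ∀ F G : Facets Q, F ≠ G → F.1 ∩ G.1 = ∅ →
      b (φ (Pi.single F 1)) (φ (Pi.single G 1)) + b (φ (Pi.single G 1)) (φ (Pi.single F 1)) = 0)
    (hne : ∃ x y, b (φ x) (φ y) + b (φ y) (φ x) ≠ 0) :
    ∃ Θ : PolyAlg Q →ₐ[ℝ] QuadAlg b,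
      (∀ F, Θ (polyVar Q F) = QuadAlg.inMid b (φ (Pi.single F 1))) ∧
      Function.Injective Θ ∧ ∀ z, z ∈ Θ.range ↔ z.mid ∈ LinearMap.range φ := by
  obtain ⟨Θ, hΘ⟩ := hQ.exists_algHom_quadAlg (b := b) (fun u => (hφ _).2 ⟨u, rfl⟩) hb
  obtain ⟨w, hw, hspan⟩ := hQ.exists_eq_add
  have hlin : ∀ h : Facets Q → ℝ,
      Θ (∑ F, h F • polyVar Q F) = QuadAlg.inMid b (φ h) := fun h => by
    simp only [map_sum, map_smul, hΘ]
    simp only [← map_smul, ← map_sum]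
    congr 2
    ext G; simp [Finset.sum_apply, Pi.single_apply]
  obtain ⟨x, y, hxy⟩ := hne
  obtain ⟨c, hc⟩ : ∃ c : ℝ, (∑ F, x F • polyVar Q F) * (∑ F, y F • polyVar Q F) = c • w := by
    choose c hc using hw
    refine ⟨∑ F, ∑ G, x F * y G * c F G, ?_⟩
    rw [Finset.sum_mul_sum]
    simp only [smul_mul_smul_comm, hc, smul_smul, ← Finset.sum_smul]
  have hc' := congrArg Θ hc
  rw [map_mul, hlin, hlin, map_smul] at hc'
  have htop := congrArg QuadAlg.top hc'
  have hlow := congrArg QuadAlg.low hc'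
  have hmid := congrArg QuadAlg.mid hc'
  simp only [QuadAlg.top_mul, QuadAlg.low_inMid, QuadAlg.top_inMid, QuadAlg.mid_inMid,
    zero_add, QuadAlg.top_smul, QuadAlg.low_smul, QuadAlg.mid_smul, QuadAlg.low_mul,
    QuadAlg.mid_mul, zero_smul, mul_zero] at htop hlow hmid
  rw [htop] at hxy
  have hc0 : c ≠ 0 := left_ne_zero_of_mul hxy
  have htw : (Θ w).top ≠ 0 := right_ne_zero_of_mul hxy
  have hlw : (Θ w).low = 0 := (mul_eq_zero.1 hlow.symm).resolve_left hc0
  have hmw : (Θ w).mid = 0 := by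
    have := hmid.symm
    simpa [hc0] using this
  have hΘz : ∀ (a : ℝ) (h : Facets Q → ℝ) (t : ℝ),
      Θ (algebraMap ℝ _ a + ∑ F, h F • polyVar Q F + t • w) = ⟨a, φ h, t * (Θ w).top⟩ :=
    fun a h t => by
      rw [map_add, map_add, hlin, map_smul, AlgHom.commutes]
      ext <;> simp [hlw, hmw]
  refine ⟨Θ, hΘ, ?_, fun z => ⟨?_, ?_⟩⟩
  · rw [injective_iff_map_eq_zero]
    intro z hz
    obtain ⟨a, h, t, rfl⟩ := hspan z
    rw [hΘz] at hz
    have h1 := congrArg QuadAlg.low hz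
    have h2 := congrArg QuadAlg.mid hz
    have h3 := congrArg QuadAlg.top hz
    simp only [QuadAlg.low_zero, QuadAlg.mid_zero, QuadAlg.top_zero] at h1 h2 h3
    obtain ⟨u, rfl⟩ := (hφ h).1 h2
    rw [sum_smul_polyVar_eq_zero, h1, (mul_eq_zero.1 h3).resolve_right htw]
    simp
  · rintro ⟨z, rfl⟩
    obtain ⟨a, h, t, rfl⟩ := hspan z
    exact ⟨h, by rw [AlgHom.toRingHom_eq_coe, RingHom.coe_coe, hΘz]⟩
  · rintro ⟨h, hh⟩
    refine ⟨algebraMap ℝ _ z.low + ∑ F, h F • polyVar Q F + (z.top / (Θ w).top) • w, ?_⟩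
    rw [AlgHom.toRingHom_eq_coe, RingHom.coe_coe, hΘz, hh, div_mul_cancel₀ _ htw]

end IsPolygon

end PolyAlg

section Weight

open Classical in
/-- The weights of the intersection form: `1 / |sin θ|` for adjacent facets with normals at
angle `θ`, and the self-intersection number which makes the form vanish on linear functions. -/
def edgeWeight (Q : Set V) [Fintype (Facets Q)] (F G : Facets Q) : ℝ :=
  if F = G then -∑ H, if FacetAdj Q F H then
    ⟪normalVec Q F.1, normalVec Q H.1⟫ / √(1 - ⟪normalVec Q F.1, normalVec Q H.1⟫ ^ 2) else 0
  else if FacetAdj Q F G then 1 / √(1 - ⟪normalVec Q F.1, normalVec Q G.1⟫ ^ 2) else 0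

variable {Q : Set V} [Fintype (Facets Q)]

lemma edgeWeight_self (F : Facets Q) : edgeWeight Q F F =
    -∑ H ∈ Finset.univ.erase F, edgeWeight Q F H * ⟪normalVec Q F.1, normalVec Q H.1⟫ := by
  classical
  rw [edgeWeight, if_pos rfl, ← Finset.add_sum_erase _ _ (Finset.mem_univ F),
    if_neg fun h : FacetAdj Q F F => h.1 rfl, zero_add, neg_inj]
  refine Finset.sum_congr rfl fun G hG => ?_
  rw [edgeWeight, if_neg (Finset.ne_of_mem_erase hG).symm]
  split_ifs <;> ring

lemma edgeWeight_of_not_adj {F G : Facets Q} (h : F ≠ G) (h' : ¬ FacetAdj Q F G) :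
    edgeWeight Q F G = 0 := by
  rw [edgeWeight, if_neg h, if_neg h']

lemma edgeWeight_of_adj {F G : Facets Q} (h : FacetAdj Q F G) :
    edgeWeight Q F G = 1 / √(1 - ⟪normalVec Q F.1, normalVec Q G.1⟫ ^ 2) := by
  rw [edgeWeight, if_neg h.1, if_pos h]

lemma edgeWeight_comm (F G : Facets Q) : edgeWeight Q F G = edgeWeight Q G F := by
  by_cases h : F = G
  · rw [h]
  by_cases h' : FacetAdj Q F G
  · rw [edgeWeight_of_adj h', edgeWeight_of_adj (IsPolygon.adj_symm h'), real_inner_comm]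
  · rw [edgeWeight_of_not_adj h h',
      edgeWeight_of_not_adj (Ne.symm h) fun h'' => h' (IsPolygon.adj_symm h'')]

lemma edgeWeight_perm (σ : Equiv.Perm (Facets Q))
    (hσ : ∀ F G, FacetAdj Q (σ F) (σ G) ↔ FacetAdj Q F G)
    (hn : ∀ F G, ⟪normalVec Q (σ F).1, normalVec Q (σ G).1⟫ =
      ⟪normalVec Q F.1, normalVec Q G.1⟫) (F G : Facets Q) :
    edgeWeight Q (σ F) (σ G) = edgeWeight Q F G := by
  classical
  by_cases h : F = G
  · rw [h, edgeWeight, edgeWeight, if_pos rfl, if_pos rfl, ← Equiv.sum_comp σ]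
    simp only [hn, hσ]
  by_cases h' : FacetAdj Q F G
  · rw [edgeWeight_of_adj h', edgeWeight_of_adj ((hσ F G).2 h'), hn]
  · rw [edgeWeight_of_not_adj h h', edgeWeight_of_not_adj (fun e => h (σ.injective e))
      fun e => h' ((hσ F G).1 e)]

variable [FiniteDimensional ℝ V]

namespace IsPolygon

omit [Fintype (Facets Q)] in
lemma nonempty_facets (hQ : IsPolygon Q) : Nonempty (Facets Q) := by
  by_contra h
  rw [not_nonempty_iff] at h
  have : Q = Set.univ := Set.eq_univ_of_forall fun x => hQ.mem_iff.2 fun F => h.elim F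
  have hb := hQ.bounded
  have : Nontrivial V := Module.nontrivial_of_finrank_pos (R := ℝ) (by rw [hQ.finrank_eq]; simp)
  rw [‹Q = _›] at hb
  exact NormedSpace.unbounded_univ ℝ V hb

omit [Fintype (Facets Q)] in
lemma one_sub_inner_sq_pos (hQ : IsPolygon Q) {F G : Facets Q} (h : FacetAdj Q F G) :
    0 < 1 - ⟪normalVec Q F.1, normalVec Q G.1⟫ ^ 2 := by
  obtain ⟨d, hd, hdF, hfr, hex⟩ := exists_frame hQ.finrank_eq (hQ.norm_normalVec F)
  have h1 := hQ.adj_inner_ne_zero h (d := d) (by rw [real_inner_comm]; exact hdF)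
    (by rintro rfl; simp at hd)
  rw [real_inner_comm] at h1
  have h2 := hfr (normalVec Q G.1) (normalVec Q G.1)
  rw [real_inner_self_eq_norm_sq, hQ.norm_normalVec] at h2
  have := sq_pos_of_ne_zero h1
  linarith

lemma edgeWeight_pos (hQ : IsPolygon Q) {F G : Facets Q} (h : FacetAdj Q F G) :
    0 < edgeWeight Q F G := by
  rw [edgeWeight_of_adj h]
  exact one_div_pos.2 (Real.sqrt_pos.2 (hQ.one_sub_inner_sq_pos h))

lemma sum_edgeWeight_mul_inner (hQ : IsPolygon Q) (F : Facets Q) (u : V) :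
    ∑ G, edgeWeight Q F G * ⟪u, normalVec Q G.1⟫ = 0 := by
  classical
  obtain ⟨d, hd, hdF, hfr, hex⟩ := exists_frame hQ.finrank_eq (hQ.norm_normalVec F)
  have hd0 : d ≠ 0 := by rintro rfl; simp at hd
  have hdF' : ⟪normalVec Q F.1, d⟫ = 0 := by rw [real_inner_comm]; exact hdF
  have h1 : ∑ G, edgeWeight Q F G * ⟪normalVec Q F.1, normalVec Q G.1⟫ = 0 := by
    rw [← Finset.add_sum_erase _ _ (Finset.mem_univ F), real_inner_self_eq_norm_sq,
      hQ.norm_normalVec, one_pow, mul_one, edgeWeight_self, neg_add_cancel]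
  have hadj : ∀ G, FacetAdj Q F G →
      edgeWeight Q F G * ⟪d, normalVec Q G.1⟫ = SignType.sign ⟪d, normalVec Q G.1⟫ := by
    intro G hG
    have h2 := hfr (normalVec Q G.1) (normalVec Q G.1)
    rw [real_inner_self_eq_norm_sq, hQ.norm_normalVec] at h2
    have h3 : ⟪d, normalVec Q G.1⟫ ≠ 0 := by
      rw [real_inner_comm]; exact hQ.adj_inner_ne_zero hG hdF' hd0
    have h4 : 1 - ⟪normalVec Q F.1, normalVec Q G.1⟫ ^ 2 = ⟪d, normalVec Q G.1⟫ ^ 2 := by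
      linarith
    rw [edgeWeight_of_adj hG, h4, Real.sqrt_sq_eq_abs, ← mul_right_inj' (abs_ne_zero.2 h3),
      abs_mul_sign]
    field_simp
  have h2 : ∑ G, edgeWeight Q F G * ⟪d, normalVec Q G.1⟫ = 0 := by
    obtain ⟨G, hG, hGd⟩ := hQ.exists_adj F hdF' hd0
    obtain ⟨H, hH, hHd⟩ := hQ.exists_adj F (d := -d) (by rw [inner_neg_right, hdF', neg_zero])
      (neg_ne_zero.2 hd0)
    rw [inner_neg_right, neg_pos] at hHd
    have hGH : G ≠ H := by rintro rfl; linarith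
    rw [Fintype.sum_eq_add G H hGH, hadj G hG, hadj H hH, real_inner_comm, sign_pos hGd,
      real_inner_comm, sign_neg hHd]
    · simp
    · rintro I ⟨hIG, hIH⟩
      by_cases hIF : I = F
      · rw [hIF, hdF, mul_zero]
      by_cases hI : FacetAdj Q F I
      · exfalso
        rcases lt_trichotomy 0 ⟪normalVec Q I.1, d⟫ with h | h | h
        · exact hIG (hQ.adj_unique hdF' hI hG h hGd)
        · exact hQ.adj_inner_ne_zero hI hdF' hd0 h.symm
        · exact hIH (hQ.adj_unique (d := -d) (by rw [inner_neg_right, hdF', neg_zero]) hI hH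
            (by rw [inner_neg_right]; linarith) (by rw [inner_neg_right]; linarith))
      · rw [edgeWeight_of_not_adj (Ne.symm hIF) hI, zero_mul]
  rw [hex u]
  simp only [inner_add_left, real_inner_smul_left, mul_add, Finset.sum_add_distrib,
    mul_left_comm (edgeWeight Q F _), ← Finset.mul_sum, h1, h2, mul_zero, add_zero]

lemma sum_edgeWeight_pos (hQ : IsPolygon Q) : 0 < ∑ F, ∑ G, edgeWeight Q F G := by
  classical
  have := hQ.nonempty_facets
  refine Finset.sum_pos (fun F _ => ?_) Finset.univ_nonempty
  rw [← Finset.add_sum_erase _ _ (Finset.mem_univ F), edgeWeight_self, neg_add_eq_sub,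
    ← Finset.sum_sub_distrib]
  obtain ⟨d, hd, hdF, -⟩ := exists_frame hQ.finrank_eq (hQ.norm_normalVec F)
  obtain ⟨G, hG, -⟩ := hQ.exists_adj F (d := d) (by rw [real_inner_comm]; exact hdF)
    (by rintro rfl; simp at hd)
  have hpos : ∀ G, FacetAdj Q F G → 0 < edgeWeight Q F G -
      edgeWeight Q F G * ⟪normalVec Q F.1, normalVec Q G.1⟫ := fun G hG => by
    have h1 := hQ.edgeWeight_pos hG
    have h2 := hQ.one_sub_inner_sq_pos hG
    have h3 : ⟪normalVec Q F.1, normalVec Q G.1⟫ < 1 := by nlinarith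
    nlinarith
  refine Finset.sum_pos' (fun H hH => ?_) ⟨G, Finset.mem_erase.2 ⟨hG.1.symm,
    Finset.mem_univ G⟩, hpos G hG⟩
  by_cases h : FacetAdj Q F H
  · exact (hpos H h).le
  · rw [edgeWeight_of_not_adj (Finset.ne_of_mem_erase hH).symm h]; simp

end IsPolygon

/-- The linear relations among the variables of the polytopal algebra. -/
def linRel (Q : Set V) : Submodule ℝ (Facets Q → ℝ) :=
  LinearMap.range ({ toFun := fun u F => ⟪u, normalVec Q F.1⟫
                     map_add' := fun u v => by ext; simp [inner_add_left]
                     map_smul' := fun r u => by ext; simp [real_inner_smul_left] } :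
    V →ₗ[ℝ] (Facets Q → ℝ))

omit [Fintype (Facets Q)] [FiniteDimensional ℝ V] in
lemma mem_linRel {h : Facets Q → ℝ} :
    h ∈ linRel Q ↔ ∃ u : V, h = fun F => ⟪u, normalVec Q F.1⟫ :=
  exists_congr fun _ => eq_comm

/-- The bilinear form with matrix `edgeWeight`, on functions on the facets. -/
def preForm (Q : Set V) [Fintype (Facets Q)] : LinearMap.BilinForm ℝ (Facets Q → ℝ) :=
  LinearMap.mk₂ ℝ (fun g h => ∑ F, ∑ G, g F * (edgeWeight Q F G * h G))
    (fun g g' h => by simp only [Pi.add_apply, add_mul, Finset.sum_add_distrib])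
    (fun c g h => by simp only [Pi.smul_apply, smul_eq_mul, mul_assoc, Finset.mul_sum])
    (fun g h h' => by simp only [Pi.add_apply, mul_add, Finset.sum_add_distrib])
    (fun c g h => by
      simp only [Pi.smul_apply, smul_eq_mul, Finset.mul_sum]
      refine Finset.sum_congr rfl fun F _ => Finset.sum_congr rfl fun G _ => ?_
      ring)

omit [FiniteDimensional ℝ V] in
lemma preForm_apply (g h : Facets Q → ℝ) :
    preForm Q g h = ∑ F, g F * ∑ G, edgeWeight Q F G * h G := by
  simp only [Finset.mul_sum]; rfl

omit [FiniteDimensional ℝ V] in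
lemma preForm_comm (g h : Facets Q → ℝ) : preForm Q g h = preForm Q h g := by
  simp only [preForm_apply, Finset.mul_sum]
  rw [Finset.sum_comm]
  refine Finset.sum_congr rfl fun F _ => Finset.sum_congr rfl fun G _ => ?_
  rw [edgeWeight_comm]; ring

lemma IsPolygon.preForm_linRel (hQ : IsPolygon Q) (g : Facets Q → ℝ) {h : Facets Q → ℝ}
    (hh : h ∈ linRel Q) : preForm Q g h = 0 := by
  obtain ⟨u, rfl⟩ := mem_linRel.1 hh
  simp only [preForm_apply, hQ.sum_edgeWeight_mul_inner, mul_zero, Finset.sum_const_zero]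

/-- The intersection form on the degree one part of the polytopal algebra. -/
def interForm (hQ : IsPolygon Q) : LinearMap.BilinForm ℝ ((Facets Q → ℝ) ⧸ linRel Q) :=
  (linRel Q).liftQ
    { toFun := fun g => (linRel Q).liftQ (preForm Q g) fun _ hh => hQ.preForm_linRel g hh
      map_add' := fun g g' => by
        refine Submodule.linearMap_qext _ (LinearMap.ext fun h => ?_)
        change preForm Q (g + g') h = preForm Q g h + preForm Q g' h
        simp
      map_smul' := fun c g => by
        refine Submodule.linearMap_qext _ (LinearMap.ext fun h => ?_)
        change preForm Q (c • g) h = c • preForm Q g h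
        simp }
    fun g hg => by
      rw [LinearMap.mem_ker]
      refine Submodule.linearMap_qext _ (LinearMap.ext fun h => ?_)
      change preForm Q g h = 0
      rw [preForm_comm, hQ.preForm_linRel h hg]

@[simp] lemma interForm_mk (hQ : IsPolygon Q) (g h : Facets Q → ℝ) :
    interForm hQ ((linRel Q).mkQ g) ((linRel Q).mkQ h) = preForm Q g h := rfl

end Weight

section Roots

/-- The reflection across the hyperplane orthogonal to `α`, as a linear isometry. -/
def reflEquiv (α : V) : V ≃ₗᵢ[ℝ] V := (ℝ ∙ α)ᗮ.reflection

lemma reflEquiv_apply (α x : V) : reflEquiv α x = x - (2 * ⟪x, α⟫ / ⟪α, α⟫) • α := by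
  rw [reflEquiv, Submodule.reflection_orthogonal_apply, Submodule.reflection_singleton_apply]
  simp only [real_inner_comm x α, real_inner_self_eq_norm_sq]
  module

lemma coe_reflEquiv (α : V) : ⇑(reflEquiv α) = reflMap α := funext (reflEquiv_apply α)

lemma reflEquiv_mul_self (α : V) : reflEquiv α * reflEquiv α = 1 :=
  LinearIsometryEquiv.ext fun x => (ℝ ∙ α)ᗮ.reflection_reflection x

lemma reflEquiv_self (α : V) : reflEquiv α α = -α := by
  rw [reflEquiv, Submodule.reflection_orthogonalComplement_singleton_eq_neg]

lemma reflEquiv_of_inner_eq_zero {α x : V} (h : ⟪x, α⟫ = 0) : reflEquiv α x = x := by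
  rw [reflEquiv_apply, h]; simp

lemma inner_reflEquiv_self (α x : V) : ⟪reflEquiv α x, α⟫ = -⟪x, α⟫ := by
  rw [← neg_neg ⟪reflEquiv α x, α⟫, ← inner_neg_right, ← reflEquiv_self α,
    LinearIsometryEquiv.inner_map_map]

lemma reflEquiv_conj (g : V ≃ₗᵢ[ℝ] V) (α : V) : g * reflEquiv α = reflEquiv (g α) * g := by
  ext x
  change g (reflEquiv α x) = reflEquiv (g α) (g x)
  rw [reflEquiv_apply, reflEquiv_apply, map_sub, map_smul, LinearIsometryEquiv.inner_map_map,
    LinearIsometryEquiv.inner_map_map]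

/-- The parabolic subgroup `W_K` as a group of linear isometries. -/
def parabolic {n : ℕ} (α : Fin n → V) (K : Set (Fin n)) : Subgroup (V ≃ₗᵢ[ℝ] V) :=
  Subgroup.closure ((fun k => reflEquiv (α k)) '' K)

variable {n : ℕ} {α : Fin n → V} {K : Set (Fin n)}

lemma reflEquiv_mem_parabolic {k : Fin n} (hk : k ∈ K) : reflEquiv (α k) ∈ parabolic α K :=
  Subgroup.subset_closure ⟨k, hk, rfl⟩

lemma parabolic_mono {K' : Set (Fin n)} (h : K ⊆ K') : parabolic α K ≤ parabolic α K' :=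
  Subgroup.closure_mono (Set.image_mono h)

lemma exists_word {g : V ≃ₗᵢ[ℝ] V} (hg : g ∈ parabolic α K) :
    ∃ L : List (Fin n), (∀ k ∈ L, k ∈ K) ∧ (L.map fun k => reflEquiv (α k)).prod = g := by
  induction hg using Subgroup.closure_induction with
  | mem g hg =>
    obtain ⟨k, hk, rfl⟩ := hg
    exact ⟨[k], by simpa using hk, by simp⟩
  | one => exact ⟨[], by simp, by simp⟩
  | mul g h _ _ hg hh =>
    obtain ⟨L, hL, rfl⟩ := hg
    obtain ⟨M, hM, rfl⟩ := hh
    refine ⟨L ++ M, fun k hk => ?_, by simp⟩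
    rcases List.mem_append.1 hk with h | h
    exacts [hL k h, hM k h]
  | inv g _ hg =>
    obtain ⟨L, hL, rfl⟩ := hg
    refine ⟨L.reverse, by simpa using hL, ?_⟩
    rw [List.prod_inv_reverse, List.map_map, List.map_reverse]
    congr 2

lemma mem_WK_iff {s : Function.End V} : s ∈ WK α K ↔ ∃ g ∈ parabolic α K, ⇑g = s := by
  constructor
  · intro hs
    induction hs using Submonoid.closure_induction with
    | mem s hs =>
      obtain ⟨k, hk, rfl⟩ := hs
      exact ⟨_, reflEquiv_mem_parabolic hk, coe_reflEquiv _⟩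
    | one => exact ⟨1, one_mem _, rfl⟩
    | mul s t _ _ hs ht =>
      obtain ⟨g, hg, rfl⟩ := hs
      obtain ⟨h, hh, rfl⟩ := ht
      exact ⟨g * h, mul_mem hg hh, rfl⟩
  · rintro ⟨g, hg, rfl⟩
    obtain ⟨L, hL, rfl⟩ := exists_word hg
    clear hg
    induction L with
    | nil => exact one_mem (WK α K)
    | cons k L ih =>
      rw [List.map_cons, List.prod_cons]
      have h1 : (⇑(reflEquiv (α k)) : Function.End V) ∈ WK α K :=
        Submonoid.subset_closure ⟨k, hL k List.mem_cons_self, coe_reflEquiv _⟩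
      have h2 := (WK α K).mul_mem h1 (ih fun j hj => hL j (List.mem_cons_of_mem _ hj))
      exact h2

lemma parabolic_induction {p : V → Prop} (h : ∀ k ∈ K, ∀ x, p x → p (reflEquiv (α k) x))
    {g : V ≃ₗᵢ[ℝ] V} (hg : g ∈ parabolic α K) {x : V} (hx : p x) : p (g x) := by
  obtain ⟨L, hL, rfl⟩ := exists_word hg
  clear hg
  induction L with
  | nil => exact hx
  | cons k L ih =>
    rw [List.map_cons, List.prod_cons]
    exact h k (hL k List.mem_cons_self) _ (ih fun j hj => hL j (List.mem_cons_of_mem _ hj))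

namespace RootSystemData

variable (S : RootSystemData V n)

lemma map_mem_R {g : V ≃ₗᵢ[ℝ] V} (hg : g ∈ parabolic S.α K) {β : V} (hβ : β ∈ S.R) :
    g β ∈ S.R :=
  parabolic_induction (p := (· ∈ S.R)) (fun k _ x hx => by
    rw [coe_reflEquiv, ← S.hR_refl _ (S.hα_mem k)]
    exact Set.mem_image_of_mem _ hx) hg hβ

lemma isometry_ext {g h : V ≃ₗᵢ[ℝ] V} (H : ∀ k, g (S.α k) = h (S.α k)) : g = h := by
  have : (g.toLinearEquiv : V →ₗ[ℝ] V) = h.toLinearEquiv := by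
    refine LinearMap.ext_on_range S.hα_span H
  ext x
  exact LinearMap.congr_fun this x

lemma finite_parabolic (K : Set (Fin n)) : Finite (parabolic S.α K) := by
  have := S.hR_fin.to_subtype
  refine Finite.of_injective
    (fun g : parabolic S.α K => fun k => (⟨g.1 (S.α k), S.map_mem_R g.2 (S.hα_mem k)⟩ : S.R))
    fun g h hgh => Subtype.ext (S.isometry_ext fun k => ?_)
  exact congrArg Subtype.val (congrFun hgh k)

variable [FiniteDimensional ℝ V]

lemma exists_inner_eq (c : Fin n → ℝ) : ∃ x : V, ∀ k, ⟪x, S.α k⟫ = c k := by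
  let b := Module.Basis.mk S.hα_indep S.hα_span.ge
  refine ⟨(InnerProductSpace.toDual ℝ V).symm (LinearMap.toContinuousLinearMap (b.constr ℝ c)),
    fun k => ?_⟩
  rw [InnerProductSpace.toDual_symm_apply]
  have : S.α k = b k := by simp [b]
  simp [this]

/-- The dual basis of the simple system. -/
def coweight (i : Fin n) : V := (S.exists_inner_eq (Pi.single i 1)).choose

lemma inner_coweight (i k : Fin n) :
    ⟪S.coweight i, S.α k⟫ = (Pi.single i 1 : Fin n → ℝ) k :=
  (S.exists_inner_eq (Pi.single i 1)).choose_spec k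

lemma eq_sum_coweight (x : V) : x = ∑ i, ⟪S.coweight i, x⟫ • S.α i := by
  have hx : x ∈ Submodule.span ℝ (Set.range S.α) := S.hα_span ▸ Submodule.mem_top
  obtain ⟨c, rfl⟩ := (Submodule.mem_span_range_iff_exists_fun ℝ).1 hx
  refine Finset.sum_congr rfl fun i _ => ?_
  congr 1
  simp [inner_sum, inner_smul_right, S.inner_coweight, Pi.single_apply]

/-- Nonnegative combinations of the simple roots. -/
def IsPos (x : V) : Prop := ∀ i, 0 ≤ ⟪S.coweight i, x⟫

lemma isPos_or_neg {β : V} (hβ : β ∈ S.R) : S.IsPos β ∨ S.IsPos (-β) := by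
  obtain ⟨c, rfl, hc⟩ := S.hα_sign β hβ
  have : ∀ i, ⟪S.coweight i, ∑ j, c j • S.α j⟫ = c i := fun i => by
    simp [inner_sum, inner_smul_right, S.inner_coweight, Pi.single_apply]
  refine hc.imp (fun h i => ?_) fun h i => ?_
  · rw [this]; exact h i
  · rw [inner_neg_right, this]; exact neg_nonneg.2 (h i)

lemma eq_zero_of_isPos {x : V} (h : S.IsPos x) (h' : S.IsPos (-x)) : x = 0 := by
  rw [S.eq_sum_coweight x]
  refine Finset.sum_eq_zero fun i _ => ?_
  have := h' i
  rw [inner_neg_right] at this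
  rw [le_antisymm (by linarith) (h i), zero_smul]

lemma isPos_simple (k : Fin n) : S.IsPos (S.α k) := fun i => by
  rw [S.inner_coweight, Pi.single_apply]; split_ifs <;> norm_num

lemma isPos_reflEquiv {β : V} (hβ : β ∈ S.R) (hp : S.IsPos β) {i : Fin n} (hi : β ≠ S.α i) :
    S.IsPos (reflEquiv (S.α i) β) := by
  refine (S.isPos_or_neg (S.map_mem_R (K := Set.univ)
    (reflEquiv_mem_parabolic (Set.mem_univ i)) hβ)).resolve_right fun hn => hi ?_
  have hj : ∀ j, j ≠ i → ⟪S.coweight j, β⟫ = 0 := fun j hj => by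
    have := hn j
    rw [reflEquiv_apply, inner_neg_right, inner_sub_right, inner_smul_right, S.inner_coweight,
      Pi.single_apply, if_neg hj.symm] at this
    exact le_antisymm (by linarith) (hp j)
  have hβi : β = ⟪S.coweight i, β⟫ • S.α i := by
    conv_lhs => rw [S.eq_sum_coweight β]
    exact Finset.sum_eq_single i (fun j _ h => by rw [hj j h, zero_smul]) (by simp)
  have : β ∈ ({S.α i, -S.α i} : Set V) := by
    rw [← S.hR_red _ (S.hα_mem i)]
    exact ⟨hβ, _, hβi⟩
  refine this.resolve_right fun h => S.hR_ne0 _ (S.hα_mem i)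
    (S.eq_zero_of_isPos (S.isPos_simple i) ?_)
  rw [← Set.mem_singleton_iff.1 h]; exact hp

lemma exists_deletion (L : List (Fin n)) (hL : ∀ k ∈ L, k ∈ K) (k : Fin n)
    (h : ¬ S.IsPos ((L.map fun k => reflEquiv (S.α k)).prod (S.α k))) :
    ∃ L' : List (Fin n), (∀ k ∈ L', k ∈ K) ∧ L'.length + 1 = L.length ∧
      (L'.map fun k => reflEquiv (S.α k)).prod =
        (L.map fun k => reflEquiv (S.α k)).prod * reflEquiv (S.α k) := by
  induction L with
  | nil => exact (h (S.isPos_simple k)).elim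
  | cons i L ih =>
    have hL' : ∀ k ∈ L, k ∈ K := fun j hj => hL j (List.mem_cons_of_mem _ hj)
    rw [List.map_cons, List.prod_cons] at h ⊢
    by_cases hp : S.IsPos ((L.map fun k => reflEquiv (S.α k)).prod (S.α k))
    · have hmem : (L.map fun k => reflEquiv (S.α k)).prod (S.α k) ∈ S.R :=
        S.map_mem_R (K := Set.univ) (Subgroup.list_prod_mem _ fun g hg => by
          obtain ⟨j, -, rfl⟩ := List.mem_map.1 hg
          exact reflEquiv_mem_parabolic (Set.mem_univ j)) (S.hα_mem k)
      have heq : (L.map fun k => reflEquiv (S.α k)).prod (S.α k) = S.α i := by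
        by_contra hne
        exact h (S.isPos_reflEquiv hmem hp hne)
      refine ⟨L, hL', rfl, ?_⟩
      rw [mul_assoc, reflEquiv_conj, heq, ← mul_assoc, reflEquiv_mul_self, one_mul]
    · obtain ⟨L', h1, h2, h3⟩ := ih hL' hp
      refine ⟨i :: L', ?_, by simp [h2], by rw [List.map_cons, List.prod_cons, h3, mul_assoc]⟩
      intro j hj
      rcases List.mem_cons.1 hj with rfl | hj
      exacts [hL _ List.mem_cons_self, h1 j hj]

lemma parabolic_coweight {g : V ≃ₗᵢ[ℝ] V} (hg : g ∈ parabolic S.α K) {j : Fin n} (hj : j ∉ K) :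
    g (S.coweight j) = S.coweight j :=
  parabolic_induction (p := (· = S.coweight j)) (fun k hk x hx => by
    have hkj : k ≠ j := by rintro rfl; exact hj hk
    rw [hx]
    exact reflEquiv_of_inner_eq_zero (by rw [S.inner_coweight, Pi.single_apply, if_neg hkj])) hg rfl

/-- The chamber of a parabolic subgroup meets every orbit at most once. -/
lemma eq_of_mem_cham {g : V ≃ₗᵢ[ℝ] V} (hg : g ∈ parabolic S.α K) {x : V}
    (hx : x ∈ cham S.α K) (hgx : g x ∈ cham S.α K) : g x = x := by
  obtain ⟨L, hL, rfl⟩ := exists_word hg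
  clear hg
  induction hm : L.length using Nat.strong_induction_on generalizing L with
  | _ m ih =>
    rcases L.eq_nil_or_concat with rfl | ⟨M, k, rfl⟩
    · rfl
    rw [List.concat_eq_append] at *
    have hM : ∀ j ∈ M, j ∈ K := fun j hj => hL j (by simp [hj])
    have hk : k ∈ K := hL k (by simp)
    simp only [List.map_append, List.map_cons, List.map_nil, List.prod_append, List.prod_cons,
      List.prod_nil, mul_one, List.length_append, List.length_cons, List.length_nil,
      zero_add] at hgx hm ⊢
    set h := (M.map fun k => reflEquiv (S.α k)).prod with hh
    have hhK : h ∈ parabolic S.α K := Subgroup.list_prod_mem _ fun g hg => by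
      obtain ⟨j, hj, rfl⟩ := List.mem_map.1 hg
      exact reflEquiv_mem_parabolic (hM j hj)
    by_cases hp : S.IsPos (h (S.α k))
    · have h0 : ∀ j, j ∉ K → ⟪S.coweight j, h (S.α k)⟫ = 0 := fun j hj => by
        rw [← S.parabolic_coweight hhK hj, LinearIsometryEquiv.inner_map_map, S.inner_coweight,
          Pi.single_apply, if_neg (by rintro rfl; exact hj hk)]
      have h1 : 0 ≤ ⟪h (reflEquiv (S.α k) x), h (S.α k)⟫ := by
        conv_rhs => rw [S.eq_sum_coweight (h (S.α k))]
        rw [inner_sum]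
        refine Finset.sum_nonneg fun j _ => ?_
        rw [inner_smul_right]
        by_cases hj : j ∈ K
        · exact mul_nonneg (hp j) (hgx j hj)
        · rw [h0 j hj, zero_mul]
      rw [LinearIsometryEquiv.inner_map_map, inner_reflEquiv_self] at h1
      have h2 : reflEquiv (S.α k) x = x :=
        reflEquiv_of_inner_eq_zero (le_antisymm (by linarith) (hx k hk))
      change h (reflEquiv (S.α k) x) ∈ _ at hgx
      change h (reflEquiv (S.α k) x) = x
      rw [h2] at hgx ⊢
      exact ih M.length (by omega) M hM hgx rfl
    · obtain ⟨L', h1, h2, h3⟩ := S.exists_deletion M hM k hp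
      rw [← h3] at hgx ⊢
      exact ih L'.length (by omega) L' h1 hgx rfl

/-- The chamber of a parabolic subgroup meets every orbit. -/
lemma exists_mem_cham (K : Set (Fin n)) (x : V) :
    ∃ g ∈ parabolic S.α K, g x ∈ cham S.α K := by
  obtain ⟨ρ, hρ⟩ := S.exists_inner_eq fun _ => 1
  have := S.finite_parabolic K
  obtain ⟨g, hg⟩ := Finite.exists_max fun g : parabolic S.α K => ⟪g.1 x, ρ⟫
  refine ⟨g.1, g.2, fun k hk => ?_⟩
  have h := hg (⟨reflEquiv (S.α k), reflEquiv_mem_parabolic hk⟩ * g)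
  change ⟪reflEquiv (S.α k) (g.1 x), ρ⟫ ≤ _ at h
  rw [reflEquiv_apply, inner_sub_left, real_inner_smul_left, real_inner_comm ρ (S.α k), hρ,
    mul_one] at h
  have hpos : 0 < ⟪S.α k, S.α k⟫ := real_inner_self_pos.2 (S.hR_ne0 _ (S.hα_mem k))
  have h2 : 0 ≤ 2 * ⟪g.1 x, S.α k⟫ / ⟪S.α k, S.α k⟫ := by linarith
  have := mul_nonneg h2 hpos.le
  rw [div_mul_cancel₀ _ hpos.ne'] at this
  linarith

end RootSystemData

end Roots

section Polytope

lemma exists_finite_convexHull_eq_of_halfspaces [FiniteDimensional ℝ V] (I : Finset (V × ℝ))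
    (hb : Bornology.IsBounded {x : V | ∀ i ∈ I, ⟪i.1, x⟫ ≤ i.2}) :
    ∃ B : Set V, B.Finite ∧ {x : V | ∀ i ∈ I, ⟪i.1, x⟫ ≤ i.2} = convexHull ℝ B := by
  classical
  set Q := {x : V | ∀ i ∈ I, ⟪i.1, x⟫ ≤ i.2} with hQ
  have hmem : ∀ {x}, x ∈ Q ↔ ∀ i ∈ I, ⟪i.1, x⟫ ≤ i.2 := Iff.rfl
  have hcl : IsClosed Q := by
    rw [hQ]
    simp only [Set.ofPred_forall]
    exact isClosed_biInter fun i _ => isClosed_le (by fun_prop) continuous_const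
  have hconv : Convex ℝ Q := by
    intro x hx y hy a b ha hb' hab i hi
    rw [inner_add_right, inner_smul_right, inner_smul_right]
    have h1 := mul_le_mul_of_nonneg_left (hx i hi) ha
    have h2 := mul_le_mul_of_nonneg_left (hy i hi) hb'
    have h3 : a * i.2 + b * i.2 = i.2 := by rw [← add_mul, hab, one_mul]
    linarith
  have hfin : (Q.extremePoints ℝ).Finite := by
    refine Set.Finite.of_injOn (f := fun x => I.filter fun i => ⟪i.1, x⟫ = i.2)
      (t := (I.powerset : Set (Finset (V × ℝ)))) (fun x _ => by
        rw [Finset.mem_coe, Finset.mem_powerset]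
        exact Finset.filter_subset _ _) ?_
      (Finset.finite_toSet _)
    intro x hx y hy hxy
    by_contra hne
    have hxQ := hmem.1 hx.1
    have hyQ := hmem.1 hy.1
    have hact : ∀ i ∈ I, ⟪i.1, x⟫ = i.2 → ⟪i.1, y⟫ = i.2 := fun i hi h => by
      have : i ∈ I.filter fun i => ⟪i.1, x⟫ = i.2 := by simp [hi, h]
      have hxy' : (I.filter fun i => ⟪i.1, x⟫ = i.2) = I.filter fun i => ⟪i.1, y⟫ = i.2 := hxy
      rw [hxy'] at this
      exact (Finset.mem_filter.1 this).2
    obtain ⟨t, ht, htQ⟩ := exists_pos_small_perturbation (I := I) (z := x) (d := x - y)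
      fun i hi => by
        rcases (hxQ i hi).lt_or_eq with h | h
        · exact Or.inl h
        · exact Or.inr ⟨h.le, by rw [inner_sub_right, h, hact i hi h, sub_self]⟩
    have hseg : x ∈ openSegment ℝ y (x + t • (x - y)) := by
      refine ⟨t / (1 + t), 1 / (1 + t), by positivity, by positivity, by field_simp; ring, ?_⟩
      have h1 : x = ((1 + t)⁻¹ * (1 + t)) • x := by
        rw [inv_mul_cancel₀ (by positivity), one_smul]
      conv_rhs => rw [h1]
      module
    exact hne (hx.2 hy.1 (hmem.2 htQ) hseg).symm
  refine ⟨_, hfin, ?_⟩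
  have := closure_convexHull_extremePoints
    (Metric.isCompact_of_isClosed_isBounded hcl hb) hconv
  exact this.symm.trans (hfin.isClosed_convexHull ℝ).closure_eq

lemma exists_halfspaces_of_convexHull [FiniteDimensional ℝ V] {B : Set V} (hB : B.Finite)
    (h0 : (0 : V) ∈ interior (convexHull ℝ B)) :
    ∃ I : Finset (V × ℝ), (∀ i ∈ I, i.1 ≠ 0) ∧
      convexHull ℝ B = {x | ∀ i ∈ I, ⟪i.1, x⟫ ≤ i.2} := by
  classical
  have hpolar : ∀ {y : V}, (∀ b ∈ B, ⟪b, y⟫ ≤ 1) → ∀ x ∈ convexHull ℝ B, ⟪x, y⟫ ≤ 1 := by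
    intro y hy x hx
    refine convexHull_min (t := {x | ⟪x, y⟫ ≤ 1}) hy ?_ hx
    have := convex_halfSpace_le (𝕜 := ℝ) (f := fun x : V => ⟪x, y⟫)
      ⟨fun a b => inner_add_left _ _ _, fun a b => real_inner_smul_left _ _ _⟩ 1
    exact this
  obtain ⟨r, hr, hball⟩ := Metric.mem_nhds_iff.1 (mem_interior_iff_mem_nhds.1 h0)
  set J : Finset (V × ℝ) := hB.toFinset.image fun b => (b, 1) with hJ
  have hJD : ∀ y : V, (∀ i ∈ J, ⟪i.1, y⟫ ≤ i.2) ↔ ∀ b ∈ B, ⟪b, y⟫ ≤ 1 := fun y => by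
    simp [hJ]
  have hbd : Bornology.IsBounded {y : V | ∀ i ∈ J, ⟪i.1, y⟫ ≤ i.2} := by
    refine (Metric.isBounded_closedBall (x := (0 : V)) (r := 2 / r)).subset fun y hy => ?_
    rw [mem_closedBall_zero_iff]
    by_cases hy0 : y = 0
    · rw [hy0, norm_zero]; positivity
    have hn : 0 < ‖y‖ := norm_pos_iff.2 hy0
    have hx : (r / 2 / ‖y‖) • y ∈ Metric.ball (0 : V) r := by
      rw [mem_ball_zero_iff, norm_smul, Real.norm_of_nonneg (by positivity),
        div_mul_cancel₀ _ hn.ne']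
      linarith
    have := hpolar ((hJD y).1 hy) _ (hball hx)
    rw [real_inner_smul_left, real_inner_self_eq_norm_sq] at this
    have h1 : r / 2 / ‖y‖ * ‖y‖ ^ 2 = r / 2 * ‖y‖ := by field_simp
    rw [h1] at this
    rw [le_div_iff₀ hr]
    linarith
  obtain ⟨E, hE, hDE⟩ := exists_finite_convexHull_eq_of_halfspaces J hbd
  refine ⟨(hE.toFinset.erase 0).image fun e => (e, 1), by simp +contextual [eq_comm], ?_⟩
  ext x
  constructor
  · intro hx i hi
    simp only [Finset.mem_image, Finset.mem_erase, Set.Finite.mem_toFinset] at hi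
    obtain ⟨e, ⟨-, he⟩, rfl⟩ := hi
    have : e ∈ {y : V | ∀ i ∈ J, ⟪i.1, y⟫ ≤ i.2} := hDE ▸ subset_convexHull ℝ E he
    rw [real_inner_comm]
    exact hpolar ((hJD e).1 this) x hx
  · intro hx
    by_contra hxB
    have hxE : ∀ e ∈ E, ⟪x, e⟫ ≤ 1 := fun e he => by
      by_cases he0 : e = 0
      · simp [he0]
      · rw [real_inner_comm]
        exact hx (e, 1) (by simp [he, he0])
    obtain ⟨f, u, hf, hu⟩ := geometric_hahn_banach_closed_point (convex_convexHull ℝ B)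
      (hB.isClosed_convexHull ℝ) hxB
    have hu0 : 0 < u := by simpa using hf 0 (interior_subset h0)
    set y := (InnerProductSpace.toDual ℝ V).symm f with hy
    have hfy : ∀ z, f z = ⟪y, z⟫ := fun z => by
      rw [hy, InnerProductSpace.toDual_symm_apply]
    have hyD : u⁻¹ • y ∈ convexHull ℝ E := by
      rw [← hDE]
      refine (hJD _).2 fun b hb => ?_
      have h1 := hf b (subset_convexHull ℝ B hb)
      rw [hfy] at h1
      rw [inner_smul_right, real_inner_comm, inv_mul_le_iff₀ hu0, mul_one]
      exact h1.le
    have h2 : ⟪x, u⁻¹ • y⟫ ≤ 1 := by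
      refine convexHull_min (t := {e | ⟪x, e⟫ ≤ 1}) hxE ?_ hyD
      have := convex_halfSpace_le (𝕜 := ℝ) (f := fun e : V => ⟪x, e⟫)
        ⟨fun a b => inner_add_right _ _ _, fun a b => real_inner_smul_right _ _ _⟩ 1
      exact this
    rw [inner_smul_right, real_inner_comm, inv_mul_le_iff₀ hu0, mul_one, ← hfy] at h2
    linarith

end Polytope

section Setup

variable [FiniteDimensional ℝ V]

/-- A point fixed by all simple reflections vanishes. -/
lemma RootSystemData.eq_zero_of_inner {n : ℕ} (S : RootSystemData V n) {x : V}
    (h : ∀ k, ⟪x, S.α k⟫ = 0) : x = 0 := by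
  rw [← inner_self_eq_zero (𝕜 := ℝ)]
  conv_lhs => rw [S.eq_sum_coweight x, sum_inner]
  refine Finset.sum_eq_zero fun k _ => ?_
  rw [← S.eq_sum_coweight x, real_inner_smul_left, real_inner_comm x (S.α k), h, mul_zero]

lemma RootSystemData.zero_mem_interior {n : ℕ} (S : RootSystemData V n) {P : Set V}
    (hconv : Convex ℝ P)
    (hP : ∀ g ∈ parabolic S.α Set.univ, g '' P = P) (hint : (interior P).Nonempty) :
    (0 : V) ∈ interior P := by
  obtain ⟨p, hp⟩ := hint
  have := S.finite_parabolic Set.univ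
  have := Fintype.ofFinite (parabolic S.α Set.univ)
  have hg : ∀ g : parabolic S.α Set.univ, g.1 p ∈ interior P := fun g => by
    have h1 : g.1 '' interior P = interior P := by
      have := g.1.toHomeomorph.image_interior P
      rw [LinearIsometryEquiv.coe_toHomeomorph, hP _ g.2] at this
      exact this
    rw [← h1]
    exact ⟨p, hp, rfl⟩
  set w : ℝ := (Fintype.card (parabolic S.α Set.univ) : ℝ)⁻¹
  have hw : 0 < w := by
    have : 0 < Fintype.card (parabolic S.α Set.univ) := Fintype.card_pos
    positivity
  have hmem : ∑ g : parabolic S.α Set.univ, w • g.1 p ∈ interior P :=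
    hconv.interior.sum_mem (fun _ _ => hw.le) (by simp [w]) fun g _ => hg g
  have h0 : ∑ g : parabolic S.α Set.univ, w • g.1 p = 0 := by
    refine S.eq_zero_of_inner fun k => ?_
    have hfix : reflEquiv (S.α k) (∑ g : parabolic S.α Set.univ, w • g.1 p) =
        ∑ g : parabolic S.α Set.univ, w • g.1 p := by
      rw [map_sum]
      refine Fintype.sum_equiv (Equiv.mulLeft (⟨reflEquiv (S.α k),
        reflEquiv_mem_parabolic (Set.mem_univ k)⟩ : parabolic S.α Set.univ)) _ _ fun g => ?_
      rw [map_smul]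
      rfl
    have := inner_reflEquiv_self (S.α k) (∑ g : parabolic S.α Set.univ, w • g.1 p)
    rw [hfix] at this
    linarith
  rwa [h0] at hmem

omit [FiniteDimensional ℝ V] in
lemma PermSetup.image_P {n : ℕ} (S : PermSetup V n) {g : V ≃ₗᵢ[ℝ] V}
    (hg : g ∈ parabolic S.α Set.univ) : g '' S.P = S.P := by
  have key : ∀ g ∈ parabolic S.α Set.univ, g '' S.P ⊆ S.P := by
    intro g hg
    have h1 : g '' S.P = convexHull ℝ (g '' ⋃ w ∈ WK S.α Set.univ, Set.image w S.Λ) :=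
      g.toLinearEquiv.toLinearMap.image_convexHull _
    rw [h1]
    refine convexHull_mono ?_
    rintro _ ⟨x, hx, rfl⟩
    simp only [Set.mem_iUnion] at hx ⊢
    obtain ⟨w, hw, y, hy, rfl⟩ := hx
    exact ⟨_, (WK S.α Set.univ).mul_mem (mem_WK_iff.2 ⟨g, hg, rfl⟩) hw, y, hy, rfl⟩
  refine (key g hg).antisymm fun x hx => ?_
  exact ⟨g⁻¹ x, key g⁻¹ (inv_mem hg) ⟨x, hx, rfl⟩, g.apply_symm_apply x⟩

omit [FiniteDimensional ℝ V] in
lemma PermSetup.exists_convexHull_eq {n : ℕ} (S : PermSetup V n) :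
    ∃ B : Set V, B.Finite ∧ S.P = convexHull ℝ B := by
  refine ⟨_, Set.Finite.biUnion ?_ fun w _ => S.hΛ_fin.image w, rfl⟩
  have := S.finite_parabolic Set.univ
  refine (Set.finite_range fun g : parabolic S.α Set.univ => (⇑g.1 : Function.End V)).subset ?_
  intro s hs
  obtain ⟨g, hg, rfl⟩ := mem_WK_iff.1 hs
  exact ⟨⟨g, hg⟩, rfl⟩

lemma PermSetup.isPolygon (S : PermSetup V 2) (hfull : (interior S.P).Nonempty) :
    IsPolygon S.P := by
  obtain ⟨B, hB, hPB⟩ := S.exists_convexHull_eq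
  have h0 : (0 : V) ∈ interior S.P :=
    S.zero_mem_interior (convex_convexHull ℝ _) (fun _ hg => S.image_P hg) hfull
  refine ⟨S.hdim, ?_, hfull, ?_⟩
  · rw [hPB]
    exact (hB.isCompact_convexHull ℝ).isBounded
  · rw [hPB] at h0 ⊢
    exact exists_halfspaces_of_convexHull hB h0

lemma IsPolygon.exists_convexHull_eq {Q : Set V} (hQ : IsPolygon Q) :
    ∃ B : Set V, B.Finite ∧ Q = convexHull ℝ B := by
  obtain ⟨I, -, rfl⟩ := hQ.exists_halfspaces
  exact exists_finite_convexHull_eq_of_halfspaces I hQ.bounded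

/-- A polygon cut by a chamber whose apex lies in its interior. -/
lemma IsPolygon.inter_cham {P : Set V} (hP : IsPolygon P) (h0 : (0 : V) ∈ interior P)
    (S : RootSystemData V 2) (K : Set (Fin 2)) : IsPolygon (P ∩ cham S.α K) := by
  classical
  refine ⟨hP.finrank_eq, hP.bounded.subset Set.inter_subset_left, ?_, ?_⟩
  · obtain ⟨ρ, hρ⟩ := S.exists_inner_eq fun _ => 1
    have hc : Continuous fun t : ℝ => t • ρ := by fun_prop
    have h1 : ∀ᶠ t : ℝ in nhdsWithin 0 (Set.Ioi 0), t • ρ ∈ interior P := by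
      refine ((hc.tendsto 0).mono_left nhdsWithin_le_nhds).eventually ?_
      rw [zero_smul]
      exact isOpen_interior.mem_nhds h0
    obtain ⟨t, htP, ht⟩ := (h1.and self_mem_nhdsWithin).exists
    refine ⟨t • ρ, ?_⟩
    rw [interior_inter]
    refine ⟨htP, ?_⟩
    have ho : IsOpen {x : V | ∀ k, 0 < ⟪x, S.α k⟫} := by
      simp only [Set.ofPred_forall]
      exact isOpen_iInter_of_finite fun k => isOpen_lt continuous_const (by fun_prop)
    refine interior_maximal (fun x hx k _ => (hx k).le) ho fun k => ?_
    rw [real_inner_smul_left, hρ, mul_one]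
    exact ht
  · obtain ⟨I, hI, hPI⟩ := hP.exists_halfspaces
    refine ⟨I ∪ (Finset.univ.filter (· ∈ K)).image fun k => (-S.α k, 0), ?_, ?_⟩
    · intro i hi
      rcases Finset.mem_union.1 hi with hi | hi
      · exact hI i hi
      · obtain ⟨k, -, rfl⟩ := Finset.mem_image.1 hi
        exact neg_ne_zero.2 (S.hR_ne0 _ (S.hα_mem k))
    · ext x
      rw [Set.mem_inter_iff, hPI]
      constructor
      · rintro ⟨h1, h2⟩ i hi
        rcases Finset.mem_union.1 hi with hi | hi
        · exact h1 i hi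
        · obtain ⟨k, hk, rfl⟩ := Finset.mem_image.1 hi
          have := h2 k (Finset.mem_filter.1 hk).2
          rw [inner_neg_left, real_inner_comm]
          linarith
      · refine fun h => ⟨fun i hi => h i (Finset.mem_union_left _ hi), fun k hk => ?_⟩
        have := h (-S.α k, 0) (Finset.mem_union_right _ (Finset.mem_image_of_mem _
          (Finset.mem_filter.2 ⟨Finset.mem_univ _, hk⟩)))
        simp only [inner_neg_left] at this
        rw [real_inner_comm]
        linarith

end Setup

section Symmetry

variable [FiniteDimensional ℝ V] {Q : Set V}

omit [FiniteDimensional ℝ V] in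
lemma IsEdge.image {F : Set V} {u : V} {c : ℝ} (h : IsEdge Q F u c) {g : V ≃ₗᵢ[ℝ] V}
    (hg : g '' Q = Q) : IsEdge Q (g '' F) (g u) c where
  norm_eq := by rw [LinearIsometryEquiv.norm_map, h.norm_eq]
  le x hx := by
    rw [← hg] at hx
    obtain ⟨y, hy, rfl⟩ := hx
    rw [LinearIsometryEquiv.inner_map_map]
    exact h.le y hy
  eq := by
    ext x
    constructor
    · rintro ⟨y, hy, rfl⟩
      rw [h.eq] at hy
      exact ⟨hg ▸ ⟨y, hy.1, rfl⟩, by rw [LinearIsometryEquiv.inner_map_map, hy.2]⟩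
    · rintro ⟨hx, hxc⟩
      rw [← hg] at hx
      obtain ⟨y, hy, rfl⟩ := hx
      rw [LinearIsometryEquiv.inner_map_map] at hxc
      exact ⟨y, by rw [h.eq]; exact ⟨hy, hxc⟩, rfl⟩
  nontrivial := h.nontrivial.image g.injective

namespace IsPolygon

lemma isFacet_image (hQ : IsPolygon Q) {g : V ≃ₗᵢ[ℝ] V} (hg : g '' Q = Q) {F : Set V}
    (hF : IsFacet Q F) : IsFacet Q (g '' F) :=
  (isFacet_iff hQ.finrank_eq hQ.interior_nonempty).2
    ⟨_, _, (hQ.isEdge ⟨F, hF⟩).image hg⟩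

lemma normalVec_image (hQ : IsPolygon Q) {g : V ≃ₗᵢ[ℝ] V} (hg : g '' Q = Q) {F : Set V}
    (hF : IsFacet Q F) : normalVec Q (g '' F) = g (normalVec Q F) :=
  ((hQ.isEdge ⟨F, hF⟩).image hg).normalVec_eq hQ.finrank_eq hQ.interior_nonempty

/-- The action on the facets of a group of symmetries of a polygon. -/
def facetHom (hQ : IsPolygon Q) (Γ : Subgroup (V ≃ₗᵢ[ℝ] V)) (hΓ : ∀ g ∈ Γ, g '' Q = Q) :
    Γ →* Equiv.Perm (Facets Q) :=
  letI : MulAction Γ (Facets Q) :=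
    { smul := fun g F => ⟨g.1 '' F.1, hQ.isFacet_image (hΓ g.1 g.2) F.2⟩
      one_smul := fun F => Subtype.ext (Set.image_id F.1)
      mul_smul := fun g g' F => Subtype.ext (Set.image_comp g.1 g'.1 F.1) }
  MulAction.toPermHom Γ (Facets Q)

variable (hQ : IsPolygon Q) {Γ : Subgroup (V ≃ₗᵢ[ℝ] V)} (hΓ : ∀ g ∈ Γ, g '' Q = Q)

lemma coe_facetHom (g : Γ) (F : Facets Q) : (hQ.facetHom Γ hΓ g F).1 = g.1 '' F.1 := rfl

lemma normalVec_facetHom (g : Γ) (F : Facets Q) :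
    normalVec Q (hQ.facetHom Γ hΓ g F).1 = g.1 (normalVec Q F.1) :=
  hQ.normalVec_image (hΓ g.1 g.2) F.2

lemma facetAdj_facetHom (g : Γ) (F G : Facets Q) :
    FacetAdj Q (hQ.facetHom Γ hΓ g F) (hQ.facetHom Γ hΓ g G) ↔ FacetAdj Q F G := by
  rw [FacetAdj, FacetAdj, coe_facetHom, coe_facetHom, ← Set.image_inter g.1.injective,
    Set.image_nonempty, (hQ.facetHom Γ hΓ g).injective.ne_iff]

lemma edgeWeight_facetHom [Fintype (Facets Q)] (g : Γ) (F G : Facets Q) :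
    edgeWeight Q (hQ.facetHom Γ hΓ g F) (hQ.facetHom Γ hΓ g G) = edgeWeight Q F G :=
  edgeWeight_perm _ (hQ.facetAdj_facetHom hΓ g)
    (fun F G => by rw [normalVec_facetHom, normalVec_facetHom, LinearIsometryEquiv.inner_map_map])
    F G

lemma map_polyIdeal_le (g : Γ) :
    (polyIdeal Q).map (MvPolynomial.renameEquiv ℝ (hQ.facetHom Γ hΓ g) :
      MvPolynomial (Facets Q) ℝ →+* MvPolynomial (Facets Q) ℝ) ≤ polyIdeal Q := by
  classical
  have := hQ.finite_facets
  have := Fintype.ofFinite (Facets Q)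
  rw [polyIdeal, Ideal.add_eq_sup, Ideal.map_sup]
  refine sup_le_sup ?_ ?_
  · rw [srIdeal, Ideal.map_span]
    refine Ideal.span_mono ?_
    rintro _ ⟨_, ⟨t, ht, rfl⟩, rfl⟩
    refine ⟨t.map (hQ.facetHom Γ hΓ g).toEmbedding, ?_, ?_⟩
    · refine Set.eq_empty_of_forall_notMem fun x hx => ?_
      have : g.1.symm x ∈ ⋂ F ∈ t, (F.1 : Set V) := by
        simp only [Set.mem_iInter] at hx ⊢
        intro F hF
        obtain ⟨y, hy, rfl⟩ := hx (hQ.facetHom Γ hΓ g F)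
          (Finset.mem_map_of_mem (hQ.facetHom Γ hΓ g).toEmbedding hF)
        rwa [LinearIsometryEquiv.symm_apply_apply]
      rw [ht] at this
      exact this
    · simp [MvPolynomial.renameEquiv]
  · rw [linIdeal, Ideal.map_span]
    refine Ideal.span_mono ?_
    rintro _ ⟨_, ⟨u, rfl⟩, rfl⟩
    refine ⟨g.1 u, ?_⟩
    rw [finsum_eq_sum_of_fintype, finsum_eq_sum_of_fintype, map_sum]
    refine Eq.trans ?_ (Equiv.sum_comp (hQ.facetHom Γ hΓ g) fun F =>
      MvPolynomial.C ⟪g.1 u, normalVec Q F.1⟫ * MvPolynomial.X F)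
    refine Finset.sum_congr rfl fun F _ => ?_
    rw [normalVec_facetHom, LinearIsometryEquiv.inner_map_map]
    simp [MvPolynomial.renameEquiv]

lemma map_polyIdeal (g : Γ) :
    (polyIdeal Q).map (MvPolynomial.renameEquiv ℝ (hQ.facetHom Γ hΓ g) :
      MvPolynomial (Facets Q) ℝ →+* MvPolynomial (Facets Q) ℝ) = polyIdeal Q := by
  refine (hQ.map_polyIdeal_le hΓ g).antisymm fun p hp => ?_
  have h1 := hQ.map_polyIdeal_le hΓ g⁻¹ (Ideal.mem_map_of_mem _ hp)
  have h2 := Ideal.mem_map_of_mem (MvPolynomial.renameEquiv ℝ (hQ.facetHom Γ hΓ g) :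
      MvPolynomial (Facets Q) ℝ →+* MvPolynomial (Facets Q) ℝ) h1
  convert h2
  change p = MvPolynomial.rename _ (MvPolynomial.rename _ p)
  rw [MvPolynomial.rename_rename, ← Equiv.Perm.coe_mul, ← map_mul, mul_inv_cancel, map_one,
    Equiv.Perm.coe_one, MvPolynomial.rename_id]
  rfl

/-- The action on the polytopal algebra of a group of symmetries of a polygon. -/
def polyAlgHom : Γ →* (PolyAlg Q ≃ₐ[ℝ] PolyAlg Q) :=
  MonoidHom.mk'
    (fun g => Ideal.quotientEquivAlg _ _ (MvPolynomial.renameEquiv ℝ (hQ.facetHom Γ hΓ g))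
      (hQ.map_polyIdeal hΓ g).symm)
    fun g g' => by
      refine AlgEquiv.coe_toAlgHom_injective (PolyAlg.algHom_ext fun F => ?_)
      change polyMk Q (MvPolynomial.rename _ (MvPolynomial.X F)) =
        polyMk Q (MvPolynomial.rename _ (MvPolynomial.rename _ (MvPolynomial.X F)))
      simp only [MvPolynomial.rename_X, map_mul, Equiv.Perm.mul_apply]

lemma polyAlgHom_polyVar (g : Γ) (F : Facets Q) :
    hQ.polyAlgHom hΓ g (polyVar Q F) = polyVar Q (hQ.facetHom Γ hΓ g F) := by
  change polyMk Q (MvPolynomial.rename _ (MvPolynomial.X F)) = _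
  rw [MvPolynomial.rename_X]
  rfl

end IsPolygon

end Symmetry

section Chamber

/-- A polygon around the origin which is symmetric under the parabolic subgroup `W_K`. -/
structure IsSymPolygon (S : RootSystemData V 2) (K : Set (Fin 2)) (P : Set V) : Prop
    extends IsPolygon P where
  zero_mem : (0 : V) ∈ interior P
  image_eq : ∀ g ∈ parabolic S.α K, g '' P = P

variable {S : RootSystemData V 2} {K : Set (Fin 2)} {P : Set V}

namespace IsSymPolygon

lemma apply_mem (h : IsSymPolygon S K P) {g : V ≃ₗᵢ[ℝ] V} (hg : g ∈ parabolic S.α K) {x : V}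
    (hx : x ∈ P) : g x ∈ P := by
  rw [← h.image_eq g hg]
  exact ⟨x, hx, rfl⟩

variable [FiniteDimensional ℝ V]

lemma edgeHeight_pos (h : IsSymPolygon S K P) (F : Facets P) : 0 < edgeHeight P F.1 := by
  have hne : normalVec P F.1 ≠ 0 := (h.isEdge F).ne_zero
  have h2 : ∀ᶠ t : ℝ in nhdsWithin 0 (Set.Ioi 0), t • normalVec P F.1 ∈ P := by
    have hc : Continuous fun t : ℝ => t • normalVec P F.1 := by fun_prop
    refine ((hc.tendsto 0).mono_left nhdsWithin_le_nhds).eventually ?_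
    rw [zero_smul]
    exact mem_interior_iff_mem_nhds.1 h.zero_mem
  obtain ⟨t, htP, ht⟩ := (h2.and self_mem_nhdsWithin).exists
  have := h.inner_le F htP
  rw [inner_smul_right, real_inner_self_eq_norm_sq, h.norm_normalVec] at this
  have ht' : (0 : ℝ) < t := ht
  linarith

lemma eq_zero_of_inner_normalVec (h : IsSymPolygon S K P) {x : V}
    (hx : ∀ F : Facets P, ⟪x, normalVec P F.1⟫ = 0) : x = 0 := by
  obtain ⟨M, hM⟩ := h.bounded.exists_norm_le
  by_contra hx0
  have hn : 0 < ‖x‖ := norm_pos_iff.2 hx0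
  have hM0 : 0 ≤ M := (norm_nonneg _).trans (hM 0 (interior_subset h.zero_mem))
  have h1 : ((M + 1) / ‖x‖) • x ∈ P := h.mem_iff.2 fun F => by
    rw [inner_smul_right, real_inner_comm, hx, mul_zero]
    exact (h.edgeHeight_pos F).le
  have h2 := hM _ h1
  rw [norm_smul, Real.norm_of_nonneg (by positivity), div_mul_cancel₀ _ hn.ne'] at h2
  linarith

/-- The action of `W_K` on the facets. -/
def act (h : IsSymPolygon S K P) : parabolic S.α K →* Equiv.Perm (Facets P) :=
  h.facetHom _ h.image_eq

lemma coe_act (h : IsSymPolygon S K P) (g : parabolic S.α K) (F : Facets P) :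
    (h.act g F).1 = g.1 '' F.1 := rfl

lemma normalVec_act (h : IsSymPolygon S K P) (g : parabolic S.α K) (F : Facets P) :
    normalVec P (h.act g F).1 = g.1 (normalVec P F.1) := h.normalVec_facetHom _ g F

lemma act_eq_self (h : IsSymPolygon S K P) {g : parabolic S.α K} {F : Facets P}
    (hg : g.1 (normalVec P F.1) = normalVec P F.1) : h.act g F = F :=
  h.facet_ext (by rw [normalVec_act, hg])

/-- The simple reflection attached to `k ∈ K`. -/
def refl (S : RootSystemData V 2) {k : Fin 2} (hk : k ∈ K) : parabolic S.α K :=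
  ⟨reflEquiv (S.α k), reflEquiv_mem_parabolic hk⟩

omit [FiniteDimensional ℝ V] in
lemma inner_self_pos (S : RootSystemData V 2) (k : Fin 2) : 0 < ⟪S.α k, S.α k⟫ :=
  real_inner_self_pos.2 (S.hR_ne0 _ (S.hα_mem k))

lemma inner_normalVec_nonneg (h : IsSymPolygon S K P) {F : Facets P} {x : V} (hx : x ∈ F.1)
    {k : Fin 2} (hk : k ∈ K) (hxk : 0 < ⟪x, S.α k⟫) : 0 ≤ ⟪normalVec P F.1, S.α k⟫ := by
  rw [h.mem_facet_iff] at hx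
  have h1 := h.inner_le F (h.apply_mem (reflEquiv_mem_parabolic hk) hx.1)
  rw [reflEquiv_apply, inner_sub_right, inner_smul_right, hx.2] at h1
  have := inner_self_pos S k
  have h2 : 0 < 2 * ⟪x, S.α k⟫ / ⟪S.α k, S.α k⟫ := by positivity
  exact nonneg_of_mul_nonneg_right (by linarith) h2

/-- Two distinct points of a facet do not both lie on a line through the origin. -/
lemma exists_inner_ne_zero (h : IsSymPolygon S K P) {F : Facets P} {x y : V} (hx : x ∈ F.1)
    (hy : y ∈ F.1) (hxy : x ≠ y) {a : V} (ha : a ≠ 0) : ⟪x, a⟫ ≠ 0 ∨ ⟪y, a⟫ ≠ 0 := by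
  by_contra! hc
  rw [h.mem_facet_iff] at hx hy
  have hpos := h.edgeHeight_pos F
  obtain ⟨d, -, hdu, hfr, hex⟩ := exists_frame h.finrank_eq (h.norm_normalVec F)
  have e1 := hfr x a
  have e2 := hfr y a
  rw [hx.2, hc.1] at e1
  rw [hy.2, hc.2] at e2
  have hd : ⟪d, x⟫ ≠ ⟪d, y⟫ := fun hd => hxy (by rw [hex x, hex y, hx.2, hy.2, hd])
  have h1 : (⟪d, x⟫ - ⟪d, y⟫) * ⟪d, a⟫ = 0 := by linarith
  have h2 : ⟪d, a⟫ = 0 := (mul_eq_zero.1 h1).resolve_left (sub_ne_zero.2 hd)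
  rw [h2, mul_zero, add_zero] at e1
  have h3 : ⟪normalVec P F.1, a⟫ = 0 := (mul_eq_zero.1 e1.symm).resolve_left hpos.ne'
  exact ha (by rw [hex a, h2, h3]; simp)

lemma normalVec_mem_cham (h : IsSymPolygon S K P) {F : Facets P}
    (hF : (F.1 ∩ cham S.α K).Nontrivial) : normalVec P F.1 ∈ cham S.α K := by
  obtain ⟨x, hx, y, hy, hxy⟩ := hF
  intro k hk
  rcases h.exists_inner_ne_zero hx.1 hy.1 hxy (S.hR_ne0 _ (S.hα_mem k)) with h1 | h1
  · exact h.inner_normalVec_nonneg hx.1 hk (lt_of_le_of_ne (hx.2 k hk) h1.symm)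
  · exact h.inner_normalVec_nonneg hy.1 hk (lt_of_le_of_ne (hy.2 k hk) h1.symm)

lemma inter_cham_nontrivial (h : IsSymPolygon S K P) {F : Facets P}
    (hF : normalVec P F.1 ∈ cham S.α K) : (F.1 ∩ cham S.α K).Nontrivial := by
  have := S.finite_parabolic K
  have hinf : F.1.Infinite := by
    obtain ⟨x, hx, y, hy, hxy⟩ := (h.isEdge F).nontrivial
    have hconv : Convex ℝ F.1 := by
      rw [(h.isEdge F).eq]
      exact h.convex.inter (convex_hyperplane
        ⟨fun a b => inner_add_right _ _ _, fun a b => real_inner_smul_right _ _ _⟩ _)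
    refine Set.Infinite.mono (hconv.segment_subset hx hy) ?_
    rw [segment_eq_image_lineMap]
    exact (Set.Icc_infinite zero_lt_one).image (AffineMap.lineMap_injective ℝ hxy).injOn
  obtain ⟨g, hg⟩ : ∃ g : parabolic S.α K, {x ∈ F.1 | g.1 x ∈ cham S.α K}.Infinite := by
    by_contra! hc
    refine hinf ((Set.finite_iUnion hc).subset fun x hx => ?_)
    obtain ⟨g, hg, hgx⟩ := S.exists_mem_cham K x
    exact Set.mem_iUnion.2 ⟨⟨g, hg⟩, hx, hgx⟩
  have h1 : ((h.act g F).1 ∩ cham S.α K).Nontrivial := by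
    refine (hg.nontrivial.image g.1.injective).mono ?_
    rintro _ ⟨x, hx, rfl⟩
    exact ⟨⟨x, hx.1, rfl⟩, hx.2⟩
  have h2 := h.normalVec_mem_cham h1
  rw [normalVec_act] at h2
  rwa [h.act_eq_self (S.eq_of_mem_cham g.2 hF h2)] at h1

end IsSymPolygon

end Chamber

section ChamberFacets

variable [FiniteDimensional ℝ V] {S : RootSystemData V 2} {K : Set (Fin 2)} {P : Set V}

namespace IsSymPolygon

lemma isPolygon_inter (h : IsSymPolygon S K P) : IsPolygon (P ∩ cham S.α K) :=
  h.toIsPolygon.inter_cham h.zero_mem S K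

lemma isEdge_inter (h : IsSymPolygon S K P) {F : Facets P}
    (hF : normalVec P F.1 ∈ cham S.α K) :
    IsEdge (P ∩ cham S.α K) (F.1 ∩ cham S.α K) (normalVec P F.1) (edgeHeight P F.1) where
  norm_eq := h.norm_normalVec F
  le x hx := h.inner_le F hx.1
  eq := by
    ext x
    rw [Set.mem_inter_iff, h.mem_facet_iff]
    exact ⟨fun hx => ⟨⟨hx.1.1, hx.2⟩, hx.1.2⟩, fun hx => ⟨⟨hx.1.1, hx.2⟩, hx.1.2⟩⟩
  nontrivial := h.inter_cham_nontrivial hF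

omit [FiniteDimensional ℝ V] in
lemma norm_root_pos (S : RootSystemData V 2) (k : Fin 2) : 0 < ‖S.α k‖ :=
  norm_pos_iff.2 (S.hR_ne0 _ (S.hα_mem k))

lemma isEdge_wall (h : IsSymPolygon S K P) {k : Fin 2} (hk : k ∈ K) :
    IsEdge (P ∩ cham S.α K) (P ∩ cham S.α K ∩ hplane (S.α k)) (-(‖S.α k‖⁻¹ • S.α k)) 0 where
  norm_eq := by
    rw [norm_neg, norm_smul, norm_inv, norm_norm, inv_mul_cancel₀ (norm_root_pos S k).ne']
  le x hx := by
    have := hx.2 k hk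
    rw [inner_neg_left, real_inner_smul_left, real_inner_comm, neg_nonpos]
    exact mul_nonneg (inv_nonneg.2 (norm_nonneg _)) this
  eq := by
    ext x
    rw [Set.mem_inter_iff, hplane, Set.mem_ofPred_eq, Set.mem_ofPred_eq, inner_neg_left,
      real_inner_smul_left, real_inner_comm, neg_eq_zero, mul_eq_zero,
      or_iff_right (inv_ne_zero (norm_root_pos S k).ne')]
  nontrivial := by
    obtain ⟨j, hj⟩ : ∃ j : Fin 2, j ≠ k := exists_ne k
    have h2 : ∀ᶠ t : ℝ in nhdsWithin 0 (Set.Ioi 0), t • S.coweight j ∈ P := by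
      have hc : Continuous fun t : ℝ => t • S.coweight j := by fun_prop
      refine ((hc.tendsto 0).mono_left nhdsWithin_le_nhds).eventually ?_
      rw [zero_smul]
      exact mem_interior_iff_mem_nhds.1 h.zero_mem
    obtain ⟨t, htP, ht⟩ := (h2.and self_mem_nhdsWithin).exists
    have ht' : (0 : ℝ) < t := ht
    have hin : ∀ i, ⟪t • S.coweight j, S.α i⟫ = t * (Pi.single j 1 : Fin 2 → ℝ) i := fun i => by
      rw [real_inner_smul_left, S.inner_coweight]
    refine ⟨0, ⟨⟨interior_subset h.zero_mem, fun i _ => by rw [inner_zero_left]⟩,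
      inner_zero_left _⟩, t • S.coweight j, ⟨⟨htP, fun i _ => ?_⟩, ?_⟩, fun h0 => ?_⟩
    · rw [hin]
      refine mul_nonneg ht'.le ?_
      rw [Pi.single_apply]
      split_ifs <;> norm_num
    · rw [hplane, Set.mem_ofPred_eq, hin, Pi.single_apply, if_neg hj.symm, mul_zero]
    · have := hin j
      rw [← h0, inner_zero_left, Pi.single_eq_same, mul_one] at this
      exact ht'.ne this

/-- The facet of `P ∩ C_K` cut out by a facet of `P` with normal in the chamber. -/
def inFacet (h : IsSymPolygon S K P) {F : Facets P} (hF : normalVec P F.1 ∈ cham S.α K) :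
    Facets (P ∩ cham S.α K) :=
  ⟨F.1 ∩ cham S.α K, (isFacet_iff h.finrank_eq h.isPolygon_inter.interior_nonempty).2
    ⟨_, _, h.isEdge_inter hF⟩⟩

/-- The facet of `P ∩ C_K` on a wall of the chamber. -/
def wall (h : IsSymPolygon S K P) {k : Fin 2} (hk : k ∈ K) : Facets (P ∩ cham S.α K) :=
  ⟨P ∩ cham S.α K ∩ hplane (S.α k),
    (isFacet_iff h.finrank_eq h.isPolygon_inter.interior_nonempty).2 ⟨_, _, h.isEdge_wall hk⟩⟩

lemma normalVec_inFacet (h : IsSymPolygon S K P) {F : Facets P}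
    (hF : normalVec P F.1 ∈ cham S.α K) :
    normalVec (P ∩ cham S.α K) (h.inFacet hF).1 = normalVec P F.1 :=
  (h.isEdge_inter hF).normalVec_eq h.finrank_eq h.isPolygon_inter.interior_nonempty

lemma normalVec_wall (h : IsSymPolygon S K P) {k : Fin 2} (hk : k ∈ K) :
    normalVec (P ∩ cham S.α K) (h.wall hk).1 = -(‖S.α k‖⁻¹ • S.α k) :=
  (h.isEdge_wall hk).normalVec_eq h.finrank_eq h.isPolygon_inter.interior_nonempty

lemma inFacet_ne_wall (h : IsSymPolygon S K P) {F : Facets P}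
    (hF : normalVec P F.1 ∈ cham S.α K) {k : Fin 2} (hk : k ∈ K) :
    h.inFacet hF ≠ h.wall hk := fun he => by
  have h1 := h.normalVec_inFacet hF
  rw [he, h.normalVec_wall hk] at h1
  have h2 := hF k hk
  rw [← h1, inner_neg_left, real_inner_smul_left] at h2
  have := mul_pos (inv_pos.2 (norm_root_pos S k)) (inner_self_pos S k)
  linarith

lemma wall_injective (h : IsSymPolygon S K P) {k l : Fin 2} (hk : k ∈ K) (hl : l ∈ K)
    (hkl : h.wall hk = h.wall hl) : k = l := by
  by_contra hne
  have h1 := h.normalVec_wall hk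
  rw [hkl, h.normalVec_wall hl, neg_inj] at h1
  have h2 := congrArg (fun x => ⟪S.coweight k, x⟫) h1
  simp only [inner_smul_right, S.inner_coweight, Pi.single_eq_same, Pi.single_apply,
    if_neg (Ne.symm hne), mul_zero, mul_one] at h2
  exact (inv_pos.2 (norm_root_pos S k)).ne h2

lemma facet_cases (h : IsSymPolygon S K P) (F' : Facets (P ∩ cham S.α K)) :
    (∃ (F : Facets P) (hF : normalVec P F.1 ∈ cham S.α K), F' = h.inFacet hF) ∨
      ∃ (k : Fin 2) (hk : k ∈ K), F' = h.wall hk := by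
  classical
  have := h.finite_facets
  have := Fintype.ofFinite (Facets P)
  have hE := h.isPolygon_inter.isEdge F'
  set I : Finset (V × ℝ) :=
    (Finset.univ.image fun F : Facets P => (normalVec P F.1, edgeHeight P F.1)) ∪
      (Finset.univ.filter (· ∈ K)).image fun k => (-(‖S.α k‖⁻¹ • S.α k), 0) with hI
  have hI0 : ∀ i ∈ I, ‖i.1‖ = 1 := by
    intro i hi
    rcases Finset.mem_union.1 hi with hi | hi
    · obtain ⟨F, -, rfl⟩ := Finset.mem_image.1 hi
      exact h.norm_normalVec F
    · obtain ⟨k, hk, rfl⟩ := Finset.mem_image.1 hi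
      exact (h.isEdge_wall (Finset.mem_filter.1 hk).2).norm_eq
  have hQI : P ∩ cham S.α K = {x | ∀ i ∈ I, ⟪i.1, x⟫ ≤ i.2} := by
    ext x
    constructor
    · intro hx i hi
      rcases Finset.mem_union.1 hi with hi | hi
      · obtain ⟨F, -, rfl⟩ := Finset.mem_image.1 hi
        exact h.inner_le F hx.1
      · obtain ⟨k, hk, rfl⟩ := Finset.mem_image.1 hi
        exact (h.isEdge_wall (Finset.mem_filter.1 hk).2).le x hx
    · refine fun hx => ⟨h.mem_iff.2 fun F => hx (_, _) (Finset.mem_union_left _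
        (Finset.mem_image_of_mem _ (Finset.mem_univ F))), fun k hk => ?_⟩
      have := hx (_, _) (Finset.mem_union_right _ (Finset.mem_image_of_mem _
        (Finset.mem_filter.2 ⟨Finset.mem_univ k, hk⟩)))
      rw [inner_neg_left, real_inner_smul_left, real_inner_comm, neg_nonpos] at this
      exact nonneg_of_mul_nonneg_right this (inv_pos.2 (norm_root_pos S k))
  obtain ⟨i, hi, hu, hc⟩ := hE.exists_halfspace h.finrank_eq h.isPolygon_inter.interior_nonempty
    (fun i hi => norm_ne_zero_iff.1 (by rw [hI0 i hi]; norm_num)) hQI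
  rw [hI0 i hi, inv_one, one_smul] at hu
  rw [hI0 i hi, inv_one, one_mul] at hc
  rcases Finset.mem_union.1 hi with hi | hi
  · left
    obtain ⟨F, -, rfl⟩ := Finset.mem_image.1 hi
    have hF : normalVec P F.1 ∈ cham S.α K := by
      refine h.normalVec_mem_cham (hE.nontrivial.mono fun x hx => ?_)
      rw [hE.eq, hu, hc] at hx
      exact ⟨h.mem_facet_iff.2 ⟨hx.1.1, hx.2⟩, hx.1.2⟩
    exact ⟨F, hF, h.isPolygon_inter.facet_ext (by rw [h.normalVec_inFacet, hu])⟩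
  · right
    obtain ⟨k, hk, rfl⟩ := Finset.mem_image.1 hi
    have hk := (Finset.mem_filter.1 hk).2
    exact ⟨k, hk, h.isPolygon_inter.facet_ext (by rw [h.normalVec_wall, hu])⟩

/-- The indices of the walls of the chamber that meet the facet `F` inside the chamber. -/
def adjWalls (S : RootSystemData V 2) (K : Set (Fin 2)) (F : Set V) : Set (Fin 2) :=
  {l | l ∈ K ∧ ∃ x ∈ F ∩ cham S.α K, ⟪x, S.α l⟫ = 0}

lemma exists_fold_of_mem_cham (h : IsSymPolygon S K P) {F G : Facets P} (hFG : F ≠ G) {v : V}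
    (hvF : v ∈ F.1) (hvG : v ∈ G.1) (hv : v ∈ cham S.α K) :
    ∃ g ∈ parabolic S.α (adjWalls S K F.1), (g (normalVec P G.1) = normalVec P F.1) ∨
      (g (normalVec P G.1) ∈ cham S.α K ∧ (F.1 ∩ (g '' G.1) ∩ cham S.α K).Nonempty) := by
  by_cases hG : normalVec P G.1 ∈ cham S.α K
  · exact ⟨1, one_mem _, Or.inr ⟨hG, v, ⟨hvF, v, hvG, rfl⟩, hv⟩⟩
  · have hG' : ∃ l ∈ K, ⟪normalVec P G.1, S.α l⟫ < 0 := by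
      by_contra! hc
      exact hG hc
    obtain ⟨l, hl, hlt⟩ := hG'
    have hv0 : ⟪v, S.α l⟫ = 0 := by
      refine le_antisymm (not_lt.1 fun hpos => ?_) (hv l hl)
      exact (h.inner_normalVec_nonneg hvG hl hpos).not_gt hlt
    refine ⟨reflEquiv (S.α l), reflEquiv_mem_parabolic ⟨hl, v, ⟨hvF, hv⟩, hv0⟩, Or.inl ?_⟩
    have hn := h.normalVec_act (refl S hl) G
    have hGl : G ≠ h.act (refl S hl) G := fun he => by
      rw [← he] at hn
      have h1 := inner_reflEquiv_self (S.α l) (normalVec P G.1)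
      change _ = reflEquiv (S.α l) _ at hn
      rw [← hn] at h1
      linarith
    by_contra hne
    have hFl : F ≠ h.act (refl S hl) G := fun he => hne (by rw [he, hn]; rfl)
    exact h.inter_inter_eq_empty hFG hFl hGl hvF hvG
      ⟨v, hvG, reflEquiv_of_inner_eq_zero hv0⟩

lemma inner_normalVec_eq_zero (h : IsSymPolygon S K P) {F : Facets P}
    (hF : normalVec P F.1 ∈ cham S.α K) {x : V} (hx : x ∈ F.1) {l : Fin 2} (hl : l ∈ K)
    (hxl : ⟪x, S.α l⟫ < 0) : ⟪normalVec P F.1, S.α l⟫ = 0 := by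
  refine le_antisymm ?_ (hF l hl)
  rw [h.mem_facet_iff] at hx
  have h1 := h.inner_le F (h.apply_mem (reflEquiv_mem_parabolic hl) hx.1)
  rw [reflEquiv_apply, inner_sub_right, inner_smul_right, hx.2] at h1
  have := inner_self_pos S l
  have h2 : 2 * ⟪x, S.α l⟫ / ⟪S.α l, S.α l⟫ < 0 := div_neg_of_neg_of_pos (by linarith) this
  nlinarith

/-- A neighbour of a facet `F` with normal in the chamber is folded by the reflections in the
walls meeting `F` onto `F` or onto a neighbour of `F` inside the chamber. -/
lemma exists_fold (h : IsSymPolygon S K P) {F G : Facets P}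
    (hF : normalVec P F.1 ∈ cham S.α K) (hFG : FacetAdj P F G) :
    ∃ g ∈ parabolic S.α (adjWalls S K F.1), (g (normalVec P G.1) = normalVec P F.1) ∨
      (g (normalVec P G.1) ∈ cham S.α K ∧ (F.1 ∩ (g '' G.1) ∩ cham S.α K).Nonempty) := by
  obtain ⟨hne, v, hvF, hvG⟩ := hFG
  by_cases hv : v ∈ cham S.α K
  · exact h.exists_fold_of_mem_cham hne hvF hvG hv
  have hv' : ∃ l ∈ K, ⟪v, S.α l⟫ < 0 := by
    by_contra! hc
    exact hv hc
  obtain ⟨l, hl, hlt⟩ := hv'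
  have hl0 := h.inner_normalVec_eq_zero hF hvF hl hlt
  have hFl : h.act (refl S hl) F = F := h.act_eq_self (reflEquiv_of_inner_eq_zero hl0)
  have hcham : ∀ x ∈ F.1, 0 ≤ ⟪x, S.α l⟫ → x ∈ cham S.α K := by
    intro x hx hxl k hk
    by_contra! hneg
    have hkl : k ≠ l := by rintro rfl; linarith
    have hk0 := h.inner_normalVec_eq_zero hF hx hk hneg
    refine (h.isEdge F).ne_zero (S.eq_zero_of_inner fun i => ?_)
    have : i = k ∨ i = l := by omega
    rcases this with rfl | rfl
    exacts [hk0, hl0]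
  set v' := reflEquiv (S.α l) v with hv'
  have hv'F : v' ∈ F.1 := by
    rw [← hFl]
    exact ⟨v, hvF, rfl⟩
  have hv'l : ⟪v', S.α l⟫ = -⟪v, S.α l⟫ := inner_reflEquiv_self _ _
  have hmF : midpoint ℝ v v' ∈ F.1 := by
    rw [h.mem_facet_iff] at hvF hv'F ⊢
    refine ⟨h.convex.midpoint_mem hvF.1 hv'F.1, ?_⟩
    rw [midpoint_eq_smul_add, inner_smul_right, inner_add_right, hvF.2, hv'F.2, invOf_eq_inv]
    ring
  have hml : ⟪midpoint ℝ v v', S.α l⟫ = 0 := by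
    rw [midpoint_eq_smul_add, real_inner_smul_left, inner_add_left, hv'l]
    ring
  have hladj : l ∈ adjWalls S K F.1 := ⟨hl, _, ⟨hmF, hcham _ hmF hml.ge⟩, hml⟩
  obtain ⟨g, hg, hg'⟩ := h.exists_fold_of_mem_cham (F := F) (G := h.act (refl S hl) G)
    (fun he => hne ((h.act (refl S hl)).injective (hFl.trans he))) hv'F ⟨v, hvG, rfl⟩
    (hcham v' hv'F (by rw [hv'l]; linarith))
  refine ⟨g * reflEquiv (S.α l), mul_mem hg (reflEquiv_mem_parabolic hladj), ?_⟩
  rw [normalVec_act, coe_act, ← Set.image_comp] at hg'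
  exact hg'

end IsSymPolygon

end ChamberFacets

section Extension

variable [FiniteDimensional ℝ V] {S : RootSystemData V 2} {K : Set (Fin 2)} {P : Set V}

namespace IsSymPolygon

lemma exists_rep (h : IsSymPolygon S K P) (F : Facets P) :
    ∃ g : parabolic S.α K, normalVec P (h.act g F).1 ∈ cham S.α K := by
  obtain ⟨g, hg, hgF⟩ := S.exists_mem_cham K (normalVec P F.1)
  exact ⟨⟨g, hg⟩, by rwa [normalVec_act]⟩

/-- The facet of `P ∩ C_K` to which a facet of `P` is folded by `W_K`. -/
def rep (h : IsSymPolygon S K P) (F : Facets P) : Facets (P ∩ cham S.α K) :=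
  h.inFacet (h.exists_rep F).choose_spec

lemma rep_eq (h : IsSymPolygon S K P) {F : Facets P} {g : parabolic S.α K}
    (hg : normalVec P (h.act g F).1 ∈ cham S.α K) : h.rep F = h.inFacet hg := by
  refine h.isPolygon_inter.facet_ext ?_
  have hg₀ := (h.exists_rep F).choose_spec
  rw [rep, h.normalVec_inFacet, h.normalVec_inFacet]
  set g₀ := (h.exists_rep F).choose
  rw [normalVec_act] at hg hg₀
  rw [normalVec_act, normalVec_act]
  have hmul : (g * g₀⁻¹).1 (g₀.1 (normalVec P F.1)) = g.1 (normalVec P F.1) :=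
    congrArg g.1 (g₀.1.symm_apply_apply _)
  have := S.eq_of_mem_cham (g * g₀⁻¹).2 hg₀ (by rwa [hmul])
  rw [← hmul, this]

lemma rep_of_mem (h : IsSymPolygon S K P) {F : Facets P}
    (hF : normalVec P F.1 ∈ cham S.α K) : h.rep F = h.inFacet hF := by
  rw [h.rep_eq (F := F) (g := 1) (by rwa [map_one])]
  exact h.isPolygon_inter.facet_ext (by
    rw [normalVec_inFacet, normalVec_inFacet, map_one]; rfl)

lemma rep_act (h : IsSymPolygon S K P) (g : parabolic S.α K) (F : Facets P) :
    h.rep (h.act g F) = h.rep F := by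
  obtain ⟨g₀, hg₀⟩ := h.exists_rep F
  have hact : h.act (g₀ * g⁻¹) (h.act g F) = h.act g₀ F := by
    rw [← Equiv.Perm.mul_apply, ← map_mul, inv_mul_cancel_right]
  rw [h.rep_eq hg₀, h.rep_eq (F := h.act g F) (g := g₀ * g⁻¹) (by rwa [hact])]
  exact h.isPolygon_inter.facet_ext (by rw [normalVec_inFacet, normalVec_inFacet, hact])

lemma exists_normalVec_rep (h : IsSymPolygon S K P) (F : Facets P) :
    ∃ g : parabolic S.α K,
      normalVec (P ∩ cham S.α K) (h.rep F).1 = g.1 (normalVec P F.1) :=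
  ⟨_, (h.normalVec_inFacet _).trans (h.normalVec_act _ F)⟩

lemma exists_act_eq (h : IsSymPolygon S K P) {F G : Facets P} (hFG : h.rep F = h.rep G) :
    ∃ g, h.act g F = G := by
  obtain ⟨g, hg⟩ := h.exists_normalVec_rep F
  obtain ⟨g', hg'⟩ := h.exists_normalVec_rep G
  refine ⟨g'⁻¹ * g, h.facet_ext ?_⟩
  rw [normalVec_act]
  change g'.1.symm (g.1 _) = _
  rw [← hg, hFG, hg', LinearIsometryEquiv.symm_apply_apply]

lemma rep_ne_wall (h : IsSymPolygon S K P) (F : Facets P) {k : Fin 2} (hk : k ∈ K) :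
    h.rep F ≠ h.wall hk := h.inFacet_ne_wall _ hk

open Classical in
/-- The vector whose linear form on the facets of `P ∩ C_K` agrees with `f` on the walls. -/
def wallPart (h : IsSymPolygon S K P) : (Facets (P ∩ cham S.α K) → ℝ) →ₗ[ℝ] V :=
  ∑ k : Fin 2, if hk : k ∈ K then
    (LinearMap.proj (h.wall hk)).smulRight (-(‖S.α k‖ • S.coweight k)) else 0

lemma inner_wallPart (h : IsSymPolygon S K P) (f : Facets (P ∩ cham S.α K) → ℝ) {k : Fin 2}
    (hk : k ∈ K) : ⟪h.wallPart f, -(‖S.α k‖⁻¹ • S.α k)⟫ = f (h.wall hk) := by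
  rw [wallPart, LinearMap.sum_apply, sum_inner, Finset.sum_eq_single k]
  · rw [dif_pos hk, LinearMap.smulRight_apply, LinearMap.proj_apply, real_inner_smul_left,
      inner_neg_neg, real_inner_smul_left, inner_smul_right, S.inner_coweight,
      Pi.single_eq_same, mul_one, mul_inv_cancel₀ (norm_root_pos S k).ne', mul_one]
  · intro l _ hlk
    split_ifs with hl
    · rw [LinearMap.smulRight_apply, LinearMap.proj_apply, real_inner_smul_left,
        inner_neg_neg, real_inner_smul_left, inner_smul_right, S.inner_coweight,
        Pi.single_apply, if_neg hlk.symm, mul_zero, mul_zero, mul_zero]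
    · rw [LinearMap.zero_apply, inner_zero_left]
  · exact fun hk' => absurd (Finset.mem_univ k) hk'

lemma wallPart_eq_zero (h : IsSymPolygon S K P) {f : Facets (P ∩ cham S.α K) → ℝ}
    (hf : ∀ k (hk : k ∈ K), f (h.wall hk) = 0) : h.wallPart f = 0 := by
  rw [wallPart, LinearMap.sum_apply]
  refine Finset.sum_eq_zero fun k _ => ?_
  split_ifs with hk
  · rw [LinearMap.smulRight_apply, LinearMap.proj_apply, hf k hk, zero_smul]
  · rfl

open Classical in
lemma wallPart_single_wall (h : IsSymPolygon S K P) {k : Fin 2} (hk : k ∈ K) :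
    h.wallPart (Pi.single (h.wall hk) 1) = -(‖S.α k‖ • S.coweight k) := by
  rw [wallPart, LinearMap.sum_apply, Finset.sum_eq_single k]
  · rw [dif_pos hk, LinearMap.smulRight_apply, LinearMap.proj_apply, Pi.single_eq_same, one_smul]
  · intro l _ hlk
    split_ifs with hl
    · rw [LinearMap.smulRight_apply, LinearMap.proj_apply, Pi.single_apply,
        if_neg fun he => hlk (h.wall_injective _ _ he), zero_smul]
    · rfl
  · exact fun hk' => absurd (Finset.mem_univ k) hk'

/-- The extension to the facets of `P` of a function on the facets of `P ∩ C_K`, after it has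
been normalized to vanish on the walls. -/
def extend (h : IsSymPolygon S K P) : (Facets (P ∩ cham S.α K) → ℝ) →ₗ[ℝ] (Facets P → ℝ) where
  toFun f F := f (h.rep F) - ⟪h.wallPart f, normalVec (P ∩ cham S.α K) (h.rep F).1⟫
  map_add' f f' := by
    ext F
    simp only [Pi.add_apply, map_add, inner_add_left]
    ring
  map_smul' c f := by
    ext F
    simp only [Pi.smul_apply, map_smul, real_inner_smul_left, smul_eq_mul, RingHom.id_apply]
    ring

lemma extend_apply (h : IsSymPolygon S K P) (f : Facets (P ∩ cham S.α K) → ℝ) (F : Facets P) :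
    h.extend f F =
      f (h.rep F) - ⟪h.wallPart f, normalVec (P ∩ cham S.α K) (h.rep F).1⟫ := rfl

lemma extend_act (h : IsSymPolygon S K P) (f : Facets (P ∩ cham S.α K) → ℝ)
    (g : parabolic S.α K) (F : Facets P) : h.extend f (h.act g F) = h.extend f F := by
  rw [extend_apply, rep_act, extend_apply]

omit [FiniteDimensional ℝ V] in
lemma apply_eq_self_of_inner (S : RootSystemData V 2) {g : V ≃ₗᵢ[ℝ] V} {J : Set (Fin 2)}
    (hg : g ∈ parabolic S.α J) {u : V} (hu : ∀ k ∈ J, ⟪u, S.α k⟫ = 0) : g u = u :=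
  parabolic_induction (p := (· = u)) (fun k hk x hx => by
    rw [hx]; exact reflEquiv_of_inner_eq_zero (hu k hk)) hg rfl

omit [FiniteDimensional ℝ V] in
lemma inner_apply_of_inner (S : RootSystemData V 2) {g : V ≃ₗᵢ[ℝ] V} {J : Set (Fin 2)}
    (hg : g ∈ parabolic S.α J) {u : V} (hu : ∀ k ∈ J, ⟪u, S.α k⟫ = 0) (x : V) :
    ⟪u, g x⟫ = ⟪u, x⟫ := by
  conv_lhs => rw [← apply_eq_self_of_inner S hg hu]
  exact g.inner_map_map u x

lemma mkQ_extend_eq_zero_iff (h : IsSymPolygon S K P) (f : Facets (P ∩ cham S.α K) → ℝ) :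
    (linRel P).mkQ (h.extend f) = 0 ↔
      ∃ u : V, f = fun F' => ⟪u, normalVec (P ∩ cham S.α K) F'.1⟫ := by
  rw [Submodule.mkQ_apply, Submodule.Quotient.mk_eq_zero, mem_linRel]
  constructor
  · rintro ⟨u, hu⟩
    have hu0 : ∀ k ∈ K, ⟪u, S.α k⟫ = 0 := by
      intro k hk
      have hfix : reflEquiv (S.α k) u - u = 0 := by
        refine h.eq_zero_of_inner_normalVec fun F => ?_
        have h1 := congrFun hu (h.act (refl S hk) F)
        have h2 := congrFun hu F
        rw [extend_act, h2, normalVec_act] at h1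
        rw [inner_sub_left, h1]
        change ⟪reflEquiv (S.α k) u, _⟫ - ⟪u, reflEquiv (S.α k) _⟫ = 0
        rw [← (reflEquiv (S.α k)).inner_map_map u, ← Function.comp_apply (f := reflEquiv (S.α k))
          (g := reflEquiv (S.α k)), ← LinearIsometryEquiv.coe_mul, reflEquiv_mul_self]
        exact sub_self _
      have h3 := inner_reflEquiv_self (S.α k) u
      rw [sub_eq_zero.1 hfix] at h3
      linarith
    refine ⟨u + h.wallPart f, funext fun F' => ?_⟩
    rcases h.facet_cases F' with ⟨F, hF, rfl⟩ | ⟨k, hk, rfl⟩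
    · have h1 := congrFun hu F
      rw [extend_apply, h.rep_of_mem hF, h.normalVec_inFacet] at h1
      rw [h.normalVec_inFacet, inner_add_left]
      linarith
    · rw [inner_add_left, h.normalVec_wall, h.inner_wallPart f hk, inner_neg_right,
        inner_smul_right, hu0 k hk, mul_zero, neg_zero, zero_add]
  · rintro ⟨u, rfl⟩
    set w := h.wallPart fun F' => ⟪u, normalVec (P ∩ cham S.α K) F'.1⟫ with hw
    refine ⟨u - w, funext fun F => ?_⟩
    have hu0 : ∀ k ∈ K, ⟪u - w, S.α k⟫ = 0 := by
      intro k hk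
      have h1 := h.inner_wallPart (fun F' => ⟪u, normalVec (P ∩ cham S.α K) F'.1⟫) hk
      rw [← hw] at h1
      simp only [h.normalVec_wall, inner_neg_right, inner_smul_right, neg_inj] at h1
      rw [inner_sub_left, mul_left_cancel₀ (inv_ne_zero (norm_root_pos S k).ne') h1, sub_self]
    obtain ⟨g, hg⟩ := h.exists_normalVec_rep F
    rw [extend_apply, ← hw, ← inner_sub_left, hg, inner_apply_of_inner S g.2 hu0]

end IsSymPolygon

end Extension

section Invariants

variable [FiniteDimensional ℝ V] {S : RootSystemData V 2} {K : Set (Fin 2)} {P : Set V}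

namespace IsSymPolygon

/-- The action of `W_K` on the degree one part of the polytopal algebra. -/
def actQ (h : IsSymPolygon S K P) (g : parabolic S.α K) :
    ((Facets P → ℝ) ⧸ linRel P) →ₗ[ℝ] ((Facets P → ℝ) ⧸ linRel P) :=
  (linRel P).mapQ (linRel P) (LinearMap.funLeft ℝ ℝ (h.act g⁻¹)) fun f hf => by
    obtain ⟨u, rfl⟩ := mem_linRel.1 hf
    refine mem_linRel.2 ⟨g.1 u, funext fun F => ?_⟩
    rw [LinearMap.funLeft_apply, normalVec_act]
    change ⟪u, g.1.symm _⟫ = _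
    rw [← g.1.inner_map_map u, LinearIsometryEquiv.apply_symm_apply]

lemma actQ_mk (h : IsSymPolygon S K P) (g : parabolic S.α K) (f : Facets P → ℝ) :
    h.actQ g ((linRel P).mkQ f) = (linRel P).mkQ fun F => f (h.act g⁻¹ F) := rfl

lemma actQ_single (h : IsSymPolygon S K P) [DecidableEq (Facets P)] (g : parabolic S.α K)
    (F : Facets P) : h.actQ g ((linRel P).mkQ (Pi.single F 1)) =
      (linRel P).mkQ (Pi.single (h.act g F) 1) := by
  rw [actQ_mk]
  congr 1
  ext G
  rw [map_inv, Pi.single_apply, Pi.single_apply]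
  exact if_congr (Equiv.symm_apply_eq _) rfl rfl

lemma interForm_actQ (h : IsSymPolygon S K P) [Fintype (Facets P)] (g : parabolic S.α K)
    (x y : (Facets P → ℝ) ⧸ linRel P) :
    interForm h.toIsPolygon (h.actQ g x) (h.actQ g y) = interForm h.toIsPolygon x y := by
  obtain ⟨x, rfl⟩ := (linRel P).mkQ_surjective x
  obtain ⟨y, rfl⟩ := (linRel P).mkQ_surjective y
  rw [actQ_mk, actQ_mk, interForm_mk, interForm_mk, preForm_apply, preForm_apply,
    ← Equiv.sum_comp (h.act g⁻¹) fun F => x F * ∑ G, edgeWeight P F G * y G]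
  refine Finset.sum_congr rfl fun F _ => ?_
  rw [← Equiv.sum_comp (h.act g⁻¹) fun G => edgeWeight P (h.act g⁻¹ F) G * y G]
  refine congrArg _ (Finset.sum_congr rfl fun G _ => ?_)
  rw [show edgeWeight P (h.act g⁻¹ F) (h.act g⁻¹ G) = edgeWeight P F G from
    h.edgeWeight_facetHom h.image_eq g⁻¹ F G]

lemma exists_extend_eq (h : IsSymPolygon S K P) {f : Facets P → ℝ}
    (hf : ∀ g F, f (h.act g F) = f F) : ∃ f', h.extend f' = f := by
  classical
  let f' : Facets (P ∩ cham S.α K) → ℝ := fun F' =>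
    if hF : ∃ F, h.rep F = F' then f hF.choose else 0
  refine ⟨f', funext fun F => ?_⟩
  have hw : h.wallPart f' = 0 := h.wallPart_eq_zero fun k hk =>
    dif_neg fun ⟨F, hF⟩ => h.rep_ne_wall F hk hF
  have hex : ∃ G, h.rep G = h.rep F := ⟨F, rfl⟩
  rw [extend_apply, hw, inner_zero_left, sub_zero]
  refine (dif_pos hex).trans ?_
  obtain ⟨g, hg⟩ := h.exists_act_eq hex.choose_spec
  conv_rhs => rw [← hg, hf]

lemma mem_range_mkQ_extend_iff (h : IsSymPolygon S K P) (z : (Facets P → ℝ) ⧸ linRel P) :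
    z ∈ LinearMap.range ((linRel P).mkQ ∘ₗ h.extend) ↔ ∀ g, h.actQ g z = z := by
  constructor
  · rintro ⟨f, rfl⟩ g
    rw [LinearMap.comp_apply, actQ_mk]
    simp only [extend_act]
  · intro hz
    obtain ⟨f, rfl⟩ := (linRel P).mkQ_surjective z
    have := S.finite_parabolic K
    have := Fintype.ofFinite (parabolic S.α K)
    set N : ℝ := (Fintype.card (parabolic S.α K) : ℝ) with hN
    have hN0 : N ≠ 0 := Nat.cast_ne_zero.2 Fintype.card_ne_zero
    obtain ⟨f', hf'⟩ := h.exists_extend_eq (f := N⁻¹ • ∑ g : parabolic S.α K,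
      fun F => f (h.act g⁻¹ F)) fun g F => by
        simp only [Pi.smul_apply, Finset.sum_apply]
        congr 1
        rw [← Equiv.sum_comp (Equiv.mulLeft g)]
        refine Finset.sum_congr rfl fun g' _ => ?_
        rw [Equiv.coe_mulLeft, ← Equiv.Perm.mul_apply, ← map_mul, mul_inv_rev,
          inv_mul_cancel_right]
    refine ⟨f', ?_⟩
    rw [LinearMap.comp_apply, hf', map_smul, map_sum]
    simp only [← actQ_mk, hz]
    rw [Finset.sum_const, Finset.card_univ, ← Nat.cast_smul_eq_nsmul ℝ, ← hN, smul_smul,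
      inv_mul_cancel₀ hN0, one_smul]

open Classical in
lemma sum_edgeWeight_mul_extend (h : IsSymPolygon S K P) [Fintype (Facets P)] {F : Facets P}
    (hF : normalVec P F.1 ∈ cham S.α K) {G' : Facets (P ∩ cham S.α K)}
    (hG' : (h.inFacet hF).1 ∩ G'.1 = ∅) :
    ∑ G, edgeWeight P F G * h.extend (Pi.single G' 1) G = 0 := by
  have hempty : ∀ x, x ∈ F.1 → x ∈ cham S.α K → x ∉ G'.1 := fun x h1 h2 h3 =>
    (Set.mem_empty_iff_false x).1 (hG' ▸ ⟨⟨h1, h2⟩, h3⟩)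
  have hfold : ∀ G, edgeWeight P F G ≠ 0 → ∃ g ∈ parabolic S.α (adjWalls S K F.1),
      (g (normalVec P G.1) = normalVec P F.1) ∨
      (g (normalVec P G.1) ∈ cham S.α K ∧ (F.1 ∩ (g '' G.1) ∩ cham S.α K).Nonempty) := by
    intro G hG
    by_cases hFG : F = G
    · exact ⟨1, one_mem _, Or.inl (by rw [hFG]; rfl)⟩
    · exact h.exists_fold hF (not_not.1 fun hn => hG (edgeWeight_of_not_adj hFG hn))
  have hsub : adjWalls S K F.1 ⊆ K := fun l hl => hl.1
  have hrep : ∀ G, edgeWeight P F G ≠ 0 → ∃ g ∈ parabolic S.α (adjWalls S K F.1),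
      normalVec (P ∩ cham S.α K) (h.rep G).1 = g (normalVec P G.1) ∧
        (F.1 ∩ cham S.α K ∩ (h.rep G).1).Nonempty := by
    intro G hG
    obtain ⟨g, hg, hor⟩ := hfold G hG
    have hgK : g ∈ parabolic S.α K := parabolic_mono hsub hg
    have hmem : normalVec P (h.act ⟨g, hgK⟩ G).1 ∈ cham S.α K := by
      rw [normalVec_act]
      rcases hor with h1 | h1
      · rw [h1]; exact hF
      · exact h1.1
    refine ⟨g, hg, ?_, ?_⟩
    · rw [h.rep_eq hmem, normalVec_inFacet, normalVec_act]
    · rw [h.rep_eq hmem]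
      rcases hor with h1 | ⟨-, x, ⟨hxF, hxG⟩, hx⟩
      · have hFa : h.act ⟨g, hgK⟩ G = F := h.facet_ext (by rw [normalVec_act, h1])
        obtain ⟨x, hx⟩ := (h.inter_cham_nontrivial hF).nonempty
        exact ⟨x, hx, by rw [hFa]; exact hx.1, hx.2⟩
      · exact ⟨x, ⟨hxF, hx⟩, hxG, hx⟩
  have hne : ∀ G, edgeWeight P F G ≠ 0 → h.rep G ≠ G' := by
    rintro G hG rfl
    obtain ⟨-, -, -, x, hx, hxG⟩ := hrep G hG
    exact hempty x hx.1 hx.2 hxG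
  have hterm : ∀ G, edgeWeight P F G * h.extend (Pi.single G' 1) G = -(edgeWeight P F G *
      ⟪h.wallPart (Pi.single G' 1), normalVec P G.1⟫) := by
    intro G
    by_cases hG : edgeWeight P F G = 0
    · rw [hG, zero_mul, zero_mul, neg_zero]
    rw [extend_apply, Pi.single_apply, if_neg (hne G hG), zero_sub, mul_neg]
    obtain ⟨g, hg, hgn, -⟩ := hrep G hG
    rw [hgn, inner_apply_of_inner S hg]
    intro l hl
    rcases h.facet_cases G' with ⟨F', hF', rfl⟩ | ⟨k, hk, rfl⟩
    · rw [h.wallPart_eq_zero, inner_zero_left]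
      intro k hk
      rw [Pi.single_apply, if_neg (h.inFacet_ne_wall hF' hk).symm]
    · have hlk : l ≠ k := by
        rintro rfl
        obtain ⟨-, x, hx, hx0⟩ := hl
        exact hempty x hx.1 hx.2 ⟨⟨(h.mem_facet_iff.1 hx.1).1, hx.2⟩, hx0⟩
      rw [h.wallPart_single_wall hk, inner_neg_left, real_inner_smul_left, S.inner_coweight,
        Pi.single_apply, if_neg hlk, mul_zero, neg_zero]
  rw [Finset.sum_congr rfl fun G _ => hterm G, Finset.sum_neg_distrib]
  simp only [h.sum_edgeWeight_mul_inner, neg_zero]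

open Classical in
lemma preForm_extend_inFacet (h : IsSymPolygon S K P) [Fintype (Facets P)] {F : Facets P}
    (hF : normalVec P F.1 ∈ cham S.α K) {G' : Facets (P ∩ cham S.α K)}
    (hG' : (h.inFacet hF).1 ∩ G'.1 = ∅) :
    preForm P (h.extend (Pi.single (h.inFacet hF) 1)) (h.extend (Pi.single G' 1)) = 0 := by
  rw [preForm_apply]
  refine Finset.sum_eq_zero fun G _ => ?_
  rw [extend_apply, h.wallPart_eq_zero fun k hk => by
    rw [Pi.single_apply, if_neg (h.inFacet_ne_wall hF hk).symm], inner_zero_left, sub_zero,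
    Pi.single_apply]
  split_ifs with hG
  · obtain ⟨g, rfl⟩ := h.exists_act_eq (F := F) (G := G) (by rw [h.rep_of_mem hF, hG])
    rw [one_mul, ← Equiv.sum_comp (h.act g)]
    have he : ∀ G, edgeWeight P (h.act g F) (h.act g G) = edgeWeight P F G :=
      h.edgeWeight_facetHom h.image_eq g F
    simp only [he, extend_act]
    exact h.sum_edgeWeight_mul_extend hF hG'
  · rw [zero_mul]

open Classical in
lemma preForm_extend (h : IsSymPolygon S K P) [Fintype (Facets P)]
    {F' G' : Facets (P ∩ cham S.α K)} (hFG : F'.1 ∩ G'.1 = ∅) :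
    preForm P (h.extend (Pi.single F' 1)) (h.extend (Pi.single G' 1)) = 0 := by
  rcases h.facet_cases F' with ⟨F, hF, rfl⟩ | ⟨k, hk, rfl⟩
  · exact h.preForm_extend_inFacet hF hFG
  rcases h.facet_cases G' with ⟨G, hG, rfl⟩ | ⟨l, hl, rfl⟩
  · rw [preForm_comm]
    exact h.preForm_extend_inFacet hG (by rwa [Set.inter_comm])
  · have h0 : ∀ j, (0 : V) ∈ P ∩ cham S.α K ∩ hplane (S.α j) := fun j =>
      ⟨⟨interior_subset h.zero_mem, fun i _ => by rw [inner_zero_left]⟩, inner_zero_left _⟩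
    exact absurd (hFG ▸ ⟨h0 k, h0 l⟩ : (0 : V) ∈ (∅ : Set V)) (Set.notMem_empty _)

end IsSymPolygon

end Invariants

section Main

variable [FiniteDimensional ℝ V] {S : RootSystemData V 2} {K : Set (Fin 2)} {P : Set V}

lemma IsPolygon.exists_equiv_quadAlg {Q : Set V} (hQ : IsPolygon Q) [Fintype (Facets Q)]
    [DecidableEq (Facets Q)] :
    ∃ Θ : PolyAlg Q →ₐ[ℝ] QuadAlg (interForm hQ),
      (∀ F, Θ (polyVar Q F) = QuadAlg.inMid _ ((linRel Q).mkQ (Pi.single F 1))) ∧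
      Function.Bijective Θ := by
  obtain ⟨Θ, hΘ, hinj, hrange⟩ := hQ.exists_embedding (b := interForm hQ) (φ := (linRel Q).mkQ)
    (fun f => by rw [Submodule.mkQ_apply, Submodule.Quotient.mk_eq_zero, mem_linRel])
    (fun F G hne hFG => by
      have hadj : ¬ FacetAdj Q F G := fun hc => hc.2.ne_empty hFG
      simp only [interForm_mk]
      rw [preForm_comm (Pi.single G 1), ← two_mul, preForm_apply]
      simp [Pi.single_apply, edgeWeight_of_not_adj hne hadj])
    ⟨1, 1, by
      simp only [interForm_mk]
      rw [← two_mul, preForm_apply]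
      simpa using hQ.sum_edgeWeight_pos.ne'⟩
  refine ⟨Θ, hΘ, hinj, fun z => (hrange z).2 ?_⟩
  rw [Submodule.range_mkQ]
  trivial

namespace IsSymPolygon

lemma exists_embedding_inter (h : IsSymPolygon S K P) [Fintype (Facets P)] :
    ∃ Θ : PolyAlg (P ∩ cham S.α K) →ₐ[ℝ] QuadAlg (interForm h.toIsPolygon),
      Function.Injective Θ ∧ ∀ z, z ∈ Θ.range ↔ ∀ g, h.actQ g z.mid = z.mid := by
  classical
  have := h.isPolygon_inter.finite_facets
  have := Fintype.ofFinite (Facets (P ∩ cham S.α K))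
  obtain ⟨f, hf⟩ := h.exists_extend_eq (f := fun _ => (1 : ℝ)) fun _ _ => rfl
  obtain ⟨Θ, -, hinj, hrange⟩ := h.isPolygon_inter.exists_embedding
    (b := interForm h.toIsPolygon) (φ := (linRel P).mkQ ∘ₗ h.extend) h.mkQ_extend_eq_zero_iff
    (fun F G _ hFG => by
      have h1 := h.preForm_extend hFG
      have h2 := h.preForm_extend ((Set.inter_comm _ _).trans hFG)
      simp only [LinearMap.comp_apply, interForm_mk]
      convert add_zero (0 : ℝ) using 2)
    ⟨f, f, by
      simp only [LinearMap.comp_apply, interForm_mk, hf]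
      rw [← two_mul, preForm_apply]
      simpa using h.sum_edgeWeight_pos.ne'⟩
  exact ⟨Θ, hinj, fun z => (hrange z).trans (h.mem_range_mkQ_extend_iff _)⟩

lemma exists_algHom (h : IsSymPolygon S K P) :
    ∃ Ψ : PolyAlg (P ∩ cham S.α K) →ₐ[ℝ] PolyAlg P, Function.Injective Ψ ∧
      ∀ z, z ∈ Ψ.range ↔ ∀ g, h.polyAlgHom h.image_eq g z = z := by
  classical
  have := h.finite_facets
  have := Fintype.ofFinite (Facets P)
  obtain ⟨Θ, hΘ, hbij⟩ := h.toIsPolygon.exists_equiv_quadAlg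
  obtain ⟨Θ', hinj, hrange⟩ := h.exists_embedding_inter
  have hequiv : ∀ g z, Θ (h.polyAlgHom h.image_eq g z) =
      QuadAlg.mapMid (h.actQ g) (h.interForm_actQ g) (Θ z) := fun g => by
    refine DFunLike.congr_fun (f := Θ.comp (h.polyAlgHom h.image_eq g).toAlgHom)
      (g := (QuadAlg.mapMid (h.actQ g) (h.interForm_actQ g)).comp Θ)
      (PolyAlg.algHom_ext fun F => ?_)
    change Θ (h.polyAlgHom h.image_eq g (polyVar P F)) = QuadAlg.mapMid (h.actQ g) (h.interForm_actQ g)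
      (Θ (polyVar P F))
    rw [IsPolygon.polyAlgHom_polyVar, hΘ, hΘ, QuadAlg.mapMid_apply, QuadAlg.mid_inMid, actQ_single]
    rfl
  let e := AlgEquiv.ofBijective Θ hbij
  refine ⟨e.symm.toAlgHom.comp Θ', e.symm.injective.comp hinj, fun z => ?_⟩
  trans Θ z ∈ Θ'.range
  · refine exists_congr fun x => ?_
    change e.symm (Θ' x) = z ↔ Θ' x = e z
    exact e.symm_apply_eq
  · rw [hrange]
    refine forall_congr' fun g => ?_
    rw [← hbij.1.eq_iff (b := z), hequiv, QuadAlg.mapMid_apply, QuadAlg.ext_iff]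
    simp

end IsSymPolygon

omit [FiniteDimensional ℝ V] in
lemma exists_WK_hom {n : ℕ} (α : Fin n → V) (K : Set (Fin n)) :
    ∃ f : WK α K →* parabolic α K, (∀ s, ⇑(f s).1 = s.1) ∧ Function.Surjective f := by
  choose f hf hfs using fun s : WK α K => mem_WK_iff.1 s.2
  refine ⟨MonoidHom.mk' (fun s => ⟨f s, hf s⟩) fun s t =>
    Subtype.ext (DFunLike.coe_injective ?_), hfs, fun g => ?_⟩
  · change ⇑(f (s * t)) = ⇑(f s) ∘ ⇑(f t)
    rw [hfs, hfs, hfs]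
    rfl
  · exact ⟨⟨⇑g.1, mem_WK_iff.2 ⟨g.1, g.2, rfl⟩⟩, Subtype.ext (DFunLike.coe_injective (hfs _))⟩

end Main

/-- Theorem 6.1: for a (possibly degenerate) `W`-symmetric polygon `P` (`n = 2`) and a
parabolic subgroup `W_K`, (i) `W_K` acts on `𝒜(P)` by `ℝ`-algebra automorphisms
induced by `X_F ↦ X_{s(F)}`, and (ii) `P ∩ C_K` is a full-dimensional polygon and
`𝒜(P ∩ C_K) ≅ 𝒜(P)^{W_K}` as `ℝ`-algebras. -/
theorem statement_1 {V : Type*} [NormedAddCommGroup V] [InnerProductSpace ℝ V]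
    [FiniteDimensional ℝ V] (S : PermSetup V 2)
    (hfull : (interior S.P).Nonempty) (K : Set (Fin 2)) :
    -- (i)
    (∀ s ∈ WK S.α K,
      (∀ F : Set V, IsFacet S.P F → IsFacet S.P (Set.image s F) ∧
        s (normalVec S.P F) = normalVec S.P (Set.image s F)) ∧
      ∃ σ : MvPolynomial (Facets S.P) ℝ ≃ₐ[ℝ] MvPolynomial (Facets S.P) ℝ,
        (∀ F : Facets S.P, ∃ hF : IsFacet S.P (Set.image s F.1),
          σ (MvPolynomial.X F) = MvPolynomial.X ⟨Set.image s F.1, hF⟩) ∧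
        Ideal.map (σ : MvPolynomial (Facets S.P) ℝ →+* MvPolynomial (Facets S.P) ℝ)
          (polyIdeal S.P) = polyIdeal S.P) ∧
    -- (ii)
    ((∃ B : Set V, B.Finite ∧ S.P ∩ cham S.α K = convexHull ℝ B) ∧
     (interior (S.P ∩ cham S.α K)).Nonempty ∧
     ∃ ρ : ↥(WK S.α K) →* (PolyAlg S.P ≃ₐ[ℝ] PolyAlg S.P),
       (∀ (s : ↥(WK S.α K)) (F : Facets S.P)
          (hF : IsFacet S.P (Set.image (s : Function.End V) F.1)),
          ρ s (polyMk S.P (MvPolynomial.X F)) =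
            polyMk S.P (MvPolynomial.X ⟨Set.image (s : Function.End V) F.1, hF⟩)) ∧
       Nonempty ((PolyAlg (S.P ∩ cham S.α K)) ≃ₐ[ℝ] ↥(invariants ρ))) := by
  have h : IsSymPolygon S.toRootSystemData K S.P :=
    ⟨S.isPolygon hfull,
      S.zero_mem_interior (convex_convexHull ℝ _) (fun _ hg => S.image_P hg) hfull,
      fun _ hg => S.image_P (parabolic_mono (Set.subset_univ K) hg)⟩
  refine ⟨fun s hs => ?_, h.isPolygon_inter.exists_convexHull_eq,
    h.isPolygon_inter.interior_nonempty, ?_⟩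
  · obtain ⟨g, hg, rfl⟩ := mem_WK_iff.1 hs
    refine ⟨fun F hF => ⟨h.isFacet_image (h.image_eq g hg) hF,
        (h.normalVec_image (h.image_eq g hg) hF).symm⟩,
      MvPolynomial.renameEquiv ℝ (h.facetHom _ h.image_eq ⟨g, hg⟩),
      fun F => ⟨h.isFacet_image (h.image_eq g hg) F.2, MvPolynomial.rename_X _ _⟩,
      h.map_polyIdeal h.image_eq ⟨g, hg⟩⟩
  · obtain ⟨f, hf, hfs⟩ := exists_WK_hom S.α K
    obtain ⟨Ψ, hinj, hrange⟩ := h.exists_algHom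
    refine ⟨(h.polyAlgHom h.image_eq).comp f, fun s F hF => ?_,
      ⟨(AlgEquiv.ofInjective Ψ hinj).trans (Subalgebra.equivOfEq _ _ (SetLike.ext fun z => ?_))⟩⟩
    · refine (h.polyAlgHom_polyVar h.image_eq (f s) F).trans (congrArg (polyVar S.P) ?_)
      exact Subtype.ext (congrArg (· '' F.1) (hf s))
    · exact (hrange z).trans hfs.forall
end
end

section
/- Lemma (Lemma 2.2, equivalence of conditions (1), (2), (3)). Let P = conv(A) for a nonempty finite set A ⊆ V, let α ∈ V be nonzero with r_α(P) = P, let F be a nonempty exposed face of P, and let b be the barycenter of F (the centroid of the finitely many extreme points of F). Then the following are equivalent: (1) r_α(F) = F; (2) ⟨b, α⟩ = 0; (3) there exists a point x in the relative (intrinsic) interior of F with ⟨x, α⟩ = 0. -/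
open scoped RealInnerProductSpace

noncomputable section

variable {V : Type*} [NormedAddCommGroup V] [InnerProductSpace ℝ V]

theorem coe_reflection_orthogonal_eq_reflMap (α : V) :
    ⇑(ℝ ∙ α)ᗮ.reflection = reflMap α := by
  funext x
  rw [Submodule.reflection_orthogonal_apply, Submodule.reflection_singleton_apply, reflMap,
    real_inner_self_eq_norm_sq, real_inner_comm]
  simp only [neg_sub, RCLike.ofReal_real_eq_id, id_eq]
  rw [← Nat.cast_smul_eq_nsmul ℝ, smul_smul, Nat.cast_ofNat, mul_div_assoc]

theorem reflMap_reflMap (α x : V) : reflMap α (reflMap α x) = x := by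
  rw [← coe_reflection_orthogonal_eq_reflMap, Submodule.reflection_reflection]

theorem inner_reflMap_left {α : V} (hα : α ≠ 0) (x : V) : ⟪reflMap α x, α⟫ = -⟪x, α⟫ := by
  have : ⟪α, α⟫ ≠ 0 := inner_self_ne_zero.2 hα
  rw [reflMap, inner_sub_left, real_inner_smul_left]
  field_simp
  ring

theorem reflMap_eq_self_of_inner_eq_zero {α x : V} (hx : ⟪x, α⟫ = 0) : reflMap α x = x := by
  simp [reflMap, hx]

theorem reflMap_image_eq_of_mapsTo {α : V} {F : Set V} (h : Set.MapsTo (reflMap α) F F) :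
    reflMap α '' F = F :=
  h.image_subset.antisymm fun x hx => ⟨_, h hx, reflMap_reflMap α x⟩

theorem Convex.midpoint_mem_intrinsicInterior {s : Set V} (hs : Convex ℝ s) {x y : V}
    (hx : x ∈ intrinsicInterior ℝ s) (hy : y ∈ s) :
    midpoint ℝ y x ∈ intrinsicInterior ℝ s := by
  have : Nonempty s := ⟨y, hy⟩
  obtain ⟨x, hx, rfl⟩ := hx
  let y' : affineSpan ℝ s := ⟨y, subset_affineSpan ℝ s hy⟩
  refine ⟨AffineMap.homothety y' (1 / 2 : ℝ) x, ?_, ?_⟩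
  · refine interior_maximal ?_
      (AffineMap.homothety_isOpenMap y' (1 / 2 : ℝ) (by norm_num) _ isOpen_interior) ⟨x, hx, rfl⟩
    rintro _ ⟨z, hz, rfl⟩
    replace hz := interior_subset hz
    rw [Set.mem_preimage] at hz
    have h := hs.lineMap_mem hy hz (t := 1 / 2) (by norm_num)
    simpa [AffineMap.homothety_apply, AffineMap.lineMap_apply, y'] using h
  · simp [AffineMap.homothety_apply, midpoint, AffineMap.lineMap_apply, y']

theorem exists_mem_openSegment_of_mem_intrinsicInterior {s : Set V} {x y : V}
    (hx : x ∈ intrinsicInterior ℝ s) (hy : y ∈ s) : ∃ z ∈ s, x ∈ openSegment ℝ y z := by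
  have : Nonempty s := ⟨y, hy⟩
  obtain ⟨x, hx, rfl⟩ := hx
  let y' : affineSpan ℝ s := ⟨y, subset_affineSpan ℝ s hy⟩
  have h := eventually_homothety_mem_of_mem_interior ℝ y' hx
  obtain ⟨t, ht, ht1⟩ := ((h.filter_mono nhdsWithin_le_nhds).and
    (self_mem_nhdsWithin (s := Set.Ioi (1 : ℝ)))).exists
  have ht1 : 1 < t := ht1
  refine ⟨_, ht, 1 - t⁻¹, t⁻¹, by simpa using inv_lt_one_of_one_lt₀ ht1, by positivity, by ring, ?_⟩
  have ht0 : t ≠ 0 := by positivity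
  simp only [AffineMap.homothety_apply, AffineSubspace.coe_vadd, Submodule.coe_smul,
    AffineSubspace.coe_vsub, vsub_eq_sub, vadd_eq_add, y', smul_add, smul_smul,
    inv_mul_cancel₀ ht0, one_smul, sub_smul]
  abel

theorem IsExposed.finite_extremePoints {A F : Set V} (hA : A.Finite)
    (hF : IsExposed ℝ (convexHull ℝ A) F) : (Set.extremePoints ℝ F).Finite :=
  hA.subset (hF.isExtreme.extremePoints_subset_extremePoints.trans extremePoints_convexHull_subset)

theorem IsExposed.convexHull_extremePoints {A F : Set V} (hA : A.Finite)
    (hF : IsExposed ℝ (convexHull ℝ A) F) : convexHull ℝ (Set.extremePoints ℝ F) = F := by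
  rw [← ((hF.finite_extremePoints hA).isClosed_convexHull ℝ).closure_eq]
  exact closure_convexHull_extremePoints (hF.isCompact (hA.isCompact_convexHull ℝ))
    (hF.convex (convex_convexHull ℝ A))

theorem barycenter_eq_smul_sum {F : Set V} (h : (Set.extremePoints ℝ F).Finite)
    (hne : (Set.extremePoints ℝ F).Nonempty) :
    barycenter F = (h.toFinset.card : ℝ)⁻¹ • ∑ e ∈ h.toFinset, e := by
  rw [barycenter, dif_pos h, Finset.centroid_def, Finset.affineCombination_eq_linear_combination _ _ _
    (Finset.sum_centroidWeights_eq_one_of_nonempty ℝ _ (h.toFinset_nonempty.2 hne)),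
    Finset.smul_sum]
  simp [Finset.centroidWeights_apply]

theorem inner_barycenter_eq_zero_iff {F : Set V} (h : (Set.extremePoints ℝ F).Finite)
    (hne : (Set.extremePoints ℝ F).Nonempty) (α : V) :
    ⟪barycenter F, α⟫ = 0 ↔ ∑ e ∈ h.toFinset, ⟪e, α⟫ = 0 := by
  have : (h.toFinset.card : ℝ) ≠ 0 := by
    simpa [Finset.card_eq_zero] using hne.ne_empty
  rw [barycenter_eq_smul_sum h hne, real_inner_smul_left, sum_inner]
  simp [this, -Set.Finite.toFinset_eq_empty, -Finset.card_eq_zero]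

theorem inner_barycenter_eq_zero_of_reflMap_image_eq {α : V} (hα : α ≠ 0) {F : Set V}
    (h : (Set.extremePoints ℝ F).Finite) (hne : (Set.extremePoints ℝ F).Nonempty)
    (hr : reflMap α '' F = F) : ⟪barycenter F, α⟫ = 0 := by
  rw [inner_barycenter_eq_zero_iff h hne]
  have hE : reflMap α '' Set.extremePoints ℝ F = Set.extremePoints ℝ F := by
    rw [← coe_reflection_orthogonal_eq_reflMap] at hr ⊢
    rw [image_extremePoints, hr]
  have hmem : ∀ e ∈ h.toFinset, reflMap α e ∈ h.toFinset := fun e he => by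
    rw [h.mem_toFinset] at he ⊢
    exact hE.subset ⟨e, he, rfl⟩
  have hsum : ∑ e ∈ h.toFinset, ⟪e, α⟫ = ∑ e ∈ h.toFinset, -⟪e, α⟫ :=
    Finset.sum_nbij' (reflMap α) (reflMap α) hmem hmem (fun e _ => reflMap_reflMap α e)
      (fun e _ => reflMap_reflMap α e) (fun e _ => by rw [inner_reflMap_left hα, neg_neg])
  rw [Finset.sum_neg_distrib] at hsum
  linarith

theorem IsExposed.reflMap_image_eq_of_sum_inner_eq_zero {α : V} {P F : Set V}
    (hsym : reflMap α '' P = P) (hF : IsExposed ℝ P F) {s : Finset V} (hne : s.Nonempty)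
    (hs : convexHull ℝ (s : Set V) = F) (h0 : ∑ e ∈ s, ⟪e, α⟫ = 0) :
    reflMap α '' F = F := by
  have hsF : ∀ e ∈ s, e ∈ F := fun e he => hs ▸ subset_convexHull ℝ _ he
  have hconv : Convex ℝ F := hs ▸ convex_convexHull ℝ _
  have hmem : ∀ e ∈ s, reflMap α e ∈ P := fun e he => hsym.subset ⟨e, hF.subset (hsF e he), rfl⟩
  obtain ⟨l, hl⟩ := hF (hne.imp hsF)
  have hle : ∀ e ∈ s, l (reflMap α e) ≤ l e := fun e he =>
    ((hl.subset (hsF e he)).2) _ (hmem e he)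
  have hsum : ∑ e ∈ s, l (reflMap α e) = ∑ e ∈ s, l e := by
    simp only [reflMap, map_sub, map_smul, smul_eq_mul]
    rw [Finset.sum_sub_distrib, ← Finset.sum_mul, ← Finset.sum_div, ← Finset.mul_sum, h0]
    simp
  have heq := (Finset.sum_eq_sum_iff_of_le hle).1 hsum
  have hE : ∀ e ∈ s, reflMap α e ∈ F := fun e he => hl.superset
    ⟨hmem e he, fun y hy => ((hl.subset (hsF e he)).2 y hy).trans (heq e he).ge⟩
  apply reflMap_image_eq_of_mapsTo
  have hsub : convexHull ℝ (s : Set V) ⊆ reflMap α ⁻¹' F := by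
    refine convexHull_min hE ?_
    rw [← coe_reflection_orthogonal_eq_reflMap]
    exact hconv.linear_preimage ((ℝ ∙ α)ᗮ.reflection : V ≃ₗ[ℝ] V).toLinearMap
  rwa [hs] at hsub

theorem IsExposed.reflMap_image_eq_of_mem_intrinsicInterior {α : V} {P F : Set V}
    (hsym : reflMap α '' P = P) (hF : IsExposed ℝ P F) {x : V}
    (hx : x ∈ intrinsicInterior ℝ F) (h0 : ⟪x, α⟫ = 0) : reflMap α '' F = F := by
  apply reflMap_image_eq_of_mapsTo
  intro y hy
  obtain ⟨z, hz, hxyz⟩ := exists_mem_openSegment_of_mem_intrinsicInterior hx hy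
  have hmem : ∀ w ∈ F, reflMap α w ∈ P := fun w hw => hsym.subset ⟨w, hF.subset hw, rfl⟩
  refine hF.isExtreme.left_mem_of_mem_openSegment (hmem y hy) (hmem z hz)
    (intrinsicInterior_subset hx) ?_
  have h := Set.mem_image_of_mem (reflMap α) hxyz
  rw [reflMap_eq_self_of_inner_eq_zero h0, ← coe_reflection_orthogonal_eq_reflMap] at h
  rw [← coe_reflection_orthogonal_eq_reflMap]
  exact (image_openSegment ℝ ((ℝ ∙ α)ᗮ.reflection : V ≃ₗ[ℝ] V).toLinearMap.toAffineMap y z).subset h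

theorem Convex.exists_mem_intrinsicInterior_inner_eq_zero [FiniteDimensional ℝ V] {α : V}
    (hα : α ≠ 0) {F : Set V} (hF : Convex ℝ F) (hne : F.Nonempty) (hr : reflMap α '' F = F) :
    ∃ x ∈ intrinsicInterior ℝ F, ⟪x, α⟫ = 0 := by
  obtain ⟨x, hx⟩ := hne.intrinsicInterior hF
  refine ⟨_, hF.midpoint_mem_intrinsicInterior hx
    (hr.subset ⟨x, intrinsicInterior_subset hx, rfl⟩), ?_⟩
  rw [midpoint_eq_smul_add, real_inner_smul_left, inner_add_left, inner_reflMap_left hα]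
  simp

/-- Lemma 2.2, equivalence of (1), (2), (3): for a polytope `P = conv A` invariant
under the reflection `r_α` and a nonempty exposed face `F` with barycenter `b`,
the following are equivalent: (1) `r_α(F) = F`; (2) `⟪b, α⟫ = 0`; (3) some point
of the relative (intrinsic) interior of `F` lies on `H_α`. -/
theorem statement_3 {V : Type*} [NormedAddCommGroup V] [InnerProductSpace ℝ V]
    [FiniteDimensional ℝ V] (hn : 1 ≤ Module.finrank ℝ V)
    (A : Set V) (hA : A.Finite) (hAne : A.Nonempty)
    (α : V) (hα : α ≠ 0)
    (P : Set V) (hP : P = convexHull ℝ A) (hsym : reflMap α '' P = P)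
    (F : Set V) (hF : IsExposed ℝ P F) (hFne : F.Nonempty) :
    List.TFAE [reflMap α '' F = F,
      ⟪barycenter F, α⟫ = 0,
      ∃ x ∈ intrinsicInterior ℝ F, ⟪x, α⟫ = 0] := by
  subst hP
  have hfin := hF.finite_extremePoints hA
  have hhull := hF.convexHull_extremePoints hA
  have hne : (Set.extremePoints ℝ F).Nonempty := by
    rwa [← hhull, convexHull_nonempty_iff] at hFne
  tfae_have 1 → 2 := inner_barycenter_eq_zero_of_reflMap_image_eq hα hfin hne
  tfae_have 2 → 1 := fun h => hF.reflMap_image_eq_of_sum_inner_eq_zero hsym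
    (hfin.toFinset_nonempty.2 hne) (by rwa [hfin.coe_toFinset])
    ((inner_barycenter_eq_zero_iff hfin hne α).1 h)
  tfae_have 1 → 3 := (hF.convex (convex_convexHull ℝ A)).exists_mem_intrinsicInterior_inner_eq_zero
    hα hFne
  tfae_have 3 → 1 := fun ⟨x, hx, h0⟩ =>
    hF.reflMap_image_eq_of_mem_intrinsicInterior hsym hx h0
  tfae_finish
end
end

section
/- Lemma (Lemma 2.2, condition (4) in the nondegenerate case). Let P = conv(A) for a nonempty finite set A ⊆ V, and let α ∈ V be nonzero with r_α(P) = P. Assume that no extreme point x of P satisfies ⟨x, α⟩ = 0. If F is an exposed face of P with F ∩ H_α ≠ ∅, then r_α(F) = F. -/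
open scoped RealInnerProductSpace

noncomputable section

variable {V : Type*} [NormedAddCommGroup V] [InnerProductSpace ℝ V]

/-- If a compact exposed face `F` of `P` contains a point on `H_α` but no extreme point of `P`
lies on `H_α`, then `F` contains a point strictly on the positive side of `H_α`. -/
theorem exists_inner_pos_of_isExposed {V : Type*} [NormedAddCommGroup V]
    [InnerProductSpace ℝ V] {P F : Set V} {α : V} (hP : IsCompact P)
    (hnd : ∀ x ∈ Set.extremePoints ℝ P, ⟪x, α⟫ ≠ 0) (hF : IsExposed ℝ P F)
    (hmeet : (F ∩ hplane α).Nonempty) : ∃ y ∈ F, 0 < ⟪y, α⟫ := by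
  by_contra! hneg
  obtain ⟨x, hxF, hx⟩ := hmeet
  have hx : ⟪x, α⟫ = 0 := hx
  have hG : IsExposed ℝ F ((innerSL ℝ α).toExposed F) :=
    ContinuousLinearMap.toExposed.isExposed
  have hxG : x ∈ (innerSL ℝ α).toExposed F := by
    refine ⟨hxF, fun y hy => ?_⟩
    rw [innerSL_apply_apply, innerSL_apply_apply, real_inner_comm, real_inner_comm x α, hx]
    exact hneg y hy
  have hFc : IsCompact F := hF.isCompact hP
  obtain ⟨e, he⟩ := (hG.isCompact hFc).extremePoints_nonempty ⟨x, hxG⟩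
  have heP : e ∈ Set.extremePoints ℝ P :=
    (hF.isExtreme.trans hG.isExtreme).extremePoints_subset_extremePoints he
  refine hnd e heP (le_antisymm (hneg e he.1.1) ?_)
  have h := he.1.2 x hxF
  rwa [innerSL_apply_apply, innerSL_apply_apply, real_inner_comm, real_inner_comm e α, hx] at h

theorem reflMap_involutive {V : Type*} [NormedAddCommGroup V] [InnerProductSpace ℝ V] {α : V}
    (hα : α ≠ 0) : Function.Involutive (reflMap α) := by
  intro x
  have h : ⟪α, α⟫ ≠ 0 := inner_self_ne_zero.mpr hα
  simp only [reflMap, inner_sub_left, real_inner_smul_left]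
  rw [sub_sub, ← add_smul]
  have hc : 2 * ⟪x, α⟫ / ⟪α, α⟫ +
      2 * (⟪x, α⟫ - 2 * ⟪x, α⟫ / ⟪α, α⟫ * ⟪α, α⟫) / ⟪α, α⟫ = 0 := by
    field_simp
    ring
  rw [hc, zero_smul, sub_zero]

/-- Lemma 2.2, condition (4) in the nondegenerate case: if no extreme point of the
`r_α`-invariant polytope `P = conv A` lies on `H_α`, then any exposed face `F` of `P`
meeting `H_α` satisfies `r_α(F) = F`. -/
theorem statement_4 {V : Type*} [NormedAddCommGroup V] [InnerProductSpace ℝ V]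
    [FiniteDimensional ℝ V] (hn : 1 ≤ Module.finrank ℝ V)
    (A : Set V) (hA : A.Finite) (hAne : A.Nonempty)
    (α : V) (hα : α ≠ 0)
    (P : Set V) (hP : P = convexHull ℝ A) (hsym : reflMap α '' P = P)
    (hnd : ∀ x ∈ Set.extremePoints ℝ P, ⟪x, α⟫ ≠ 0)
    (F : Set V) (hF : IsExposed ℝ P F) (hmeet : (F ∩ hplane α).Nonempty) :
    reflMap α '' F = F := by
  obtain ⟨l, rfl⟩ := hF (hmeet.mono Set.inter_subset_left)
  have hPc : IsCompact P := hP ▸ hA.isCompact_convexHull ℝ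
  have hpos : 0 < ⟪α, α⟫ := real_inner_self_pos.mpr hα
  have hmem : ∀ x ∈ P, reflMap α x ∈ P := fun x hx => hsym ▸ Set.mem_image_of_mem _ hx
  obtain ⟨y, hy, hyα⟩ := exists_inner_pos_of_isExposed hPc hnd hF hmeet
  obtain ⟨z, hz, hzα⟩ := exists_inner_pos_of_isExposed (α := -α) hPc
    (by simpa only [inner_neg_right, ne_eq, neg_eq_zero] using hnd) hF
    (by simpa only [hplane, inner_neg_right, neg_eq_zero] using hmeet)
  rw [inner_neg_right] at hzα
  have hl : ∀ x, l (reflMap α x) = l x - 2 * ⟪x, α⟫ / ⟪α, α⟫ * l α := fun x => by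
    simp [reflMap]
  have hlα : l α = 0 := by
    have h₁ := hy.2 _ (hmem y hy.1)
    have h₂ := hz.2 _ (hmem z hz.1)
    rw [hl] at h₁ h₂
    have c₁ : 0 < 2 * ⟪y, α⟫ / ⟪α, α⟫ := by positivity
    have c₂ : 2 * ⟪z, α⟫ / ⟪α, α⟫ < 0 := div_neg_of_neg_of_pos (by linarith) hpos
    refine le_antisymm ?_ ?_ <;> nlinarith
  have hlr : ∀ x, l (reflMap α x) = l x := fun x => by rw [hl, hlα, mul_zero, sub_zero]
  have hsub : Set.MapsTo (reflMap α) {x ∈ P | ∀ y ∈ P, l y ≤ l x}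
      {x ∈ P | ∀ y ∈ P, l y ≤ l x} :=
    fun x hx => ⟨hmem x hx.1, fun w hw => (hlr x).symm ▸ hx.2 w hw⟩
  exact Set.Subset.antisymm hsub.image_subset
    fun x hx => ⟨reflMap α x, hsub hx, reflMap_involutive hα x⟩
end
end

section
/- Lemma (Lemma 2.2, orthogonality of facet normals). Let P ⊆ V be a full-dimensional polytope and let α ∈ V be nonzero with r_α(P) = P. Let F' be a facet of P with r_α(F') = F', and let u ∈ V be any nonzero vector exposing F', i.e. F' = {x ∈ P : ⟨u, x⟩ = max_{y ∈ P} ⟨u, y⟩}. Then ⟨u, α⟩ = 0. -/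
open scoped RealInnerProductSpace

noncomputable section

variable {V : Type*} [NormedAddCommGroup V] [InnerProductSpace ℝ V]

/-- Lemma 2.2, orthogonality of facet normals: if the facet `F'` of the
`r_α`-invariant full-dimensional polytope `P` satisfies `r_α(F') = F'`, then any
nonzero vector `u` exposing `F'` satisfies `⟪u, α⟫ = 0`. -/
theorem statement_5 {V : Type*} [NormedAddCommGroup V] [InnerProductSpace ℝ V]
    [FiniteDimensional ℝ V] (hn : 1 ≤ Module.finrank ℝ V)
    (P : Set V) (hP : ∃ A : Set V, A.Finite ∧ P = convexHull ℝ A)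
    (hfull : (interior P).Nonempty)
    (α : V) (hα : α ≠ 0) (hsym : reflMap α '' P = P)
    (F' : Set V) (hF' : IsFacet P F') (hFsym : reflMap α '' F' = F')
    (u : V) (hu : u ≠ 0)
    (hexp : F' = {x ∈ P | ∀ y ∈ P, ⟪u, y⟫ ≤ ⟪u, x⟫}) :
    ⟪u, α⟫ = 0 := by
  obtain ⟨A, hA, rfl⟩ := hP
  have hαα : ⟪α, α⟫ ≠ 0 := inner_self_ne_zero.mpr hα
  obtain ⟨x₀, hx₀, hmax⟩ := (hA.isCompact_convexHull (𝕜 := ℝ)).exists_isMaxOn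
    (hfull.mono interior_subset) (f := fun y => ⟪u, y⟫) (by fun_prop)
  have hx₀F : x₀ ∈ F' := by rw [hexp]; exact ⟨hx₀, fun y hy => hmax hy⟩
  have hconst : ∀ x ∈ F', ∀ y ∈ F', ⟪u, x⟫ = ⟪u, y⟫ := by
    intro x hx y hy
    rw [hexp] at hx hy
    exact le_antisymm (hy.2 x hx.1) (hx.2 y hy.1)
  by_cases hF : ∃ x ∈ F', ⟪x, α⟫ ≠ 0
  · obtain ⟨x, hx, hxα⟩ := hF
    have hrx : reflMap α x ∈ F' := hFsym ▸ Set.mem_image_of_mem _ hx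
    have h := hconst _ hrx _ hx
    rw [reflMap, inner_sub_right, real_inner_smul_right, sub_eq_self] at h
    exact (mul_eq_zero.mp h).resolve_left (div_ne_zero (mul_ne_zero two_ne_zero hxα) hαα)
  push Not at hF
  have hspan : vectorSpan ℝ F' ≤ (ℝ ∙ α)ᗮ := by
    rw [vectorSpan, Submodule.span_le]
    rintro _ ⟨x, hx, y, hy, rfl⟩
    simp [Submodule.mem_orthogonal_singleton_iff_inner_left, inner_sub_left, hF x hx, hF y hy]
  have hspan_u : vectorSpan ℝ F' ≤ (ℝ ∙ u)ᗮ := by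
    rw [vectorSpan, Submodule.span_le]
    rintro _ ⟨x, hx, y, hy, rfl⟩
    simp [Submodule.mem_orthogonal_singleton_iff_inner_right, inner_sub_right, hconst x hx y hy]
  have heq : vectorSpan ℝ F' = (ℝ ∙ α)ᗮ := by
    refine Submodule.eq_of_le_of_finrank_eq hspan ?_
    have h₁ := hF'.2
    rw [direction_affineSpan] at h₁
    have h₂ := (ℝ ∙ α).finrank_add_finrank_orthogonal
    rw [finrank_span_singleton hα] at h₂
    omega
  have hu_mem : u ∈ ℝ ∙ α := by
    rw [← Submodule.orthogonal_orthogonal (ℝ ∙ α), ← heq]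
    exact Submodule.orthogonal_le hspan_u
      (Submodule.le_orthogonal_orthogonal _ (Submodule.mem_span_singleton_self u))
  obtain ⟨c, rfl⟩ := Submodule.mem_span_singleton.mp hu_mem
  have hc : c ≠ 0 := fun h => hu (by simp [h])
  have hle : ∀ y ∈ convexHull ℝ A, c * ⟪y, α⟫ ≤ 0 := by
    intro y hy
    have h : ⟪c • α, y⟫ ≤ ⟪c • α, x₀⟫ := hmax hy
    rwa [real_inner_smul_left, real_inner_smul_left, real_inner_comm, real_inner_comm x₀,
      hF x₀ hx₀F, mul_zero] at h
  have hsub : convexHull ℝ A ⊆ ((ℝ ∙ α)ᗮ : Submodule ℝ V) := by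
    intro y hy
    have h := hle _ (hsym ▸ Set.mem_image_of_mem (reflMap α) hy)
    have hr : ⟪reflMap α y, α⟫ = -⟪y, α⟫ := by
      rw [reflMap, inner_sub_left, real_inner_smul_left, div_mul_cancel₀ _ hαα]
      ring
    rw [hr] at h
    have h₀ : c * ⟪y, α⟫ = 0 := le_antisymm (hle y hy) (by linarith)
    exact Submodule.mem_orthogonal_singleton_iff_inner_left.mpr
      ((mul_eq_zero.mp h₀).resolve_left hc)
  have htop := Submodule.eq_top_of_nonempty_interior' _ (hfull.mono (interior_mono hsub))
  exact absurd (Submodule.mem_orthogonal_singleton_iff_inner_left.mp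
    (htop ▸ Submodule.mem_top : α ∈ (ℝ ∙ α)ᗮ)) hαα
end
end
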